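/- Let Ω ⊆ ℝⁿ be open and bounded, Ω± = Ω∩{±xₙ>0}, Γ = Ω∩{xₙ=0}, and fix [λ,Λ] ⊆ (0,∞). Assume H₋ satisfies (H₋) and H₊ satisfies (H₊) as in the comparison theorem, and that at least one of the following holds: (Mz) there is λ₀ > 0 such that for all h ≥ 0, H₋(p,z+h,x) ≥ H₋(p,z,x) + λ₀h and H₊(M,p,z+h,x) ≥ H₊(M,p,z,x) + λ₀h; (Mp) there are λ₀ > 0 and a unit vector e such that for all h ≥ 0, H₋(p+he,z,x) ≥ H₋(p,z,x) + λ₀h and H₊(M,p+he,z,x) ≥ H₊(M,p,z,x) + λ₀h; (C) H₋ and H₊ are independent of z and convex in their remaining arguments (M,p) (resp. p) for each x, and there exist β ∈ C²(closure(Ω)) and η̄ > 0 with H₋(Dβ(x),β(x),x) + η̄ ≤ 0 for all x ∈ Ω₋∪Γ and H₊(D²β(x),Dβ(x),β(x),x) + η̄ ≤ 0 for all x ∈ Ω₊. Let u, v ∈ C(closure(Ω)) ∩ C^{0,1}(Ω₋), where u is a viscosity sub-solution of {H₋u ≤ 0 in Ω₋∪Γ, H₊u ≤ 0 in Ω₊}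 and v is a viscosity super-solution of {H₋v ≥ 0 in Ω₋∪Γ, H₊v ≥ 0 in Ω₊}. If u ≤ v on ∂Ω, then u ≤ v in Ω. -/

import Mathlib

open Metric Set Filter Topology Bornology

noncomputable section

abbrev Euc (n : ℕ) := EuclideanSpace ℝ (Fin n)

/-- Hessian matrix of a function at a point (second iterated Fréchet derivative,
a purely local notion). -/
def hessianMatrix {n : ℕ} (φ : Euc n → ℝ) (x : Euc n) : Matrix (Fin n) (Fin n) ℝ :=
  Matrix.of fun i j =>
    iteratedFDeriv ℝ 2 φ x ![EuclideanSpace.single i (1 : ℝ), EuclideanSpace.single j (1 : ℝ)]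

/-- Evaluation of a second-order operator on a C² function. -/
def evalOp2 {n : ℕ} (H : Matrix (Fin n) (Fin n) ℝ → Euc n → ℝ → Euc n → ℝ)
    (φ : Euc n → ℝ) (x : Euc n) : ℝ :=
  H (hessianMatrix φ x) (gradient φ x) (φ x) x

/-- Evaluation of a first-order operator on a differentiable function. -/
def evalOp1 {n : ℕ} (H : Euc n → ℝ → Euc n → ℝ) (φ : Euc n → ℝ) (x : Euc n) : ℝ :=
  H (gradient φ x) (φ x) x

/-- Degenerate ellipticity of a second-order operator on `S`. -/
def DegElliptic2 {n : ℕ} (S : Set (Euc n))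
    (H : Matrix (Fin n) (Fin n) ℝ → Euc n → ℝ → Euc n → ℝ) : Prop :=
  ∀ M₁ M₂ : Matrix (Fin n) (Fin n) ℝ, ∀ p : Euc n, ∀ z₁ z₂ : ℝ, ∀ x ∈ S,
    (M₁ - M₂).PosSemidef → z₁ ≤ z₂ → H M₁ p z₁ x ≤ H M₂ p z₂ x

/-- A first-order operator is degenerate elliptic (nondecreasing in `z`) on `S`. -/
def DegElliptic1 {n : ℕ} (S : Set (Euc n)) (H : Euc n → ℝ → Euc n → ℝ) : Prop :=
  ∀ p : Euc n, ∀ z₁ z₂ : ℝ, ∀ x ∈ S, z₁ ≤ z₂ → H p z₁ x ≤ H p z₂ x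

/-- A first-order operator has bounded sub-level sets on `S`. -/
def BoundedSublevels1 {n : ℕ} (S : Set (Euc n)) (H : Euc n → ℝ → Euc n → ℝ) : Prop :=
  ∀ z c : ℝ, Bornology.IsBounded {p : Euc n | ∃ x ∈ S, H p z x ≤ c}

/-- The set of symmetric matrices `A` with `λ I ≤ A ≤ Λ I`. -/
def pucciSet (n : ℕ) (l L : ℝ) : Set (Matrix (Fin n) (Fin n) ℝ) :=
  {A | (A - l • (1 : Matrix (Fin n) (Fin n) ℝ)).PosSemidef ∧
       ((L • (1 : Matrix (Fin n) (Fin n) ℝ)) - A).PosSemidef}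

/-- Pucci maximal operator `𝓜⁺_{λ,Λ}`. -/
def pucciPlus {n : ℕ} (l L : ℝ) (M : Matrix (Fin n) (Fin n) ℝ) : ℝ :=
  sSup ((fun A : Matrix (Fin n) (Fin n) ℝ => -(A * M).trace) '' pucciSet n l L)

/-- Pucci minimal operator `𝓜⁻_{λ,Λ}`. -/
def pucciMinus {n : ℕ} (l L : ℝ) (M : Matrix (Fin n) (Fin n) ℝ) : ℝ :=
  sInf ((fun A : Matrix (Fin n) (Fin n) ℝ => -(A * M).trace) '' pucciSet n l L)

/-- Uniform ellipticity of a translation invariant operator `F` w.r.t. `[λ, Λ]`. -/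
def UnifEllipticF {n : ℕ} (l L : ℝ) (F : Matrix (Fin n) (Fin n) ℝ → Euc n → ℝ → ℝ) : Prop :=
  ∀ M₁ M₂ : Matrix (Fin n) (Fin n) ℝ, ∀ p₁ p₂ : Euc n, ∀ z₁ z₂ : ℝ,
    pucciMinus l L (M₂ - M₁) - L * ‖p₂ - p₁‖ - L * max (-(z₂ - z₁)) 0
        ≤ F M₂ p₂ z₂ - F M₁ p₁ z₁ ∧
      F M₂ p₂ z₂ - F M₁ p₁ z₁
        ≤ pucciPlus l L (M₂ - M₁) + L * ‖p₂ - p₁‖ + L * max (z₂ - z₁) 0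

/-- A first-order operator is locally Lipschitz on `ℝⁿ × ℝ × S`. -/
def LocallyLipschitzOp1 {n : ℕ} (S : Set (Euc n)) (H : Euc n → ℝ → Euc n → ℝ) : Prop :=
  ∀ q : Euc n × ℝ × Euc n, q.2.2 ∈ S →
    ∃ K : NNReal, ∃ t ∈ 𝓝[univ ×ˢ univ ×ˢ S] q,
      LipschitzOnWith K (fun q' : Euc n × ℝ × Euc n => H q'.1 q'.2.1 q'.2.2) t

/-- A first-order operator is quasi-convex: its sub-level sets in `(p, z)` are convex. -/
def QuasiConvex1 {n : ℕ} (S : Set (Euc n)) (H : Euc n → ℝ → Euc n → ℝ) : Prop :=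
  ∀ x ∈ S, ∀ c : ℝ, Convex ℝ {q : Euc n × ℝ | H q.1 q.2 x ≤ c}

/-- `φ` is an admissible C² test function touching `u` from above at `x₀` on `ball x₀ r ⊆ Ω`. -/
def SubTest {n : ℕ} (Ω : Set (Euc n)) (u : Euc n → ℝ) (x₀ : Euc n)
    (φ : Euc n → ℝ) (r : ℝ) : Prop :=
  0 < r ∧ ball x₀ r ⊆ Ω ∧ ContDiffOn ℝ 2 φ (ball x₀ r) ∧
    (∀ x ∈ ball x₀ r, u x ≤ φ x) ∧ u x₀ = φ x₀

/-- `φ` is an admissible C² test function touching `u` from below at `x₀` on `ball x₀ r ⊆ Ω`. -/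
def SupTest {n : ℕ} (Ω : Set (Euc n)) (u : Euc n → ℝ) (x₀ : Euc n)
    (φ : Euc n → ℝ) (r : ℝ) : Prop :=
  0 < r ∧ ball x₀ r ⊆ Ω ∧ ContDiffOn ℝ 2 φ (ball x₀ r) ∧
    (∀ x ∈ ball x₀ r, φ x ≤ u x) ∧ u x₀ = φ x₀

section Alexandrov

open MeasureTheory

variable {E : Type*} [NormedAddCommGroup E] [InnerProductSpace ℝ E]

/-- `m` is a (global) subgradient of `f` at `x`. -/
def IsSubgrad (f : E → ℝ) (x m : E) : Prop := ∀ y, f x + inner ℝ m (y - x) ≤ f y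

/-- `f` has a subgradient of norm at most `R` at every point. -/
def BddSubgrad (R : ℝ) (f : E → ℝ) : Prop := ∀ x, ∃ m, ‖m‖ ≤ R ∧ IsSubgrad f x m

theorem BddSubgrad.sub_le {R : ℝ} {f : E → ℝ} (hf : BddSubgrad R f) (x y : E) :
    f x - f y ≤ R * ‖x - y‖ := by
  obtain ⟨m, hm, h⟩ := hf x
  have h1 := h y
  have h2 : -inner ℝ m (y - x) ≤ ‖m‖ * ‖x - y‖ := by
    rw [← inner_neg_right, neg_sub]; exact real_inner_le_norm _ _
  have := mul_le_mul_of_nonneg_right hm (norm_nonneg (x - y))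
  linarith

theorem BddSubgrad.nonneg {R : ℝ} {f : E → ℝ} (hf : BddSubgrad R f) : 0 ≤ R := by
  obtain ⟨m, hm, -⟩ := hf 0
  exact (norm_nonneg m).trans hm

theorem BddSubgrad.continuous {R : ℝ} {f : E → ℝ} (hf : BddSubgrad R f) : Continuous f := by
  have : LipschitzWith R.toNNReal f := LipschitzWith.of_le_add_mul _ fun x y => by
    rw [Real.coe_toNNReal _ hf.nonneg, dist_eq_norm]
    linarith [hf.sub_le x y]
  exact this.continuous

theorem IsSubgrad.monotone {f : E → ℝ} {x₁ x₂ m₁ m₂ : E} (h₁ : IsSubgrad f x₁ m₁)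
    (h₂ : IsSubgrad f x₂ m₂) : 0 ≤ inner ℝ (m₁ - m₂) (x₁ - x₂) := by
  have a := h₁ x₂
  have b := h₂ x₁
  have c : inner ℝ m₁ (x₂ - x₁) = - inner ℝ m₁ (x₁ - x₂) := by rw [← inner_neg_right, neg_sub]
  rw [inner_sub_left]
  linarith

/-- The proximal map is everywhere defined. -/
theorem BddSubgrad.exists_prox [FiniteDimensional ℝ E] {R : ℝ} {f : E → ℝ} (hf : BddSubgrad R f)
    (y : E) : ∃ x, IsSubgrad f x (y - x) := by
  have hR := hf.nonneg
  have hcont : Continuous fun x => f x + ‖x - y‖ ^ 2 / 2 := by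
    have := hf.continuous
    fun_prop
  obtain ⟨x, hx, hmin⟩ := (isCompact_closedBall y (2 * R)).exists_isMinOn
    ⟨y, mem_closedBall_self (by positivity)⟩ hcont.continuousOn
  have hglob : ∀ z, f x + ‖x - y‖ ^ 2 / 2 ≤ f z + ‖z - y‖ ^ 2 / 2 := by
    intro z
    by_cases hz : z ∈ closedBall y (2 * R)
    · exact hmin hz
    · have h1 : f x + ‖x - y‖ ^ 2 / 2 ≤ f y + ‖y - y‖ ^ 2 / 2 :=
        hmin (mem_closedBall_self (by positivity))
      have h2 := hf.sub_le y z
      rw [mem_closedBall, dist_eq_norm, not_le] at hz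
      rw [norm_sub_rev y z] at h2
      simp only [sub_self, norm_zero] at h1
      nlinarith [norm_nonneg (z - y)]
  refine ⟨x, fun z => ?_⟩
  have key : ∀ t : ℝ, 0 < t → t ≤ 1 →
      inner ℝ (y - x) (z - x) - t / 2 * ‖z - x‖ ^ 2 ≤ f z - f x := by
    intro t ht ht1
    obtain ⟨m, -, hm⟩ := hf (x + t • (z - x))
    have a := hm x
    have b := hm z
    have c := hglob (x + t • (z - x))
    have e1 : x - (x + t • (z - x)) = (-t) • (z - x) := by module
    have e2 : z - (x + t • (z - x)) = (1 - t) • (z - x) := by module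
    have e3 : x + t • (z - x) - y = t • (z - x) - (y - x) := by module
    rw [e1, inner_smul_right] at a
    rw [e2, inner_smul_right] at b
    rw [e3, norm_sub_sq_real (t • (z - x)), norm_smul, mul_pow, inner_smul_left,
      Real.norm_of_nonneg ht.le, norm_sub_rev x y, real_inner_comm] at c
    simp only [conj_trivial] at c
    have d : f (x + t • (z - x)) ≤ (1 - t) * f x + t * f z := by nlinarith
    have e : t * (inner ℝ (y - x) (z - x) - t / 2 * ‖z - x‖ ^ 2) ≤ t * (f z - f x) := by
      nlinarith
    exact le_of_mul_le_mul_left e ht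
  have hlim : Tendsto (fun t : ℝ => inner ℝ (y - x) (z - x) - t / 2 * ‖z - x‖ ^ 2) (𝓝[>] 0)
      (𝓝 (inner ℝ (y - x) (z - x) - 0 / 2 * ‖z - x‖ ^ 2)) := by
    apply Tendsto.mono_left _ nhdsWithin_le_nhds
    apply Continuous.tendsto
    fun_prop
  have := le_of_tendsto hlim (by
    filter_upwards [Ioo_mem_nhdsGT (show (0 : ℝ) < 1 by norm_num)] with t ht
    exact key t ht.1 ht.2.le)
  simp only [zero_div, zero_mul, sub_zero] at this
  linarith

theorem prox_lipschitz {f : E → ℝ} {J : E → E} (hJ : ∀ y, IsSubgrad f (J y) (y - J y)) :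
    LipschitzWith 1 J := by
  refine LipschitzWith.of_dist_le_mul fun y₁ y₂ => ?_
  have h := (hJ y₁).monotone (hJ y₂)
  have e : y₁ - J y₁ - (y₂ - J y₂) = (y₁ - y₂) - (J y₁ - J y₂) := by abel
  rw [e, inner_sub_left, real_inner_self_eq_norm_sq] at h
  have h2 := real_inner_le_norm (y₁ - y₂) (J y₁ - J y₂)
  rw [dist_eq_norm, dist_eq_norm, NNReal.coe_one, one_mul]
  by_contra hc
  push Not at hc
  nlinarith [norm_nonneg (y₁ - y₂)]

theorem prox_eq {f : E → ℝ} {J : E → E} (hJ : ∀ y, IsSubgrad f (J y) (y - J y)) {x m : E}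
    (hm : IsSubgrad f x m) : J (x + m) = x := by
  have h := (hJ (x + m)).monotone hm
  have e : x + m - J (x + m) - m = - (J (x + m) - x) := by abel
  rw [e, inner_neg_left, real_inner_self_eq_norm_sq] at h
  have : ‖J (x + m) - x‖ ^ 2 = 0 := le_antisymm (by linarith) (sq_nonneg _)
  exact sub_eq_zero.1 (norm_eq_zero.1 (pow_eq_zero_iff (two_ne_zero) |>.1 this))

/-- The conjugate of `f + ‖·‖²/2`, expressed through the proximal map `J`. -/
def proxConj (f : E → ℝ) (J : E → E) (y : E) : ℝ := inner ℝ (J y) y - f (J y) - ‖J y‖ ^ 2 / 2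

theorem proxConj_ge {f : E → ℝ} {J : E → E} (hJ : ∀ y, IsSubgrad f (J y) (y - J y)) (x y : E) :
    inner ℝ x y - f x - ‖x‖ ^ 2 / 2 ≤ proxConj f J y := by
  have h := hJ y x
  have h2 : 0 ≤ ‖x - J y‖ ^ 2 := sq_nonneg _
  rw [norm_sub_sq_real] at h2
  rw [inner_sub_left, inner_sub_right, inner_sub_right, real_inner_self_eq_norm_sq,
    real_inner_comm x y, real_inner_comm (J y) y, real_inner_comm x (J y)] at h
  unfold proxConj
  linarith

theorem hasFDerivAt_proxConj {f : E → ℝ} {J : E → E} (hJ : ∀ y, IsSubgrad f (J y) (y - J y))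
    (y : E) : HasFDerivAt (proxConj f J) (innerSL ℝ (J y)) y := by
  rw [hasFDerivAt_iff_isLittleO_nhds_zero]
  have hb : ∀ k, ‖proxConj f J (y + k) - proxConj f J y - innerSL ℝ (J y) k‖ ≤ 1 * ‖‖k‖ ^ 2‖ := by
    intro k
    have h1 := proxConj_ge hJ (J y) (y + k)
    have h2 := proxConj_ge hJ (J (y + k)) y
    have h3 := (prox_lipschitz hJ).dist_le_mul (y + k) y
    rw [dist_eq_norm, dist_eq_norm, add_sub_cancel_left, NNReal.coe_one, one_mul] at h3
    have h4 := real_inner_le_norm (J (y + k) - J y) k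
    have h5 := mul_le_mul_of_nonneg_right h3 (norm_nonneg k)
    have d1 : proxConj f J y = inner ℝ (J y) y - f (J y) - ‖J y‖ ^ 2 / 2 := rfl
    have d2 : proxConj f J (y + k) =
      inner ℝ (J (y + k)) (y + k) - f (J (y + k)) - ‖J (y + k)‖ ^ 2 / 2 := rfl
    rw [inner_add_right] at h1 d2
    rw [inner_sub_left] at h4
    rw [innerSL_apply_apply, Real.norm_eq_abs, one_mul, Real.norm_of_nonneg (sq_nonneg _), abs_le]
    constructor <;> nlinarith [norm_nonneg k]
  refine (Asymptotics.IsBigO.of_bound 1 (Eventually.of_forall hb)).trans_isLittleO ?_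
  simpa using (Asymptotics.isLittleO_norm_pow_id (E' := E) (n := 2) one_lt_two)

end Alexandrov

section AlexandrovExpansion

open MeasureTheory

variable {E : Type*} [NormedAddCommGroup E] [InnerProductSpace ℝ E]

theorem proxConj_symm {f : E → ℝ} {J : E → E} (hJ : ∀ y, IsSubgrad f (J y) (y - J y))
    {y : E} {T : E →L[ℝ] E} (hT : HasFDerivAt J T y) (a b : E) :
    inner ℝ (T a) b = inner ℝ (T b) a := by
  let B : E →L[ℝ] E →L[ℝ] ℝ := (isBoundedBilinearMap_inner (𝕜 := ℝ) (E := E)).toContinuousLinearMap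
  have h1 : ∀ z, HasFDerivAt (proxConj f J) (B (J z)) z := fun z => by
    convert hasFDerivAt_proxConj hJ z using 1
    ext v; rfl
  have h2 : HasFDerivAt (fun z => B (J z)) (B.comp T) y := B.hasFDerivAt.comp y hT
  exact second_derivative_symmetric h1 h2 a b

theorem proxConj_expansion {f : E → ℝ} {J : E → E} (hJ : ∀ y, IsSubgrad f (J y) (y - J y))
    {y : E} {T : E →L[ℝ] E} (hT : HasFDerivAt J T y) {η : ℝ} (hη : 0 < η) :
    ∃ r > 0, ∀ k, ‖k‖ ≤ r → ‖J (y + k) - J y - T k‖ ≤ η * ‖k‖ ∧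
      |proxConj f J (y + k) - proxConj f J y - inner ℝ (J y) k - inner ℝ (T k) k / 2|
        ≤ η * ‖k‖ ^ 2 := by
  have hlo := hasFDerivAt_iff_isLittleO_nhds_zero.1 hT
  obtain ⟨r, hr, hball⟩ := Metric.nhds_basis_closedBall.eventually_iff.1 (hlo.def hη)
  have hb : ∀ k : E, ‖k‖ ≤ r → ‖J (y + k) - J y - T k‖ ≤ η * ‖k‖ := fun k hk =>
    hball (by simpa using hk)
  refine ⟨r, hr, fun k hk => ⟨hb k hk, ?_⟩⟩
  let φ : E → ℝ := fun k => proxConj f J (y + k) - inner ℝ (J y) k - inner ℝ (T k) k / 2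
  have hφ : ∀ k, HasFDerivAt φ (innerSL ℝ (J (y + k) - J y - T k)) k := by
    intro k
    have h1 : HasFDerivAt (fun k => proxConj f J (y + k)) (innerSL ℝ (J (y + k))) k := by
      have := (hasFDerivAt_proxConj hJ (y + k)).comp k ((hasFDerivAt_id k).const_add y)
      simpa [Function.comp_def] using this
    have h2 : HasFDerivAt (fun k => inner ℝ (J y) k) (innerSL ℝ (J y)) k :=
      (innerSL ℝ (J y)).hasFDerivAt
    have h3 := ((T.hasFDerivAt (x := k)).inner ℝ (hasFDerivAt_id k)).mul_const (1 / 2 : ℝ)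
    refine (((h1.sub h2).sub h3).congr_fderiv ?_).congr_of_eventuallyEq
      (Eventually.of_forall fun z => ?_)
    · ext v
      simp [fderivInnerCLM_apply, proxConj_symm hJ hT v k]
      ring
    · simp [φ, div_eq_mul_inv]
  have hmv := (convex_closedBall (0 : E) ‖k‖).norm_image_sub_le_of_norm_hasFDerivWithin_le
    (f := φ) (C := η * ‖k‖) (x := 0) (y := k)
    (fun z _ => (hφ z).hasFDerivWithinAt) (fun z hz => by
      rw [innerSL_apply_norm]
      have hz' : ‖z‖ ≤ ‖k‖ := by simpa using hz
      exact (hb z (hz'.trans hk)).trans (by gcongr)) (by simp) (by simp)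
  simp only [φ, add_zero, inner_zero_right, zero_div, sub_zero, Real.norm_eq_abs] at hmv
  calc _ = |proxConj f J (y + k) - inner ℝ (J y) k - inner ℝ (T k) k / 2 - proxConj f J y| := by
        ring_nf
    _ ≤ _ := hmv
    _ = _ := by ring

theorem prox_deriv_coercive [FiniteDimensional ℝ E] {f : E → ℝ} {J : E → E}
    (hJ : ∀ y, IsSubgrad f (J y) (y - J y)) {y : E} {T : E →L[ℝ] E} (hT : HasFDerivAt J T y)
    (hinj : Function.Injective T) : ∃ τ > 0, ∀ k, τ * ‖k‖ ^ 2 ≤ inner ℝ (T k) k := by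
  have h1 : ∀ k, ‖T k‖ ^ 2 ≤ inner ℝ (T k) k := by
    intro k
    have hd : HasDerivAt (fun t : ℝ => J (y + t • k)) (T k) 0 := by
      have hl : HasDerivAt (fun t : ℝ => y + t • k) k 0 := by
        simpa using ((hasDerivAt_id (0 : ℝ)).smul_const k).const_add y
      have hT' : HasFDerivAt J T (y + (0 : ℝ) • k) := by simpa using hT
      exact hT'.comp_hasDerivAt 0 hl
    have hs := hd.tendsto_slope_zero
    refine le_of_tendsto_of_tendsto (hs.norm.pow 2) (hs.inner tendsto_const_nhds)
      (Filter.eventually_of_mem self_mem_nhdsWithin fun t ht => ?_)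
    have ht : t ≠ 0 := ht
    have hm := (hJ (y + t • k)).monotone (hJ y)
    simp only [zero_add, zero_smul, add_zero]
    set D := J (y + t • k) - J y with hD
    have e : y + t • k - J (y + t • k) - (y - J y) = t • k - D := by rw [hD]; abel
    rw [e, inner_sub_left, inner_smul_left, real_inner_self_eq_norm_sq] at hm
    simp only [conj_trivial] at hm
    rw [norm_smul, mul_pow, inner_smul_left, real_inner_comm]
    simp only [conj_trivial, norm_inv, Real.norm_eq_abs, inv_pow, sq_abs]
    have h2 : (t ^ 2)⁻¹ * ‖D‖ ^ 2 ≤ (t ^ 2)⁻¹ * (t * inner ℝ k D) := by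
      gcongr; linarith
    calc _ ≤ _ := h2
      _ = _ := by field_simp
  obtain ⟨K, hK, hanti⟩ := (T : E →ₗ[ℝ] E).exists_antilipschitzWith (LinearMap.ker_eq_bot.2 hinj)
  refine ⟨(K : ℝ)⁻¹ ^ 2, by positivity, fun k => ?_⟩
  have h2 : ‖k‖ ≤ K * ‖T k‖ := by simpa using hanti.le_mul_dist k 0
  have hK' : (0 : ℝ) < K := hK
  have h3 : (K : ℝ)⁻¹ * ‖k‖ ≤ ‖T k‖ := by rw [inv_mul_le_iff₀ hK']; exact h2
  calc (K : ℝ)⁻¹ ^ 2 * ‖k‖ ^ 2 = ((K : ℝ)⁻¹ * ‖k‖) ^ 2 := by ring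
    _ ≤ ‖T k‖ ^ 2 := by gcongr
    _ ≤ _ := h1 k

theorem BddSubgrad.second_order_expansion [FiniteDimensional ℝ E] {R : ℝ} {f : E → ℝ}
    (hf : BddSubgrad R f) {J : E → E} (hJ : ∀ y, IsSubgrad f (J y) (y - J y)) {y : E}
    {T : E →L[ℝ] E} (hT : HasFDerivAt J T y) (hinj : Function.Injective T) :
    ∃ S : E →L[ℝ] E, (∀ a b, inner ℝ (S a) b = inner ℝ (S b) a) ∧ ∀ η > 0, ∀ᶠ h in 𝓝 (0 : E),
      |f (J y + h) - f (J y) - inner ℝ (y - J y) h - inner ℝ (S h) h / 2| ≤ η * ‖h‖ ^ 2 := by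
  obtain ⟨τ, hτ, hcoer⟩ := prox_deriv_coercive hJ hT hinj
  let e := LinearEquiv.ofInjectiveEndo (T : E →ₗ[ℝ] E) hinj
  let Ti : E →L[ℝ] E := LinearMap.toContinuousLinearMap (e.symm : E →ₗ[ℝ] E)
  have hTTi : ∀ h, T (Ti h) = h := fun h => e.apply_symm_apply h
  have hTisymm : ∀ a b, inner ℝ (Ti a) b = inner ℝ (Ti b) a := fun a b => by
    have := proxConj_symm hJ hT (Ti a) (Ti b)
    rw [hTTi, hTTi] at this
    rw [real_inner_comm, ← this, real_inner_comm]
  refine ⟨Ti - ContinuousLinearMap.id ℝ E, fun a b => ?_, fun η hη => ?_⟩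
  · simp only [sub_apply, ContinuousLinearMap.id_apply, inner_sub_left, hTisymm a b,
      real_inner_comm a b]
  set x := J y with hx
  set C := ‖Ti‖ + 4 / τ + 1 with hC
  have hCpos : 0 < C := by positivity
  set η' := min (τ / 2) (η / C ^ 2) with hη'
  have hη'pos : 0 < η' := lt_min (by positivity) (by positivity)
  have hη'C : η' * C ^ 2 ≤ η := by
    rw [← le_div_iff₀ (by positivity)]; exact min_le_right _ _
  obtain ⟨r, hr, hexp⟩ := proxConj_expansion hJ hT hη'pos
  simp only [← hx] at hexp
  have hsmall : ∀ᶠ h in 𝓝 (0 : E), C * ‖h‖ < r := by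
    have : Tendsto (fun h : E => C * ‖h‖) (𝓝 0) (𝓝 (C * ‖(0 : E)‖)) :=
      Continuous.tendsto (by fun_prop) 0
    rw [norm_zero, mul_zero] at this
    exact this.eventually_lt_const hr
  filter_upwards [hsmall] with h hh
  rcases eq_or_ne h 0 with rfl | hne
  · simp
  have hhpos : 0 < ‖h‖ := norm_pos_iff.2 hne
  have hnorm : ‖x + h‖ ^ 2 = ‖x‖ ^ 2 + 2 * inner ℝ x h + ‖h‖ ^ 2 := norm_add_sq_real x h
  have herr : ∀ k : E, ‖k‖ ≤ C * ‖h‖ → η' * ‖k‖ ^ 2 ≤ η * ‖h‖ ^ 2 := fun k hk => by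
    calc η' * ‖k‖ ^ 2 ≤ η' * (C * ‖h‖) ^ 2 := by gcongr
      _ = η' * C ^ 2 * ‖h‖ ^ 2 := by ring
      _ ≤ η * ‖h‖ ^ 2 := by gcongr
  have hcy : proxConj f J y = inner ℝ x y - f x - ‖x‖ ^ 2 / 2 := rfl
  simp only [sub_apply, ContinuousLinearMap.id_apply, inner_sub_left, real_inner_self_eq_norm_sq]
  rw [abs_le]
  constructor
  · have hk : ‖Ti h‖ ≤ C * ‖h‖ := (Ti.le_opNorm h).trans (by
      gcongr; rw [hC]; linarith [show 0 < 4 / τ by positivity])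
    have h1 := (abs_le.1 (hexp (Ti h) (hk.trans hh.le)).2).2
    have h2 := proxConj_ge hJ (x + h) (y + Ti h)
    rw [hTTi] at h1
    simp only [inner_add_left, inner_add_right] at h2
    have := herr _ hk
    rw [real_inner_comm h (Ti h)]
    linarith [real_inner_comm y h]
  · obtain ⟨m', -, hm'⟩ := hf (x + h)
    have hJy' : J (x + h + m') = x + h := prox_eq hJ hm'
    obtain ⟨k, hk⟩ : ∃ k, x + h + m' = y + k := ⟨x + h + m' - y, by abel⟩
    rw [hk] at hJy'
    have hkle : ‖k‖ ≤ 4 / τ * ‖h‖ := by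
      by_contra hc
      push Not at hc
      have hr'pos : 0 < 4 / τ * ‖h‖ := by positivity
      have hkpos : 0 < ‖k‖ := hr'pos.trans hc
      set s := 4 / τ * ‖h‖ / ‖k‖ with hs
      have hspos : 0 < s := by positivity
      have hs1 : s < 1 := (div_lt_one hkpos).2 hc
      have hsk : ‖s • k‖ = 4 / τ * ‖h‖ := by
        rw [norm_smul, Real.norm_of_nonneg hspos.le, hs, div_mul_cancel₀ _ hkpos.ne']
      have hmono := (hJ (y + k)).monotone (hJ (y + s • k))
      have h1 := (hexp (s • k) (by
        rw [hsk]
        refine le_trans ?_ hh.le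
        gcongr
        rw [hC]; linarith [norm_nonneg Ti])).1
      have e1 : y + k - J (y + k) - (y + s • k - J (y + s • k)) =
        (1 - s) • k - (J (y + k) - J (y + s • k)) := by module
      rw [e1, inner_sub_left, inner_smul_left, real_inner_self_eq_norm_sq, hJy'] at hmono
      simp only [conj_trivial] at hmono
      set D := J (y + s • k) - x - T (s • k) with hD
      have e2 : x + h - J (y + s • k) = h - T (s • k) - D := by rw [hD]; abel
      rw [e2] at hmono
      have h3 : 0 ≤ inner ℝ k (h - T (s • k) - D) := by
        by_contra hneg
        push Not at hneg
        nlinarith [sq_nonneg ‖h - T (s • k) - D‖]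
      have h4 : 0 ≤ inner ℝ (s • k) (h - T (s • k) - D) := by
        rw [inner_smul_left]; exact mul_nonneg hspos.le h3
      rw [inner_sub_right, inner_sub_right] at h4
      have h5 := hcoer (s • k)
      have h6 := real_inner_le_norm (s • k) h
      have h7 : -inner ℝ (s • k) D ≤ ‖s • k‖ * ‖D‖ := by
        rw [← inner_neg_right, ← norm_neg D]; exact real_inner_le_norm _ _
      rw [real_inner_comm] at h5
      have h8 : ‖s • k‖ * ‖D‖ ≤ ‖s • k‖ * (η' * ‖s • k‖) := by gcongr
      have h9 : η' ≤ τ / 2 := min_le_left _ _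
      have h10 : ‖s • k‖ * (η' * ‖s • k‖) ≤ ‖s • k‖ * (τ / 2 * ‖s • k‖) := by gcongr
      have h11 : 0 ≤ ‖s • k‖ * (‖h‖ - τ / 2 * ‖s • k‖) := by nlinarith
      have h12 : τ / 2 * ‖s • k‖ = 2 * ‖h‖ := by rw [hsk]; field_simp; norm_num
      rw [h12, hsk] at h11
      nlinarith
    have hkC : ‖k‖ ≤ C * ‖h‖ := hkle.trans (by gcongr; rw [hC]; linarith [norm_nonneg Ti])
    have h1 := (abs_le.1 (hexp k (hkC.trans hh.le)).2).1
    have hc2 : proxConj f J (y + k) =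
      inner ℝ (x + h) (y + k) - f (x + h) - ‖x + h‖ ^ 2 / 2 := by rw [← hJy']; rfl
    simp only [inner_add_left, inner_add_right] at hc2
    have h2 : 0 ≤ inner ℝ (T (k - Ti h)) (k - Ti h) :=
      le_trans (by positivity) (hcoer (k - Ti h))
    rw [map_sub, hTTi, inner_sub_left, inner_sub_right, inner_sub_right,
      proxConj_symm hJ hT k (Ti h), hTTi] at h2
    have := herr _ hkC
    rw [real_inner_comm h (Ti h)]
    linarith [real_inner_comm y h]

/-- **Alexandrov's theorem** for convex functions with bounded subgradients. -/
theorem BddSubgrad.alexandrov [FiniteDimensional ℝ E] [MeasurableSpace E] [BorelSpace E]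
    {R : ℝ} {f : E → ℝ} (hf : BddSubgrad R f) :
    ∃ Z : Set E, μH[Module.finrank ℝ E] Z = 0 ∧ ∀ x ∉ Z, ∀ m, IsSubgrad f x m →
      ∃ S : E →L[ℝ] E, (∀ a b, inner ℝ (S a) b = inner ℝ (S b) a) ∧ ∀ η > 0, ∀ᶠ h in 𝓝 (0 : E),
        |f (x + h) - f x - inner ℝ m h - inner ℝ (S h) h / 2| ≤ η * ‖h‖ ^ 2 := by
  choose J hJ using hf.exists_prox
  have hlip := prox_lipschitz hJ
  let N₁ : Set E := {y | ¬ DifferentiableAt ℝ J y}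
  let N₂ : Set E := {y | DifferentiableAt ℝ J y ∧ (fderiv ℝ J y).det = 0}
  refine ⟨J '' N₁ ∪ J '' N₂, ?_, fun x hx m hm => ?_⟩
  · refine measure_union_null ?_ ?_
    · have h1 : μH[Module.finrank ℝ E] N₁ = 0 := by
        have := hlip.ae_differentiableAt (μ := (μH[Module.finrank ℝ E] : Measure E))
        exact this
      have := (hlip.lipschitzOnWith (s := N₁)).hausdorffMeasure_image_le
        (d := Module.finrank ℝ E) (by positivity)
      rw [h1, mul_zero] at this
      exact le_antisymm this zero_le
    · exact addHaar_image_eq_zero_of_det_fderivWithin_eq_zero _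
        (f' := fderiv ℝ J) (fun y hy => hy.1.hasFDerivAt.hasFDerivWithinAt) fun y hy => hy.2
  · have hJx : J (x + m) = x := prox_eq hJ hm
    have hd : DifferentiableAt ℝ J (x + m) := by
      by_contra hc
      exact hx (Or.inl ⟨x + m, hc, hJx⟩)
    have hdet : (fderiv ℝ J (x + m)).det ≠ 0 := fun hc =>
      hx (Or.inr ⟨x + m, ⟨hd, hc⟩, hJx⟩)
    have hinj : Function.Injective (fderiv ℝ J (x + m)) :=
      (LinearMap.equivOfDetNeZero (fderiv ℝ J (x + m) : E →ₗ[ℝ] E) hdet).injective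
    have := hf.second_order_expansion hJ hd.hasFDerivAt hinj
    rwa [hJx, add_sub_cancel_left] at this

end AlexandrovExpansion

section SumLemma

open MeasureTheory

variable {E : Type*} [NormedAddCommGroup E] [InnerProductSpace ℝ E]

theorem IsSubgrad.add {f g : E → ℝ} {x m₁ m₂ : E} (h₁ : IsSubgrad f x m₁)
    (h₂ : IsSubgrad g x m₂) : IsSubgrad (fun z => f z + g z) x (m₁ + m₂) := fun y => by
  have := h₁ y
  have := h₂ y
  rw [inner_add_left]
  linarith

theorem BddSubgrad.add {R₁ R₂ : ℝ} {f g : E → ℝ} (hf : BddSubgrad R₁ f) (hg : BddSubgrad R₂ g) :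
    BddSubgrad (R₁ + R₂) fun z => f z + g z := fun x => by
  obtain ⟨m₁, h₁, hs₁⟩ := hf x
  obtain ⟨m₂, h₂, hs₂⟩ := hg x
  exact ⟨m₁ + m₂, (norm_add_le _ _).trans (add_le_add h₁ h₂), hs₁.add hs₂⟩

/-- The function `φ - 2⟨G·,·⟩ - ⟨p,·⟩` has a global maximum at `ξ`. -/
def IsContact (φ : E → ℝ) (G : E →L[ℝ] E) (p ξ : E) : Prop :=
  ∀ h, φ (ξ + h) ≤ φ ξ + inner ℝ ((4 : ℝ) • G ξ + p) h + 2 * inner ℝ (G h) h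

theorem eq_zero_of_inner_le_sq {d : E} {C : ℝ} (h : ∀ k, inner ℝ d k ≤ C * ‖k‖ ^ 2) : d = 0 := by
  have key : ∀ t : ℝ, 0 < t → ‖d‖ ^ 2 ≤ t * (C * ‖d‖ ^ 2) := fun t ht => by
    have := h (t • d)
    rw [inner_smul_right, real_inner_self_eq_norm_sq, norm_smul, mul_pow,
      Real.norm_of_nonneg ht.le] at this
    have : t * ‖d‖ ^ 2 ≤ t * (t * (C * ‖d‖ ^ 2)) := by linarith
    exact le_of_mul_le_mul_left this ht
  have hlim : Tendsto (fun t : ℝ => t * (C * ‖d‖ ^ 2)) (𝓝[>] 0) (𝓝 (0 * (C * ‖d‖ ^ 2))) :=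
    ((continuous_id.mul continuous_const).tendsto 0).mono_left nhdsWithin_le_nhds
  have := ge_of_tendsto hlim (eventually_of_mem self_mem_nhdsWithin key)
  rw [zero_mul] at this
  exact norm_eq_zero.1 (pow_eq_zero_iff two_ne_zero |>.1 (le_antisymm this (sq_nonneg _)))

theorem inner_clm_le (G : E →L[ℝ] E) (h : E) : inner ℝ (G h) h ≤ ‖G‖ * ‖h‖ ^ 2 := by
  calc inner ℝ (G h) h ≤ ‖G h‖ * ‖h‖ := real_inner_le_norm _ _
    _ ≤ ‖G‖ * ‖h‖ * ‖h‖ := by gcongr; exact G.le_opNorm h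
    _ = _ := by ring

theorem IsContact.subgrad_eq {φ : E → ℝ} {G : E →L[ℝ] E} {p ξ m : E} (hc : IsContact φ G p ξ)
    (hm : IsSubgrad φ ξ m) : m = (4 : ℝ) • G ξ + p := by
  refine sub_eq_zero.1 (eq_zero_of_inner_le_sq (C := 2 * ‖G‖) fun k => ?_)
  have h1 := hc k
  have h2 := hm (ξ + k)
  rw [add_sub_cancel_left] at h2
  rw [inner_sub_left]
  linarith [inner_clm_le G k]

theorem IsContact.norm_sub_le {φ : E → ℝ} {R : ℝ} (hφ : BddSubgrad R φ) {G : E →L[ℝ] E}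
    {p₁ p₂ ξ₁ ξ₂ : E} (h₁ : IsContact φ G p₁ ξ₁) (h₂ : IsContact φ G p₂ ξ₂) :
    ‖p₁ - p₂‖ ≤ 12 * (‖G‖ + 1) * ‖ξ₁ - ξ₂‖ := by
  set C := ‖G‖ + 1 with hC
  have hCpos : 0 < C := by positivity
  obtain ⟨m₁, -, hm₁⟩ := hφ ξ₁
  obtain ⟨m₂, -, hm₂⟩ := hφ ξ₂
  have e₁ := h₁.subgrad_eq hm₁
  have e₂ := h₂.subgrad_eq hm₂
  set t : ℝ := 1 / (8 * C) with ht
  have htpos : 0 < t := by positivity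
  have a := h₁ (ξ₂ - ξ₁ + t • (m₂ - m₁))
  have b := hm₂ (ξ₂ + t • (m₂ - m₁))
  have c := hm₁ ξ₂
  have e3 : ξ₁ + (ξ₂ - ξ₁ + t • (m₂ - m₁)) = ξ₂ + t • (m₂ - m₁) := by abel
  rw [e3, ← e₁, inner_add_right, inner_smul_right] at a
  rw [add_sub_cancel_left, inner_smul_right] at b
  have d := inner_clm_le G (ξ₂ - ξ₁ + t • (m₂ - m₁))
  have e4 : inner ℝ m₂ (m₂ - m₁) - inner ℝ m₁ (m₂ - m₁) = ‖m₂ - m₁‖ ^ 2 := by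
    rw [← inner_sub_left, real_inner_self_eq_norm_sq]
  have e5 : ‖ξ₂ - ξ₁ + t • (m₂ - m₁)‖ ^ 2 ≤ 2 * (‖ξ₂ - ξ₁‖ ^ 2 + t ^ 2 * ‖m₂ - m₁‖ ^ 2) := by
    have := parallelogram_law_with_norm ℝ (ξ₂ - ξ₁) (t • (m₂ - m₁))
    have e6 : ‖t • (m₂ - m₁)‖ = t * ‖m₂ - m₁‖ := by rw [norm_smul, Real.norm_of_nonneg htpos.le]
    rw [e6] at this
    nlinarith [mul_self_nonneg ‖ξ₂ - ξ₁ - t • (m₂ - m₁)‖]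
  have e7 : ‖G‖ * ‖ξ₂ - ξ₁ + t • (m₂ - m₁)‖ ^ 2 ≤
      C * (2 * (‖ξ₂ - ξ₁‖ ^ 2 + t ^ 2 * ‖m₂ - m₁‖ ^ 2)) := by
    gcongr; rw [hC]; linarith
  have e8 : t * ‖m₂ - m₁‖ ^ 2 ≤ 4 * C * (‖ξ₂ - ξ₁‖ ^ 2 + t ^ 2 * ‖m₂ - m₁‖ ^ 2) := by
    have : t * ‖m₂ - m₁‖ ^ 2 = t * inner ℝ m₂ (m₂ - m₁) - t * inner ℝ m₁ (m₂ - m₁) := by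
      rw [← e4]; ring
    linarith
  have e9 : ‖m₂ - m₁‖ ^ 2 ≤ (8 * C * ‖ξ₂ - ξ₁‖) ^ 2 := by
    have : 4 * C * (t ^ 2 * ‖m₂ - m₁‖ ^ 2) = t * ‖m₂ - m₁‖ ^ 2 / 2 := by
      rw [ht]; field_simp; ring
    have h3 : t * ‖m₂ - m₁‖ ^ 2 ≤ 8 * C * ‖ξ₂ - ξ₁‖ ^ 2 := by linarith
    have h4 : 8 * C * (t * ‖m₂ - m₁‖ ^ 2) = ‖m₂ - m₁‖ ^ 2 := by rw [ht]; field_simp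
    rw [← h4]
    calc _ ≤ 8 * C * (8 * C * ‖ξ₂ - ξ₁‖ ^ 2) := by gcongr
      _ = _ := by ring
  have e10 : ‖m₂ - m₁‖ ≤ 8 * C * ‖ξ₂ - ξ₁‖ :=
    le_of_sq_le_sq e9 (by positivity)
  have e11 : p₁ - p₂ = (4 : ℝ) • G (ξ₂ - ξ₁) - (m₂ - m₁) := by
    rw [e₁, e₂, map_sub]; module
  rw [e11, norm_sub_rev ξ₁]
  have e12 : ‖(4 : ℝ) • G (ξ₂ - ξ₁)‖ ≤ 4 * (C * ‖ξ₂ - ξ₁‖) := by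
    rw [norm_smul, Real.norm_of_nonneg (by norm_num)]
    gcongr
    exact (G.le_opNorm _).trans (by gcongr; rw [hC]; linarith)
  calc _ ≤ _ := _root_.norm_sub_le _ _
    _ ≤ 4 * (C * ‖ξ₂ - ξ₁‖) + 8 * C * ‖ξ₂ - ξ₁‖ := add_le_add e12 e10
    _ = _ := by ring

theorem BddSubgrad.exists_isContact [FiniteDimensional ℝ E] {φ : E → ℝ} {R : ℝ}
    (hφ : BddSubgrad R φ) {G : E →L[ℝ] E} (hG : ∀ x y, inner ℝ (G x) y = inner ℝ (G y) x)
    {a : ℝ} (ha : 0 < a) (hGa : ∀ x, a * ‖x‖ ^ 2 ≤ inner ℝ (G x) x) (p : E) :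
    ∃ ξ, IsContact φ G p ξ := by
  have hR := hφ.nonneg
  set ρ := (R + ‖p‖) / (2 * a) with hρ
  have hρ0 : 0 ≤ ρ := by positivity
  have hcont : Continuous fun z => φ z - 2 * inner ℝ (G z) z - inner ℝ p z := by
    have := hφ.continuous
    fun_prop
  obtain ⟨ξ, -, hmax⟩ := (isCompact_closedBall (0 : E) ρ).exists_isMaxOn
    ⟨0, mem_closedBall_self hρ0⟩ hcont.continuousOn
  have hglob : ∀ z, φ z - 2 * inner ℝ (G z) z - inner ℝ p z ≤
      φ ξ - 2 * inner ℝ (G ξ) ξ - inner ℝ p ξ := by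
    intro z
    by_cases hz : z ∈ closedBall 0 ρ
    · exact hmax hz
    · have h0 : φ 0 - 2 * inner ℝ (G 0) 0 - inner ℝ p 0 ≤
        φ ξ - 2 * inner ℝ (G ξ) ξ - inner ℝ p ξ := hmax (mem_closedBall_self hρ0)
      refine le_trans ?_ h0
      simp only [inner_zero_right, mul_zero, sub_zero]
      have h1 := hφ.sub_le z 0
      rw [sub_zero] at h1
      have h2 := hGa z
      have h3 : -inner ℝ p z ≤ ‖p‖ * ‖z‖ := by
        rw [← inner_neg_right, ← norm_neg z]; exact real_inner_le_norm _ _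
      rw [mem_closedBall, dist_zero_right, not_le, hρ, div_lt_iff₀ (by positivity)] at hz
      nlinarith [norm_nonneg z]
  refine ⟨ξ, fun h => ?_⟩
  have h1 := hglob (ξ + h)
  simp only [map_add, inner_add_left, inner_add_right, inner_smul_left, conj_trivial] at h1 ⊢
  rw [hG h ξ] at h1
  linarith

/-- A form of **Jensen's lemma**: contact points under small linear perturbations are not
contained in a null set. -/
theorem BddSubgrad.exists_isContact_notMem [FiniteDimensional ℝ E] [MeasurableSpace E]
    [BorelSpace E] {φ : E → ℝ} {R : ℝ}
    (hφ : BddSubgrad R φ) {G : E →L[ℝ] E} (hG : ∀ x y, inner ℝ (G x) y = inner ℝ (G y) x)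
    {a : ℝ} (ha : 0 < a) (hGa : ∀ x, a * ‖x‖ ^ 2 ≤ inner ℝ (G x) x) {Z : Set E}
    (hZ : μH[Module.finrank ℝ E] Z = 0) {δ : ℝ} (hδ : 0 < δ) :
    ∃ p ξ, ‖p‖ < δ ∧ ξ ∉ Z ∧ IsContact φ G p ξ := by
  by_contra hcon
  push Not at hcon
  choose ξ hξ using fun p => hφ.exists_isContact hG ha hGa p
  have hinj : Function.LeftInverse (Function.invFun ξ) ξ := by
    refine Function.leftInverse_invFun fun p₁ p₂ h12 => ?_
    have h1 := (hξ p₁).norm_sub_le hφ (hξ p₂)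
    rw [h12, sub_self, norm_zero, mul_zero] at h1
    exact sub_eq_zero.1 (norm_le_zero_iff.1 h1)
  have hlip : LipschitzOnWith (12 * (‖G‖₊ + 1)) (Function.invFun ξ) (ξ '' ball 0 δ) := by
    refine LipschitzOnWith.of_dist_le_mul ?_
    rintro _ ⟨p₁, -, rfl⟩ _ ⟨p₂, -, rfl⟩
    rw [hinj, hinj, dist_eq_norm, dist_eq_norm]
    simpa using (hξ p₁).norm_sub_le hφ (hξ p₂)
  have himg : Function.invFun ξ '' (ξ '' ball 0 δ) = ball 0 δ := by
    rw [← image_comp, hinj.comp_eq_id, image_id]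
  have hnull : μH[Module.finrank ℝ E] (ξ '' ball 0 δ) = 0 := by
    refine measure_mono_null ?_ hZ
    rintro _ ⟨p, hp, rfl⟩
    by_contra hc
    exact hcon p (ξ p) (by simpa using hp) hc (hξ p)
  have := hlip.hausdorffMeasure_image_le (d := Module.finrank ℝ E) (by positivity)
  rw [himg, hnull, mul_zero] at this
  exact (measure_ball_pos _ _ hδ).ne' (le_antisymm this zero_le)

/-- Convex envelope of a continuous function on a compact set, obtained by sup-convolution. -/
theorem exists_convex_envelope {K : Set E} (hK : IsCompact K) (hKne : K.Nonempty) {w : E → ℝ}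
    (hw : ContinuousOn w K) (G : E →L[ℝ] E) :
    ∃ (f : E → ℝ) (R : ℝ), BddSubgrad R f ∧
      (∀ y ∈ K, ∀ ξ, w y - inner ℝ (G y) y + 2 * inner ℝ (G y) ξ ≤ f ξ) ∧
      ∀ ξ, ∃ x ∈ K, f ξ = w x - inner ℝ (G x) x + 2 * inner ℝ (G x) ξ ∧
        IsSubgrad f ξ ((2 : ℝ) • G x) := by
  have hc : ∀ ξ, ContinuousOn (fun y => w y - inner ℝ (G y) y + 2 * inner ℝ (G y) ξ) K := by
    intro ξ
    fun_prop
  choose x hxK hx using fun ξ => hK.exists_isMaxOn hKne (hc ξ)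
  obtain ⟨R, hR⟩ := hK.isBounded.exists_norm_le
  have hle : ∀ y ∈ K, ∀ ξ, w y - inner ℝ (G y) y + 2 * inner ℝ (G y) ξ ≤
      w (x ξ) - inner ℝ (G (x ξ)) (x ξ) + 2 * inner ℝ (G (x ξ)) ξ := fun y hy ξ => hx ξ hy
  have hsub : ∀ ξ, IsSubgrad
      (fun ξ => w (x ξ) - inner ℝ (G (x ξ)) (x ξ) + 2 * inner ℝ (G (x ξ)) ξ) ξ
      ((2 : ℝ) • G (x ξ)) := by
    intro ξ ξ'
    have := hle (x ξ) (hxK ξ) ξ'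
    simp only [inner_smul_left, inner_sub_right, conj_trivial]
    linarith
  refine ⟨_, 2 * (‖G‖ * R), fun ξ => ⟨_, ?_, hsub ξ⟩, hle, fun ξ => ⟨x ξ, hxK ξ, rfl, hsub ξ⟩⟩
  rw [norm_smul, Real.norm_of_nonneg (by norm_num)]
  gcongr
  exact (G.le_opNorm _).trans (by gcongr; exact hR _ (hxK ξ))

/-- One-sided second-order expansion at a point of contact with the envelope. -/
theorem envelope_expansion {K : Set E} {w : E → ℝ}
    {G : E →L[ℝ] E} (hG : ∀ x y, inner ℝ (G x) y = inner ℝ (G y) x) {f : E → ℝ}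
    (hle : ∀ y ∈ K, ∀ ξ, w y - inner ℝ (G y) y + 2 * inner ℝ (G y) ξ ≤ f ξ) {x ξ : E}
    (hx : f ξ = w x - inner ℝ (G x) x + 2 * inner ℝ (G x) ξ) {S : E →L[ℝ] E} {η : ℝ} {h : E}
    (hS : |f (ξ + h) - f ξ - inner ℝ ((2 : ℝ) • G x) h - inner ℝ (S h) h / 2| ≤ η * ‖h‖ ^ 2)
    (hh : x + h ∈ K) :
    w (x + h) ≤ w x + inner ℝ ((2 : ℝ) • G (x - ξ)) h +
      inner ℝ ((S - (2 : ℝ) • G) h) h / 2 + η * ‖h‖ ^ 2 := by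
  have h1 := hle _ hh (ξ + h)
  have h2 := (abs_le.1 hS).2
  simp only [map_add, map_sub, inner_add_left, inner_add_right, inner_smul_left, inner_sub_left,
    conj_trivial, sub_apply, smul_apply, smul_sub] at h1 h2 ⊢
  rw [hG h x, hG h ξ] at h1
  linarith

theorem inner_clm_nonpos_of_expansion {S : E →L[ℝ] E}
    (h : ∀ η > 0, ∀ᶠ k in 𝓝 (0 : E), inner ℝ (S k) k ≤ η * ‖k‖ ^ 2) (k : E) :
    inner ℝ (S k) k ≤ 0 := by
  refine le_of_forall_pos_le_add fun ε hε => ?_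
  have hη : 0 < ε / (‖k‖ ^ 2 + 1) := by positivity
  have ht : Tendsto (fun t : ℝ => t • k) (𝓝[>] 0) (𝓝 0) := by
    have : Tendsto (fun t : ℝ => t • k) (𝓝 0) (𝓝 ((0 : ℝ) • k)) :=
      Continuous.tendsto (by fun_prop) 0
    rw [zero_smul] at this
    exact this.mono_left nhdsWithin_le_nhds
  obtain ⟨t, ht, htpos⟩ := ((ht.eventually (h _ hη)).and self_mem_nhdsWithin).exists
  have htpos : 0 < t := htpos
  rw [map_smul, inner_smul_left, inner_smul_right, norm_smul, Real.norm_of_nonneg htpos.le] at ht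
  simp only [conj_trivial] at ht
  have h2 : t ^ 2 * inner ℝ (S k) k ≤ t ^ 2 * (ε / (‖k‖ ^ 2 + 1) * ‖k‖ ^ 2) := by linarith
  have h3 := le_of_mul_le_mul_left h2 (by positivity)
  have h4 : ε / (‖k‖ ^ 2 + 1) * ‖k‖ ^ 2 ≤ ε := by
    rw [div_mul_eq_mul_div, div_le_iff₀ (by positivity)]
    nlinarith
  linarith

/-- **Theorem on sums** (with an arbitrarily small error). -/
theorem theorem_on_sums [FiniteDimensional ℝ E]
    {K : Set E} (hK : IsCompact K) (hKne : K.Nonempty) {u v : E → ℝ} (hu : ContinuousOn u K)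
    (hv : ContinuousOn v K) {G : E →L[ℝ] E} (hG : ∀ x y, inner ℝ (G x) y = inner ℝ (G y) x)
    {a : ℝ} (ha : 0 < a) (hGa : ∀ x, a * ‖x‖ ^ 2 ≤ inner ℝ (G x) x) {τ : ℝ} (hτ : 0 < τ) :
    ∃ x ∈ K, ∃ y ∈ K, ∃ (P₁ P₂ : E) (M₁ M₂ : E →L[ℝ] E), ‖P₁ - P₂‖ ≤ τ ∧
      (∀ b c, inner ℝ (M₁ b) c = inner ℝ (M₁ c) b) ∧
      (∀ b c, inner ℝ (M₂ b) c = inner ℝ (M₂ c) b) ∧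
      (∀ h, inner ℝ (M₁ h) h ≤ inner ℝ (M₂ h) h) ∧
      (∀ η > 0, ∀ᶠ h in 𝓝 (0 : E), x + h ∈ K →
        u (x + h) ≤ u x + inner ℝ P₁ h + inner ℝ (M₁ h) h / 2 + η * ‖h‖ ^ 2) ∧
      (∀ η > 0, ∀ᶠ h in 𝓝 (0 : E), y + h ∈ K →
        v y + inner ℝ P₂ h + inner ℝ (M₂ h) h / 2 - η * ‖h‖ ^ 2 ≤ v (y + h)) ∧
      ∀ x' ∈ K, ∀ y' ∈ K, u x' - v y' - inner ℝ (G (x' - y')) (x' - y') / 2 ≤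
        u x - v y - inner ℝ (G (x - y)) (x - y) / 2 + τ := by
  borelize E
  obtain ⟨f, Rf, hf, hfle, hfx⟩ := exists_convex_envelope hK hKne hu G
  obtain ⟨g, Rg, hg, hgle, hgx⟩ := exists_convex_envelope hK hKne hv.neg G
  obtain ⟨R, hRpos, hR⟩ := hK.isBounded.exists_pos_norm_le
  obtain ⟨Zf, hZf, hAf⟩ := hf.alexandrov
  obtain ⟨Zg, hZg, hAg⟩ := hg.alexandrov
  obtain ⟨δ, hδ, hδτ, hδ2⟩ : ∃ δ > 0, δ ≤ τ ∧ δ * (2 * R + 1) ≤ τ ∧ δ ≤ 8 * a := by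
    refine ⟨min (min τ (8 * a)) (τ / (2 * R + 1)), ?_, ?_, ?_, ?_⟩
    · positivity
    · exact (min_le_left _ _).trans (min_le_left _ _)
    · rw [← le_div_iff₀ (by positivity)]; exact min_le_right _ _
    · exact (min_le_left _ _).trans (min_le_right _ _)
  obtain ⟨p, ξ, hp, hξ, hc⟩ := (hf.add hg).exists_isContact_notMem hG ha hGa
    (measure_union_null hZf hZg) hδ
  rw [mem_union, not_or] at hξ
  obtain ⟨x, hxK, hfx, hmf⟩ := hfx ξ
  obtain ⟨y, hyK, hgy, hmg⟩ := hgx ξ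
  obtain ⟨X, hXs, hX⟩ := hAf ξ hξ.1 _ hmf
  obtain ⟨Y, hYs, hY⟩ := hAg ξ hξ.2 _ hmg
  have heq := hc.subgrad_eq (hmf.add hmg)
  have hpe : p = (2 : ℝ) • G (x - ξ) + (2 : ℝ) • G (y - ξ) := by
    rw [map_sub, map_sub, ← sub_eq_iff_eq_add'.2 heq.symm.symm]; module
  refine ⟨x, hxK, y, hyK, (2 : ℝ) • G (x - ξ), -((2 : ℝ) • G (y - ξ)), X - (2 : ℝ) • G,
    (2 : ℝ) • G - Y, ?_, ?_, ?_, ?_, ?_, ?_, ?_⟩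
  · rw [sub_neg_eq_add, ← hpe]; exact hp.le.trans hδτ
  · intro b c
    simp only [sub_apply, smul_apply, inner_sub_left, inner_smul_left, hXs b c, hG b c]
  · intro b c
    simp only [sub_apply, smul_apply, inner_sub_left, inner_smul_left, hYs b c, hG b c]
  · intro h
    have key := inner_clm_nonpos_of_expansion (S := X + Y - (4 : ℝ) • G) (fun η hη => ?_) h
    · simp only [sub_apply, add_apply, smul_apply, inner_sub_left, inner_add_left,
        inner_smul_left, conj_trivial] at key ⊢
      linarith
    · filter_upwards [hX (η / 4) (by positivity), hY (η / 4) (by positivity)] with k h1 h2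
      have h1 := (abs_le.1 h1).1
      have h2 := (abs_le.1 h2).1
      have h3 := hc k
      rw [← heq, inner_add_left] at h3
      simp only [sub_apply, add_apply, smul_apply, inner_sub_left, inner_add_left,
        inner_smul_left, conj_trivial] at h1 h2 h3 ⊢
      linarith
  · intro η hη
    filter_upwards [hX η hη] with h hh hxh
    exact envelope_expansion hG hfle hfx hh hxh
  · intro η hη
    filter_upwards [hY η hη] with h hh hyh
    have := envelope_expansion hG hgle hgy hh hyh
    simp only [Pi.neg_apply, sub_apply, inner_sub_left, inner_neg_left] at this ⊢
    linarith
  · intro x' hx' y' hy'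
    set ξ' := (1 / 2 : ℝ) • (x' + y') with hξ'
    have h1 := hfle x' hx' ξ'
    have h2 := hgle y' hy' ξ'
    have h3 := hc (ξ' - ξ)
    rw [add_sub_cancel, ← heq] at h3
    have h4 : inner ℝ p (ξ' - (1 / 2 : ℝ) • (x + y)) ≤ δ * (2 * R) := by
      refine (real_inner_le_norm _ _).trans ?_
      gcongr
      have e : ξ' - (1 / 2 : ℝ) • (x + y) = (1 / 2 : ℝ) • ((x' - x) + (y' - y)) := by
        rw [hξ']; module
      rw [e, norm_smul, Real.norm_of_nonneg (by norm_num)]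
      have := norm_add_le (x' - x) (y' - y)
      have := norm_sub_le x' x
      have := norm_sub_le y' y
      linarith [hR _ hx', hR _ hy', hR _ hxK, hR _ hyK]
    set m := (1 / 2 : ℝ) • (x + y) - ξ with hm
    have hpm : p = (4 : ℝ) • G m := by
      rw [hpe, hm, map_sub, map_sub, map_sub, map_smul, map_add]; module
    have h5 : inner ℝ p m ≤ 2 * δ := by
      have h6 := hGa m
      have h7 : inner ℝ p m = 4 * inner ℝ (G m) m := by rw [hpm, inner_smul_left]; rfl
      have h8 := real_inner_le_norm p m
      have h9 : ‖p‖ * ‖m‖ ≤ δ * ‖m‖ := by gcongr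
      have h10 : ‖m‖ ≤ 2 := by
        by_contra hcon
        push Not at hcon
        have : 4 * a * ‖m‖ ^ 2 ≤ δ * ‖m‖ := by linarith
        have : 4 * a * ‖m‖ ≤ δ := by nlinarith
        nlinarith
      nlinarith
    have h11 : u x' - v y' - inner ℝ (G (x' - y')) (x' - y') / 2 ≤
        u x - v y - inner ℝ (G (x - y)) (x - y) / 2 + inner ℝ p (ξ' - (1 / 2 : ℝ) • (x + y)) +
        inner ℝ p m / 2 := by
      have ep : ∀ z, inner ℝ p z = 2 * inner ℝ (G x) z + 2 * inner ℝ (G y) z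
          - 4 * inner ℝ (G ξ) z := fun z => by
        rw [hpm, hm, map_sub, map_smul, map_add]
        simp only [inner_smul_left, inner_sub_left, inner_add_left, conj_trivial]
        ring
      rw [ep, ep, hm]
      beta_reduce at h3
      rw [hfx, hgy] at h3
      rw [hξ'] at h1 h2 h3 ⊢
      simp only [map_sub, map_smul, map_add, inner_sub_left, inner_sub_right, inner_smul_left,
        inner_smul_right, inner_add_left, inner_add_right, conj_trivial, Pi.neg_apply]
        at h1 h2 h3 ⊢
      linarith [hG y' x', hG y x, hG x' ξ, hG y' ξ, hG x ξ, hG y ξ, hG x x', hG x y', hG y x',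
        hG y y']
    linarith

end SumLemma

section QuadraticTests

variable {n : ℕ}

/-- The quadratic function with gradient `P` at `x₀`, Hessian `T` and vanishing at `x₀`. -/
def quad (P : Euc n) (T : Euc n →L[ℝ] Euc n) (x₀ x : Euc n) : ℝ :=
  inner ℝ P (x - x₀) + inner ℝ (T (x - x₀)) (x - x₀) / 2

/-- The matrix of a bilinear form `⟨T ·, ·⟩`. -/
def opMatrix (T : Euc n →L[ℝ] Euc n) : Matrix (Fin n) (Fin n) ℝ :=
  Matrix.of fun i j =>
    inner ℝ (T (EuclideanSpace.single i (1 : ℝ))) (EuclideanSpace.single j (1 : ℝ))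

theorem contDiff_quad (P : Euc n) (T : Euc n →L[ℝ] Euc n) (x₀ : Euc n) :
    ContDiff ℝ 2 (quad P T x₀) := by
  have h1 : ContDiff ℝ 2 fun x : Euc n => x - x₀ := by fun_prop
  have h2 : ContDiff ℝ 2 fun x : Euc n => T (x - x₀) := T.contDiff.comp h1
  exact (contDiff_const.inner ℝ h1).add ((h2.inner ℝ h1).div_const 2)

theorem hasFDerivAt_const_add_quad (c : ℝ) (P : Euc n) {T : Euc n →L[ℝ] Euc n}
    (hT : ∀ a b, inner ℝ (T a) b = inner ℝ (T b) a) (x₀ x : Euc n) :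
    HasFDerivAt (fun z => c + quad P T x₀ z) (innerSL ℝ (P + T (x - x₀))) x := by
  have h1 : HasFDerivAt (fun z : Euc n => z - x₀) (ContinuousLinearMap.id ℝ (Euc n)) x :=
    (hasFDerivAt_id x).sub_const x₀
  have h2 : HasFDerivAt (fun z : Euc n => T (z - x₀)) T x := T.hasFDerivAt.comp x h1
  have h3 := (((hasFDerivAt_const P x).inner ℝ h1).add
    ((h2.inner ℝ h1).mul_const (1 / 2 : ℝ))).const_add c
  refine (h3.congr_fderiv ?_).congr_of_eventuallyEq (Eventually.of_forall fun z => ?_)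
  · ext v
    have h4 := hT v (x - x₀)
    simp only [add_apply, smul_apply, ContinuousLinearMap.comp_apply,
      ContinuousLinearMap.prod_apply, fderivInnerCLM_apply, zero_apply,
      ContinuousLinearMap.id_apply, inner_zero_left, innerSL_apply_apply, inner_add_left,
      smul_eq_mul] at h4 ⊢
    linarith
  · simp [quad, div_eq_mul_inv]

theorem gradient_const_add_quad (c : ℝ) (P : Euc n) {T : Euc n →L[ℝ] Euc n}
    (hT : ∀ a b, inner ℝ (T a) b = inner ℝ (T b) a) (x₀ x : Euc n) :
    gradient (fun z => c + quad P T x₀ z) x = P + T (x - x₀) := by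
  apply HasGradientAt.gradient
  rw [hasGradientAt_iff_hasFDerivAt]
  exact hasFDerivAt_const_add_quad c P hT x₀ x

theorem hessianMatrix_const_add_quad (c : ℝ) (P : Euc n) {T : Euc n →L[ℝ] Euc n}
    (hT : ∀ a b, inner ℝ (T a) b = inner ℝ (T b) a) (x₀ x : Euc n) :
    hessianMatrix (fun z => c + quad P T x₀ z) x = opMatrix T := by
  have h1 : fderiv ℝ (fun z => c + quad P T x₀ z) = fun z => innerSL ℝ (P + T (z - x₀)) :=
    funext fun z => (hasFDerivAt_const_add_quad c P hT x₀ z).fderiv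
  have h2 : HasFDerivAt (fun z => P + T (z - x₀)) T x :=
    (T.hasFDerivAt.comp x ((hasFDerivAt_id x).sub_const x₀)).const_add P
  let B : Euc n →L[ℝ] Euc n →L[ℝ] ℝ :=
    (isBoundedBilinearMap_inner (𝕜 := ℝ) (E := Euc n)).toContinuousLinearMap
  have h3 : HasFDerivAt (fun z => innerSL ℝ (P + T (z - x₀))) (B.comp T) x :=
    B.hasFDerivAt.comp x h2
  ext i j
  rw [hessianMatrix, Matrix.of_apply, iteratedFDeriv_two_apply, h1, h3.fderiv]
  rfl

theorem SubTest.exists_of_isLocalMax {Ω : Set (Euc n)} (hΩ : IsOpen Ω) {u : Euc n → ℝ} {P : Euc n}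
    {T : Euc n →L[ℝ] Euc n} {x₀ x₁ : Euc n} (hx₁ : x₁ ∈ Ω)
    (h : ∀ᶠ x in 𝓝 x₁, u x - quad P T x₀ x ≤ u x₁ - quad P T x₀ x₁) :
    ∃ r, SubTest Ω u x₁ (fun z => (u x₁ - quad P T x₀ x₁) + quad P T x₀ z) r := by
  obtain ⟨r, hr, hb⟩ := Metric.eventually_nhds_iff_ball.1 (h.and (hΩ.mem_nhds hx₁))
  exact ⟨r, hr, fun x hx => (hb x hx).2, (contDiff_const.add (contDiff_quad P T x₀)).contDiffOn,
    fun x hx => by linarith [(hb x hx).1], by ring⟩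

end QuadraticTests

section Pucci

variable {n : ℕ}

theorem Matrix.PosSemidef.trace_mul_nonneg' {A B : Matrix (Fin n) (Fin n) ℝ} (hA : A.PosSemidef)
    (hB : B.PosSemidef) : 0 ≤ (A * B).trace := by
  obtain ⟨m, w, rfl⟩ := Matrix.posSemidef_iff_eq_sum_vecMulVec.1 hA
  rw [Matrix.sum_mul, Matrix.trace_sum]
  refine Finset.sum_nonneg fun i _ => ?_
  rw [Matrix.trace_mul_comm, Matrix.mul_vecMulVec, Matrix.trace_vecMulVec, dotProduct_comm]
  exact hB.dotProduct_mulVec_nonneg (w i)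

theorem pucciSet_nonempty {l L : ℝ} (hL : l ≤ L) : (pucciSet n l L).Nonempty := by
  refine ⟨l • 1, ?_, ?_⟩
  · rw [sub_self]; exact Matrix.PosSemidef.zero
  · rw [← sub_smul]
    exact Matrix.PosSemidef.one.smul (sub_nonneg.2 hL)

theorem trace_le_of_mem_pucciSet {l L : ℝ} {A : Matrix (Fin n) (Fin n) ℝ}
    (hA : A ∈ pucciSet n l L) : A.trace ≤ L * n := by
  have := hA.2.trace_nonneg
  rw [Matrix.trace_sub, Matrix.trace_smul, Matrix.trace_one] at this
  simpa using this

theorem posSemidef_of_mem_pucciSet {l L : ℝ} (hl : 0 ≤ l) {A : Matrix (Fin n) (Fin n) ℝ}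
    (hA : A ∈ pucciSet n l L) : A.PosSemidef := by
  have := hA.1.add (Matrix.PosSemidef.one.smul hl)
  rwa [sub_add_cancel] at this

theorem le_diag_of_mem_pucciSet {l L : ℝ} {A : Matrix (Fin n) (Fin n) ℝ}
    (hA : A ∈ pucciSet n l L) (i : Fin n) : l ≤ A i i := by
  have := hA.1.diag_nonneg (i := i)
  simpa using this

theorem le_pucciMinus {l L : ℝ} (hL : l ≤ L) {M : Matrix (Fin n) (Fin n) ℝ} {c : ℝ}
    (h : ∀ A ∈ pucciSet n l L, c ≤ -(A * M).trace) : c ≤ pucciMinus l L M := by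
  refine le_csInf ((pucciSet_nonempty hL).image _) ?_
  rintro _ ⟨A, hA, rfl⟩
  exact h A hA

theorem opMatrix_sub (S T : Euc n →L[ℝ] Euc n) : opMatrix (S - T) = opMatrix S - opMatrix T := by
  ext i j
  simp [opMatrix, inner_sub_left]

theorem opMatrix_posSemidef {T : Euc n →L[ℝ] Euc n}
    (hT : ∀ a b, inner ℝ (T a) b = inner ℝ (T b) a) (hpos : ∀ h, 0 ≤ inner ℝ (T h) h) :
    (opMatrix T).PosSemidef := by
  refine Matrix.PosSemidef.of_dotProduct_mulVec_nonneg ?_ fun x => ?_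
  · ext i j
    simp only [Matrix.conjTranspose_apply, opMatrix, Matrix.of_apply, star_trivial]
    exact hT _ _
  · have := hpos (WithLp.toLp 2 x)
    refine this.trans_eq ?_
    have hx : (WithLp.toLp 2 x : Euc n) = ∑ i, x i • EuclideanSpace.single i (1 : ℝ) := by
      ext j
      simp [Pi.single_apply]
    rw [hx, map_sum]
    simp only [sum_inner, inner_sum, map_smul, inner_smul_left, inner_smul_right, dotProduct,
      Matrix.mulVec, star_trivial, conj_trivial, opMatrix, Matrix.of_apply, Finset.mul_sum]
    refine Finset.sum_congr rfl fun i _ => Finset.sum_congr rfl fun j _ => ?_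
    rw [hT]
    ring

theorem opMatrix_smul_id (c : ℝ) :
    opMatrix (c • ContinuousLinearMap.id ℝ (Euc n)) = c • (1 : Matrix (Fin n) (Fin n) ℝ) := by
  ext i j
  simp only [opMatrix, Matrix.of_apply, smul_apply, ContinuousLinearMap.id_apply,
    inner_smul_left, EuclideanSpace.inner_single_left, Matrix.smul_apply, Matrix.one_apply]
  simp

theorem neg_le_pucciMinus_opMatrix {l L : ℝ} (hl : 0 ≤ l) (hL : l ≤ L) {T : Euc n →L[ℝ] Euc n}
    (hT : ∀ a b, inner ℝ (T a) b = inner ℝ (T b) a) {μ : ℝ} (hμ : 0 ≤ μ)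
    (h : ∀ k, inner ℝ (T k) k ≤ μ * ‖k‖ ^ 2) :
    -(μ * (L * n)) ≤ pucciMinus l L (opMatrix T) := by
  refine le_pucciMinus hL fun A hA => ?_
  have h1 : (opMatrix (μ • ContinuousLinearMap.id ℝ (Euc n) - T)).PosSemidef := by
    refine opMatrix_posSemidef (fun a b => ?_) fun k => ?_
    · simp [inner_sub_left, inner_smul_left, hT a b, real_inner_comm a b]
    · have := h k
      simp only [sub_apply, smul_apply, ContinuousLinearMap.id_apply, inner_sub_left,
        inner_smul_left, real_inner_self_eq_norm_sq, conj_trivial]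
      linarith
  have h2 := (posSemidef_of_mem_pucciSet hl hA).trace_mul_nonneg' h1
  rw [opMatrix_sub, opMatrix_smul_id, Matrix.mul_sub, Matrix.mul_smul, Matrix.mul_one,
    Matrix.trace_sub, Matrix.trace_smul, smul_eq_mul] at h2
  have h3 := trace_le_of_mem_pucciSet hA
  nlinarith

/-- The operator `2α - 2κ e ⊗ e` with `e` the last coordinate vector. -/
def slabOp (n : ℕ) (α κ : ℝ) : Euc (n + 1) →L[ℝ] Euc (n + 1) :=
  (2 * α) • ContinuousLinearMap.id ℝ (Euc (n + 1)) -
    (2 * κ) • (EuclideanSpace.proj (Fin.last n) : Euc (n + 1) →L[ℝ] ℝ).smulRight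
      (EuclideanSpace.single (Fin.last n) (1 : ℝ))

theorem inner_slabOp (α κ : ℝ) (a b : Euc (n + 1)) :
    inner ℝ (slabOp n α κ a) b =
      2 * α * inner ℝ a b - 2 * κ * (a (Fin.last n) * b (Fin.last n)) := by
  simp only [slabOp, sub_apply, smul_apply, ContinuousLinearMap.id_apply,
    ContinuousLinearMap.smulRight_apply, inner_sub_left, inner_smul_left,
    EuclideanSpace.inner_single_left, PiLp.proj_apply, conj_trivial]
  ring

theorem slabOp_symm (α κ : ℝ) (a b : Euc (n + 1)) :
    inner ℝ (slabOp n α κ a) b = inner ℝ (slabOp n α κ b) a := by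
  rw [inner_slabOp, inner_slabOp, real_inner_comm]; ring

theorem opMatrix_slabOp (α κ : ℝ) :
    opMatrix (slabOp n α κ) = (2 * α) • (1 : Matrix (Fin (n + 1)) (Fin (n + 1)) ℝ) -
      (2 * κ) • Matrix.single (Fin.last n) (Fin.last n) (1 : ℝ) := by
  ext i j
  simp only [opMatrix, Matrix.of_apply, inner_slabOp, Matrix.sub_apply, Matrix.smul_apply,
    Matrix.one_apply, Matrix.single_apply, smul_eq_mul, EuclideanSpace.inner_single_left]
  simp
  grind

theorem le_pucciMinus_slabOp {l L : ℝ} (hL : l ≤ L) {α κ : ℝ} (hα : 0 ≤ α)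
    (hκ : 0 ≤ κ) :
    2 * κ * l - 2 * α * (L * (n + 1)) ≤ pucciMinus l L (opMatrix (slabOp n α κ)) := by
  refine le_pucciMinus hL fun A hA => ?_
  have h3 := trace_le_of_mem_pucciSet hA
  have h4 := le_diag_of_mem_pucciSet hA (Fin.last n)
  rw [opMatrix_slabOp, Matrix.mul_sub, Matrix.mul_smul, Matrix.mul_smul, Matrix.mul_one,
    Matrix.trace_sub, Matrix.trace_smul, Matrix.trace_smul, smul_eq_mul, smul_eq_mul,
    Matrix.trace_mul_single, MulOpposite.op_one, one_smul]
  push_cast at h3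
  nlinarith

end Pucci

section Slopes

variable {E : Type*} [NormedAddCommGroup E] [InnerProductSpace ℝ E]

/-- On the half space `⟨ν, ·⟩ ≥ 0` the function `w` lies, near the origin, below a linear function
of slope `s` in the direction `ν`, up to a quadratic error. -/
def IsSlope (ν : E) (w : E → ℝ) (s : ℝ) : Prop :=
  ∃ C, ∃ r > 0, ∀ h, ‖h‖ < r → 0 ≤ inner ℝ ν h → w h ≤ s * inner ℝ ν h + C * ‖h‖ ^ 2

theorem IsSlope.mono {ν : E} {w : E → ℝ} {s s' : ℝ} (h : IsSlope ν w s) (hs : s ≤ s') :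
    IsSlope ν w s' := by
  obtain ⟨C, r, hr, H⟩ := h
  exact ⟨C, r, hr, fun h hh hν => (H h hh hν).trans (by gcongr)⟩

theorem inner_le_norm_of_unit {ν : E} (hν : ‖ν‖ = 1) (h : E) : inner ℝ ν h ≤ ‖h‖ := by
  have := real_inner_le_norm ν h
  rwa [hν, one_mul] at this

/-- The test functions used on slabs. -/
def slabTest (ν : E) (s α κ : ℝ) (h : E) : ℝ :=
  s * inner ℝ ν h + α * ‖h‖ ^ 2 - κ * (inner ℝ ν h) ^ 2

theorem continuous_slabTest (ν : E) (s α κ : ℝ) : Continuous (slabTest ν s α κ) := by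
  unfold slabTest
  fun_prop

/-- If `w - φ` is nonpositive on the faces of a slab and has no interior local maximum, then it is
nonpositive in the slab. -/
theorem le_slabTest_of_boundary [FiniteDimensional ℝ E] {ν : E} {w : E → ℝ} {s α κ ρ t : ℝ}
    (hw : ContinuousOn w (closedBall 0 ρ))
    (hbot : ∀ h, ‖h‖ ≤ ρ → inner ℝ ν h = 0 → w h ≤ slabTest ν s α κ h)
    (htop : ∀ h, ‖h‖ ≤ ρ → inner ℝ ν h = t → w h ≤ slabTest ν s α κ h)
    (hside : ∀ h, ‖h‖ = ρ → 0 ≤ inner ℝ ν h → inner ℝ ν h ≤ t → w h ≤ slabTest ν s α κ h)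
    (hint : ∀ h, ‖h‖ < ρ → 0 < inner ℝ ν h →
      ¬ ∀ᶠ k in 𝓝 h, w k - slabTest ν s α κ k ≤ w h - slabTest ν s α κ h)
    {h : E} (hρ : ‖h‖ ≤ ρ) (h0 : 0 ≤ inner ℝ ν h) (h1 : inner ℝ ν h ≤ t) :
    w h ≤ slabTest ν s α κ h := by
  have hcν : Continuous fun k : E => inner ℝ ν k := by fun_prop
  set D : Set E := closedBall 0 ρ ∩ {k | 0 ≤ inner ℝ ν k ∧ inner ℝ ν k ≤ t} with hD
  have hDc : IsCompact D := (isCompact_closedBall 0 ρ).inter_right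
    ((isClosed_le continuous_const hcν).inter (isClosed_le hcν continuous_const))
  have hc : ContinuousOn (fun k => w k - slabTest ν s α κ k) D :=
    (hw.mono inter_subset_left).sub (continuous_slabTest ν s α κ).continuousOn
  have hhD : h ∈ D := ⟨by simpa using hρ, h0, h1⟩
  obtain ⟨k, hkD, hmax⟩ := hDc.exists_isMaxOn ⟨h, hhD⟩ hc
  suffices w k ≤ slabTest ν s α κ k by
    have h2 : w h - slabTest ν s α κ h ≤ w k - slabTest ν s α κ k := hmax hhD
    linarith
  have hkρ : ‖k‖ ≤ ρ := by simpa using hkD.1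
  rcases hkρ.eq_or_lt with he | hlt
  · exact hside k he hkD.2.1 hkD.2.2
  rcases hkD.2.1.eq_or_lt with he0 | hlt0
  · exact hbot k hkρ he0.symm
  rcases hkD.2.2.eq_or_lt with he1 | hlt1
  · exact htop k hkρ he1
  refine absurd ?_ (hint k hlt hlt0)
  have ho : IsOpen (ball (0 : E) ρ ∩ {k | 0 < inner ℝ ν k ∧ inner ℝ ν k < t}) :=
    isOpen_ball.inter ((isOpen_lt continuous_const hcν).inter (isOpen_lt hcν continuous_const))
  filter_upwards [ho.mem_nhds ⟨by simpa using hlt, hlt0, hlt1⟩] with z hz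
  exact hmax ⟨ball_subset_closedBall hz.1, hz.2.1.le, hz.2.2.le⟩

/-- Strongly concave slab tests cannot touch `w` from above in the open half space. -/
def SlabEstimate (ν : E) (w : E → ℝ) (r₀ C : ℝ) : Prop :=
  ∀ s α κ h, 0 ≤ α → 0 ≤ κ → ‖h‖ < r₀ → 0 < inner ℝ ν h →
    (∀ᶠ k in 𝓝 h, w k - slabTest ν s α κ k ≤ w h - slabTest ν s α κ h) →
    κ ≤ C * (1 + |s| + α)

theorem SlabEstimate.exists_isSlope [FiniteDimensional ℝ E] {ν : E} (hν : ‖ν‖ = 1) {w : E → ℝ}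
    {r₀ C C₀ : ℝ} (hr₀ : 0 < r₀) (hC : 0 ≤ C) (hw : ContinuousOn w (ball 0 r₀))
    (h0 : ∀ h, ‖h‖ < r₀ → inner ℝ ν h = 0 → w h ≤ C₀ * ‖h‖ ^ 2)
    (hR : SlabEstimate ν w r₀ C) : ∃ s, IsSlope ν w s := by
  set r := min (r₀ / 2) (1 / (2 * C + 1)) with hr
  have hrpos : 0 < r := lt_min (by positivity) (by positivity)
  have hrr₀ : r < r₀ := (min_le_left _ _).trans_lt (by linarith)
  have hrC : C * r ≤ 1 / 2 := by
    have h1 : r ≤ 1 / (2 * C + 1) := min_le_right _ _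
    rw [le_div_iff₀ (by positivity)] at h1
    nlinarith
  have hwr : ContinuousOn w (closedBall 0 r) := hw.mono (closedBall_subset_ball hrr₀)
  obtain ⟨B, hB⟩ := (isCompact_closedBall (0 : E) r).exists_bound_of_continuousOn hwr
  set α := max (max C₀ 0) (B / r ^ 2) with hα
  have hα0 : 0 ≤ α := (le_max_right _ _).trans (le_max_left _ _)
  have hαC₀ : C₀ ≤ α := (le_max_left _ _).trans (le_max_left _ _)
  have hαB : B ≤ α * r ^ 2 := by
    rw [← div_le_iff₀ (by positivity)]; exact le_max_right _ _
  set κ := 2 * C * (1 + α) + 1 with hκ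
  have hκ0 : 0 < κ := by positivity
  have hφ : ∀ h, ‖h‖ ≤ r → 0 ≤ inner ℝ ν h → α * ‖h‖ ^ 2 ≤ slabTest ν (κ * r) α κ h := by
    intro h hh hn
    have := (inner_le_norm_of_unit hν h).trans hh
    have h2 : 0 ≤ κ * (inner ℝ ν h * (r - inner ℝ ν h)) :=
      mul_nonneg hκ0.le (mul_nonneg hn (by linarith))
    unfold slabTest
    nlinarith
  refine ⟨κ * r, α, r, hrpos, fun h hh hn => ?_⟩
  have key := le_slabTest_of_boundary (t := 2 * r) (s := κ * r) (α := α) (κ := κ) (ν := ν) hwr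
    (fun h hh hn => ?_) (fun h hh hn => ?_) (fun h hh hn _ => ?_) (fun h hh hn hloc => ?_)
    hh.le hn ((inner_le_norm_of_unit hν h).trans (by linarith))
  · refine key.trans ?_
    unfold slabTest
    nlinarith [mul_nonneg hκ0.le (sq_nonneg (inner ℝ ν h))]
  · refine le_trans ?_ (hφ h hh hn.ge)
    exact (h0 h (hh.trans_lt hrr₀) hn).trans (by gcongr)
  · have := inner_le_norm_of_unit hν h
    linarith
  · refine le_trans ?_ (hφ h hh.le hn)
    have := hB h (by simpa using hh.le)
    rw [Real.norm_eq_abs] at this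
    rw [hh]
    linarith [le_abs_self (w h)]
  · have := hR (κ * r) α κ h hα0 hκ0.le (hh.trans hrr₀) hn hloc
    rw [abs_of_nonneg (by positivity)] at this
    have h2 : C * (κ * r) ≤ κ / 2 := by nlinarith
    nlinarith

/-- Propagation of slope bounds across the interface of two functions. -/
theorem isSlope_of_not_isSlope [FiniteDimensional ℝ E] {ν : E} (hν : ‖ν‖ = 1) {w₁ w₂ : E → ℝ}
    {r₀ c : ℝ} (hr₀ : 0 < r₀) (hc : 0 ≤ c) (hw₂ : ContinuousOn w₂ (ball 0 r₀))
    (hz₁ : w₁ 0 = 0) (hz₂ : w₂ 0 = 0)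
    (hpair : ∀ h k, ‖h‖ < r₀ → ‖k‖ < r₀ → inner ℝ ν h = inner ℝ ν k →
      w₁ h + w₂ k ≤ c * ‖h - k‖ ^ 2)
    {b s s' : ℝ} (hb : IsSlope ν w₂ b) (hs : ¬ IsSlope ν w₁ s) (hss' : s' < s)
    (hint : ∀ α, 0 ≤ α → ∃ ρ > 0, ∃ κ, 0 ≤ κ ∧ ∀ k, ‖k‖ < ρ → 0 < inner ℝ ν k →
      ¬ ∀ᶠ z in 𝓝 k, w₂ z - slabTest ν (-s') α κ z ≤ w₂ k - slabTest ν (-s') α κ k) :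
    IsSlope ν w₂ (-s') := by
  obtain ⟨C₂, r₂, hr₂, hb⟩ := hb
  set α := max (2 * c) (C₂ + 1) with hα
  have hαc : 2 * c ≤ α := le_max_left _ _
  have hαC₂ : C₂ + 1 ≤ α := le_max_right _ _
  obtain ⟨ρ₀, hρ₀, κ, hκ, hloc⟩ := hint α (by linarith)
  set ρ := min (min (r₀ / 2) (r₂ / 2)) ρ₀ with hρ
  have hρpos : 0 < ρ := by positivity
  have hρr₀ : ρ < r₀ := ((min_le_left _ _).trans (min_le_left _ _)).trans_lt (by linarith)
  have hρr₂ : ρ < r₂ := ((min_le_left _ _).trans (min_le_right _ _)).trans_lt (by linarith)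
  have hρρ₀ : ρ ≤ ρ₀ := min_le_right _ _
  set d := |b + s'| + κ + 1 with hd
  have hdpos : 0 < d := by positivity
  set r := min (min ρ 1) (min (ρ ^ 2 / d) ((s - s') / d)) with hr
  have hrpos : 0 < r := by
    have : 0 < s - s' := sub_pos.2 hss'
    positivity
  have hrρ : r ≤ ρ := (min_le_left _ _).trans (min_le_left _ _)
  have hr1 : r ≤ 1 := (min_le_left _ _).trans (min_le_right _ _)
  have hrd : r * d ≤ ρ ^ 2 := by
    rw [← le_div_iff₀ hdpos]; exact (min_le_right _ _).trans (min_le_left _ _)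
  have hrs : r * d ≤ s - s' := by
    rw [← le_div_iff₀ hdpos]; exact (min_le_right _ _).trans (min_le_right _ _)
  obtain ⟨h, hh, hn, hw⟩ : ∃ h, ‖h‖ < r ∧ 0 ≤ inner ℝ ν h ∧
      s * inner ℝ ν h + 2 * c * ‖h‖ ^ 2 < w₁ h := by
    by_contra hcon
    push Not at hcon
    exact hs ⟨2 * c, r, hrpos, hcon⟩
  set t := inner ℝ ν h with ht
  have htr : t < r := (inner_le_norm_of_unit hν h).trans_lt hh
  have htpos : 0 < t := by
    refine hn.lt_of_ne fun h0 => ?_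
    have := hpair h 0 (hh.trans (hrρ.trans_lt hρr₀)) (by simpa using hr₀)
      (by rw [inner_zero_right, ← ht, ← h0])
    rw [hz₂, sub_zero] at this
    rw [← h0] at hw
    linarith [mul_nonneg hc (sq_nonneg ‖h‖)]
  refine ⟨α, min ρ t, lt_min hρpos htpos, fun k hk hkn => ?_⟩
  have hkt : inner ℝ ν k ≤ t :=
    (inner_le_norm_of_unit hν k).trans (hk.trans_le (min_le_right _ _)).le
  have key := le_slabTest_of_boundary (ν := ν) (t := t) (s := -s') (α := α) (κ := κ) (ρ := ρ)
    (hw₂.mono (closedBall_subset_ball hρr₀))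
    (fun k hk hkn => ?_) (fun k hk hkn => ?_) (fun k hk hk0 hk1 => ?_)
    (fun k hk hkn => hloc k (hk.trans_le hρρ₀) hkn) (hk.trans_le (min_le_left _ _)).le hkn hkt
  · refine key.trans ?_
    unfold slabTest
    linarith [mul_nonneg hκ (sq_nonneg (inner ℝ ν k))]
  · have := hpair 0 k (by simpa using hr₀) (hk.trans_lt hρr₀) (by rw [hkn, inner_zero_right])
    rw [hz₁, zero_sub, norm_neg] at this
    have h6 : 2 * c * ‖k‖ ^ 2 ≤ α * ‖k‖ ^ 2 := by gcongr
    unfold slabTest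
    rw [hkn]
    linarith [mul_nonneg hc (sq_nonneg ‖k‖)]
  · have h1 := hpair h k (hh.trans (hrρ.trans_lt hρr₀)) (hk.trans_lt hρr₀) (by rw [hkn])
    have h2 : ‖h - k‖ ^ 2 ≤ 2 * ‖h‖ ^ 2 + 2 * ‖k‖ ^ 2 := by
      have := parallelogram_law_with_norm ℝ h k
      linarith [mul_self_nonneg ‖h + k‖, sq ‖h - k‖, sq ‖h‖, sq ‖k‖]
    have h3 : c * ‖h - k‖ ^ 2 ≤ c * (2 * ‖h‖ ^ 2 + 2 * ‖k‖ ^ 2) := by gcongr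
    have h4 : κ * t ≤ s - s' := by
      refine le_trans ?_ hrs
      rw [mul_comm]
      have : κ ≤ d := by rw [hd]; linarith [abs_nonneg (b + s')]
      gcongr
    have h5 : κ * t * t ≤ (s - s') * t := by gcongr
    have h6 : 2 * c * ‖k‖ ^ 2 ≤ α * ‖k‖ ^ 2 := by gcongr
    unfold slabTest
    rw [hkn]
    linarith
  · have h1 := hb k (hk.trans_lt hρr₂) hk0
    have h2 : (b + s') * inner ℝ ν k ≤ |b + s'| * t := by
      have := le_abs_self (b + s')
      have := abs_nonneg (b + s')
      gcongr
    have h3 : κ * (inner ℝ ν k) ^ 2 ≤ κ * t := by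
      have : (inner ℝ ν k) ^ 2 ≤ t := by
        rw [sq, ← mul_one t]
        gcongr
        linarith
      gcongr
    have h4 : (|b + s'| + κ) * t ≤ ρ ^ 2 := by
      refine le_trans ?_ hrd
      rw [mul_comm]
      have : |b + s'| + κ ≤ d := by rw [hd]; linarith
      gcongr
    have h5 : (C₂ + 1) * ρ ^ 2 ≤ α * ρ ^ 2 := by gcongr
    unfold slabTest
    rw [hk] at h1 ⊢
    linarith

/-- At the critical slope the equation holds at the origin. -/
theorem le_zero_of_critical_slope [FiniteDimensional ℝ E] {ν : E} (hν : ‖ν‖ = 1) {w : E → ℝ}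
    {r₀ σ : ℝ} (hr₀ : 0 < r₀) (hw : ContinuousOn w (ball 0 r₀))
    (hgood : ∀ δ > 0, IsSlope ν w (σ + δ)) (hbad : ∀ δ > 0, ¬ IsSlope ν w (σ - δ))
    {G : E → E → ℝ}
    (hG : ContinuousWithinAt (fun q : E × E => G q.1 q.2) (univ ×ˢ {h | 0 ≤ inner ℝ ν h})
      (σ • ν, 0))
    (htest : ∀ (β : ℝ) (h₀ h : E), ‖h‖ < r₀ → 0 < inner ℝ ν h →
      (∀ᶠ k in 𝓝 h, w k - (σ * inner ℝ ν k + β * ‖k - h₀‖ ^ 2) ≤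
        w h - (σ * inner ℝ ν h + β * ‖h - h₀‖ ^ 2)) →
      G (σ • ν + (2 * β) • (h - h₀)) h ≤ 0) : G (σ • ν) 0 ≤ 0 := by
  by_contra hpos
  push Not at hpos
  have hev := hG.eventually (lt_mem_nhds hpos)
  rw [eventually_nhdsWithin_iff] at hev
  obtain ⟨m, hm, hball⟩ := Metric.eventually_nhds_iff_ball.1 hev
  obtain ⟨C, r, hr, hg⟩ := hgood (m / 20) (by positivity)
  set D := max C 0 with hD
  have hD0 : 0 ≤ D := le_max_right _ _
  set r' := min (min (r / 2) (r₀ / 2)) (m / 2) with hr'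
  have hr'pos : 0 < r' := by positivity
  have hr'r : r' ≤ r / 2 := (min_le_left _ _).trans (min_le_left _ _)
  have hr'r₀ : r' ≤ r₀ / 2 := (min_le_left _ _).trans (min_le_right _ _)
  have hr'm : r' ≤ m / 2 := min_le_right _ _
  obtain ⟨h, hh, hn, hwh⟩ : ∃ h, ‖h‖ < r' ∧ 0 ≤ inner ℝ ν h ∧
      (σ - m / 20) * inner ℝ ν h + 3 * D * ‖h‖ ^ 2 < w h := by
    by_contra hcon
    push Not at hcon
    exact hbad (m / 20) (by positivity) ⟨3 * D, r', hr'pos, hcon⟩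
  have hg' : ∀ k, ‖k‖ < r → 0 ≤ inner ℝ ν k →
      w k ≤ (σ + m / 20) * inner ℝ ν k + D * ‖k‖ ^ 2 := fun k hk hkn =>
    (hg k hk hkn).trans (by gcongr; exact le_max_left _ _)
  set t := inner ℝ ν h with ht
  have hth : t ≤ ‖h‖ := inner_le_norm_of_unit hν h
  have htpos : 0 < t := by
    refine hn.lt_of_ne fun h0 => ?_
    have h1 := hg' h (by linarith) hn
    rw [← ht, ← h0] at h1
    rw [← h0] at hwh
    nlinarith [sq_nonneg ‖h‖]
  have hclose : ∀ k ∈ closedBall h (t / 2), ‖k‖ ≤ ‖h‖ + t / 2 ∧ t / 2 ≤ inner ℝ ν k ∧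
      inner ℝ ν k ≤ 3 * t / 2 := by
    intro k hk
    rw [mem_closedBall, dist_eq_norm] at hk
    have h1 := norm_add_le h (k - h)
    rw [add_sub_cancel] at h1
    have h2 := inner_le_norm_of_unit hν (k - h)
    have h3 := inner_le_norm_of_unit hν (h - k)
    rw [norm_sub_rev] at h3
    rw [inner_sub_right] at h2 h3
    refine ⟨by linarith, by linarith, by linarith⟩
  set β := m / (2 * t) with hβ
  have hcont : ContinuousOn (fun k => w k - (σ * inner ℝ ν k + β * ‖k - h‖ ^ 2))
      (closedBall h (t / 2)) := by
    have h1 : ContinuousOn w (closedBall h (t / 2)) := hw.mono fun k hk => by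
      have := (hclose k hk).1
      rw [mem_ball, dist_zero_right]
      linarith
    have h2 : Continuous fun k : E => σ * inner ℝ ν k + β * ‖k - h‖ ^ 2 := by fun_prop
    exact h1.sub h2.continuousOn
  obtain ⟨k, hk, hmax⟩ := (isCompact_closedBall h (t / 2)).exists_isMaxOn
    ⟨h, mem_closedBall_self (by positivity)⟩ hcont
  obtain ⟨hk1, hk2, hk3⟩ := hclose k hk
  have hcen : w h - (σ * inner ℝ ν h + β * ‖h - h‖ ^ 2) ≤
      w k - (σ * inner ℝ ν k + β * ‖k - h‖ ^ 2) :=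
    hmax (mem_closedBall_self (by positivity))
  rw [sub_self, norm_zero, ← ht] at hcen
  have hkt : ‖k - h‖ < t / 2 := by
    rw [mem_closedBall, dist_eq_norm] at hk
    refine hk.lt_of_ne fun he => ?_
    rw [he] at hcen
    have h1 := hg' k (by linarith) (by linarith)
    have h2 : β * (t / 2) ^ 2 = m * t / 8 := by rw [hβ]; field_simp; ring
    have h3 : ‖k‖ ^ 2 ≤ 3 * ‖h‖ ^ 2 := by nlinarith [norm_nonneg k]
    have h4 : D * ‖k‖ ^ 2 ≤ D * (3 * ‖h‖ ^ 2) := by gcongr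
    rw [h2] at hcen
    have h5 : m / 20 * inner ℝ ν k ≤ m / 20 * (3 * t / 2) := by gcongr
    nlinarith
  have hloc : ∀ᶠ z in 𝓝 k, w z - (σ * inner ℝ ν z + β * ‖z - h‖ ^ 2) ≤
      w k - (σ * inner ℝ ν k + β * ‖k - h‖ ^ 2) := by
    have : k ∈ ball h (t / 2) := by rwa [mem_ball, dist_eq_norm]
    filter_upwards [isOpen_ball.mem_nhds this] with z hz
    exact hmax (ball_subset_closedBall hz)
  have h1 := htest β h k (by linarith) (by linarith) hloc
  have h2 := hball (σ • ν + (2 * β) • (k - h), k) (by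
    rw [mem_ball, Prod.dist_eq, max_lt_iff]
    constructor
    · rw [dist_eq_norm, add_sub_cancel_left, norm_smul, Real.norm_of_nonneg (by positivity)]
      calc 2 * β * ‖k - h‖ < 2 * β * (t / 2) := by gcongr
        _ = m / 2 := by rw [hβ]; field_simp
        _ < m := by linarith
    · rw [dist_zero_right]; dsimp only; linarith) ⟨mem_univ _, by simpa using by linarith⟩
  linarith

theorem exists_critical_slope {ν : E} {w : E → ℝ} (hne : ∃ s, IsSlope ν w s) {m : ℝ}
    (hm : ∀ s, IsSlope ν w s → m ≤ s) :
    ∃ σ, (∀ δ > 0, IsSlope ν w (σ + δ)) ∧ ∀ δ > 0, ¬ IsSlope ν w (σ - δ) := by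
  have hbdd : BddBelow {s | IsSlope ν w s} := ⟨m, hm⟩
  refine ⟨sInf {s | IsSlope ν w s}, fun δ hδ => ?_, fun δ hδ hs => ?_⟩
  · obtain ⟨s, hs, hlt⟩ := Real.lt_sInf_add_pos hne hδ
    exact IsSlope.mono hs hlt.le
  · linarith [csInf_le hbdd hs]

/-- One-dimensional matching of slopes at the interface. -/
theorem exists_matching_slope {LU RU LV RV : Set ℝ} {gu gv : ℝ → ℝ} (hgu : Continuous gu)
    (hgv : Continuous gv) {A B : ℝ} (hLU : ∀ s < A, s ∈ LU) (hA : gu A ≤ 0)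
    (hLV : ∀ s > B, s ∈ LV) (hB : 0 ≤ gv B) (hRV : RV.Nonempty)
    (hRVmono : ∀ s ∈ RV, ∀ s' ≤ s, s' ∈ RV) (hu : ∀ s ∈ LU, s ∈ RU → gu s ≤ 0)
    (hv : ∀ s ∈ LV, s ∈ RV → 0 ≤ gv s) (hBA : gv A < 0 → B ≤ A)
    (hR : ∀ s ∉ RU, ∀ s' < s, s' ∈ RV) : ∃ s, gu s ≤ 0 ∧ 0 ≤ gv s := by
  by_contra hcon
  push Not at hcon
  have hvA := hcon A hA
  have hBA := hBA hvA
  have limU : ∀ a b, a < b → (∀ s ∈ Ioo a b, gu s ≤ 0) → gu a ≤ 0 := fun a b hab h =>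
    le_of_tendsto (hgu.continuousAt.tendsto.mono_left nhdsWithin_le_nhds)
      (eventually_of_mem (Ioo_mem_nhdsGT hab) h)
  have limV : ∀ a b, a < b → (∀ s ∈ Ioo a b, 0 ≤ gv s) → 0 ≤ gv a := fun a b hab h =>
    ge_of_tendsto (hgv.continuousAt.tendsto.mono_left nhdsWithin_le_nhds)
      (eventually_of_mem (Ioo_mem_nhdsGT hab) h)
  have limV' : ∀ a b, a < b → (∀ s ∈ Ioo a b, 0 ≤ gv s) → 0 ≤ gv b := fun a b hab h =>
    ge_of_tendsto (hgv.continuousAt.tendsto.mono_left nhdsWithin_le_nhds)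
      (eventually_of_mem (Ioo_mem_nhdsLT hab) h)
  have hle : ∀ s ∈ RV, s ≤ A := by
    intro s hs
    by_contra hlt
    push Not at hlt
    have := limV A s hlt fun s' hs' =>
      hv s' (hLV s' (hBA.trans_lt hs'.1)) (hRVmono s hs s' hs'.2.le)
    linarith
  have hbdd : BddAbove RV := ⟨A, hle⟩
  set b := sSup RV with hb
  have hbA : b ≤ A := csSup_le hRV hle
  have hRU : ∀ s > b, s ∈ RU := by
    intro s hs
    by_contra hc
    have := le_csSup hbdd (hR s hc ((b + s) / 2) (by linarith))
    linarith
  have hRV' : ∀ s < b, s ∈ RV := by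
    intro s hs
    obtain ⟨s', hs', hlt⟩ := exists_lt_of_lt_csSup hRV hs
    exact hRVmono s' hs' s hlt.le
  have h1 : gu (max b B) ≤ 0 := by
    rcases (max_le hbA hBA).eq_or_lt with he | hlt
    · rw [he]; exact hA
    · exact limU _ A hlt fun s hs =>
        hu s (hLU s hs.2) (hRU s ((le_max_left _ _).trans_lt hs.1))
  have h2 : 0 ≤ gv (max b B) := by
    rcases le_or_gt b B with h | h
    · rwa [max_eq_right h]
    · rw [max_eq_left h.le]
      exact limV' B b h fun s hs => hv s (hLV s hs.1) (hRV' s hs.2)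
  linarith [hcon _ h1]

end Slopes

section Interface

variable {E : Type*} [NormedAddCommGroup E] [InnerProductSpace ℝ E]

/-- A function near a point of the interface `⟨e, ·⟩ = 0` which is a sub-solution of the first-order
equation `G ≤ 0` on `⟨e, ·⟩ ≤ 0` and satisfies the slab estimate on the other side. -/
structure InterfaceSub (e : E) (w : E → ℝ) (G : E → E → ℝ) (r₀ : ℝ) : Prop where
  unit : ‖e‖ = 1
  pos : 0 < r₀
  zero : w 0 = 0
  cont : ContinuousOn w (ball 0 r₀)
  contG : ContinuousOn (fun q : E × E => G q.1 q.2) (univ ×ˢ {h | ‖h‖ < r₀ ∧ inner ℝ e h ≤ 0})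
  test : ∀ (P : E) (β : ℝ) (h₀ h : E), ‖h‖ < r₀ → inner ℝ e h ≤ 0 →
    (∀ᶠ k in 𝓝 h, w k - (inner ℝ P k + β * ‖k - h₀‖ ^ 2) ≤
      w h - (inner ℝ P h + β * ‖h - h₀‖ ^ 2)) → G (P + (2 * β) • (h - h₀)) h ≤ 0
  slab : ∃ C, 0 ≤ C ∧ SlabEstimate e w r₀ C
  lip : ∃ L, ∀ h k, ‖h‖ < r₀ → ‖k‖ < r₀ → inner ℝ e h ≤ 0 → inner ℝ e k ≤ 0 →
    w h ≤ w k + L * ‖h - k‖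

namespace InterfaceSub

variable {e : E} {w w₁ w₂ : E → ℝ} {G G₁ G₂ : E → E → ℝ} {r₀ : ℝ}

theorem le_zero_of_isSlope (H : InterfaceSub e w G r₀) {s : ℝ} (hl : IsSlope (-e) w (-s))
    (hr : IsSlope e w s) : G (s • e) 0 ≤ 0 := by
  obtain ⟨C₁, r₁, hr₁, h₁⟩ := hl
  obtain ⟨C₂, r₂, hr₂, h₂⟩ := hr
  have := H.test (s • e) (max C₁ C₂) 0 0 (by simpa using H.pos) (by simp) ?_
  · simpa using this
  have : ∀ᶠ k : E in 𝓝 0, k ∈ ball (0 : E) (min r₁ r₂) := isOpen_ball.mem_nhds (by simp [hr₁, hr₂])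
  filter_upwards [this] with k hk
  simp only [mem_ball, dist_zero_right, lt_min_iff] at hk
  simp only [H.zero, inner_zero_right, sub_zero, norm_zero, inner_smul_left, conj_trivial]
  norm_num
  have hc₁ : C₁ * ‖k‖ ^ 2 ≤ max C₁ C₂ * ‖k‖ ^ 2 := by gcongr; exact le_max_left _ _
  have hc₂ : C₂ * ‖k‖ ^ 2 ≤ max C₁ C₂ * ‖k‖ ^ 2 := by gcongr; exact le_max_right _ _
  rcases le_total 0 (inner ℝ e k) with h | h
  · linarith [h₂ k hk.2 h]
  · have := h₁ k hk.1 (by rw [inner_neg_left]; linarith)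
    rw [inner_neg_left] at this
    linarith

theorem exists_isSlope_neg (H : InterfaceSub e w G r₀) {C₀ : ℝ}
    (h0 : ∀ h, ‖h‖ < r₀ → inner ℝ e h = 0 → w h ≤ C₀ * ‖h‖ ^ 2) : ∃ s, IsSlope (-e) w s := by
  obtain ⟨L, hL⟩ := H.lip
  have hee : inner ℝ e e = (1 : ℝ) := by rw [real_inner_self_eq_norm_sq, H.unit, one_pow]
  refine ⟨L, max C₀ 0, r₀, H.pos, fun h hh hn => ?_⟩
  rw [inner_neg_left] at hn ⊢
  set k := h - inner ℝ e h • e with hk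
  have hke : inner ℝ e k = 0 := by
    rw [hk, inner_sub_right, inner_smul_right, hee, mul_one, sub_self]
  have hsq : ‖k‖ ^ 2 ≤ ‖h‖ ^ 2 := by
    rw [hk, norm_sub_sq_real, inner_smul_right, norm_smul, H.unit, mul_one, Real.norm_eq_abs,
      sq_abs, real_inner_comm]
    linarith [mul_self_nonneg (inner ℝ h e), sq (inner ℝ h e)]
  have hkh : ‖k‖ ≤ ‖h‖ := le_of_sq_le_sq hsq (norm_nonneg _)
  have h1 := hL h k hh (hkh.trans_lt hh) (by linarith) hke.le
  have h2 := h0 k (hkh.trans_lt hh) hke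
  rw [hk, sub_sub_cancel, norm_smul, H.unit, mul_one, Real.norm_eq_abs,
    abs_of_nonpos (by linarith), ← hk] at h1
  have h3 : C₀ * ‖k‖ ^ 2 ≤ max C₀ 0 * ‖h‖ ^ 2 := by
    gcongr
    exact le_max_left _ _
  linarith

theorem exists_le_of_isSlope_neg (H : InterfaceSub e w G r₀) :
    ∃ m, ∀ s, IsSlope (-e) w s → m ≤ s := by
  obtain ⟨L, hL⟩ := H.lip
  refine ⟨-L, fun s ⟨C, r, hr, hs⟩ => ?_⟩
  have hee : inner ℝ e e = (1 : ℝ) := by rw [real_inner_self_eq_norm_sq, H.unit, one_pow]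
  have hev : ∀ᶠ t : ℝ in 𝓝[>] 0, -L - C * t ≤ s := by
    filter_upwards [Ioo_mem_nhdsGT (lt_min hr H.pos)] with t ht
    obtain ⟨ht0, ht⟩ := ht
    rw [lt_min_iff] at ht
    have hn : ‖(-t) • e‖ = t := by
      rw [norm_smul, H.unit, mul_one, norm_neg, Real.norm_of_nonneg ht0.le]
    have hi : inner ℝ e ((-t) • e) = -t := by rw [inner_smul_right, hee, mul_one]
    have h1 := hs ((-t) • e) (by rw [hn]; exact ht.1) (by rw [inner_neg_left, hi]; linarith)
    have h2 := hL 0 ((-t) • e) (by simpa using H.pos) (by rw [hn]; exact ht.2) (by simp)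
      (by rw [hi]; linarith)
    rw [inner_neg_left, hi, hn, neg_neg] at h1
    rw [H.zero, zero_sub, norm_neg, hn] at h2
    have h3 : t * (-L - C * t) ≤ t * s := by linarith [sq t]
    exact le_of_mul_le_mul_left h3 ht0
  have ht : Tendsto (fun t : ℝ => -L - C * t) (𝓝[>] 0) (𝓝 (-L - C * 0)) :=
    (Continuous.tendsto (by fun_prop) 0).mono_left nhdsWithin_le_nhds
  rw [mul_zero, sub_zero] at ht
  exact le_of_tendsto ht hev

theorem exists_critical [FiniteDimensional ℝ E] (H : InterfaceSub e w G r₀) {C₀ : ℝ}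
    (h0 : ∀ h, ‖h‖ < r₀ → inner ℝ e h = 0 → w h ≤ C₀ * ‖h‖ ^ 2) :
    ∃ σ, (∀ δ > 0, IsSlope (-e) w (σ + δ)) ∧ (∀ δ > 0, ¬ IsSlope (-e) w (σ - δ)) ∧
      G (σ • (-e)) 0 ≤ 0 := by
  obtain ⟨m, hm⟩ := H.exists_le_of_isSlope_neg
  obtain ⟨σ, hgood, hbad⟩ := exists_critical_slope (H.exists_isSlope_neg h0) hm
  refine ⟨σ, hgood, hbad, le_zero_of_critical_slope (by rw [norm_neg, H.unit]) H.pos H.cont hgood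
    hbad ?_ fun β h₀ h hh hn hloc => ?_⟩
  · have h1 := H.contG (σ • (-e), 0) ⟨mem_univ _, by simpa using H.pos⟩
    refine h1.mono_of_mem_nhdsWithin ?_
    have h2 : (univ ×ˢ ball (0 : E) r₀ : Set (E × E)) ∈ 𝓝 (σ • (-e), (0 : E)) :=
      (isOpen_univ.prod isOpen_ball).mem_nhds ⟨mem_univ _, by simpa using H.pos⟩
    filter_upwards [mem_nhdsWithin_of_mem_nhds h2, self_mem_nhdsWithin] with q hq hq'
    refine ⟨mem_univ _, by simpa using hq.2, ?_⟩
    have : 0 ≤ inner ℝ (-e) q.2 := hq'.2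
    rw [inner_neg_left] at this
    linarith
  · rw [inner_neg_left] at hn
    refine H.test _ _ _ _ hh (by linarith) ?_
    simpa only [inner_smul_left, conj_trivial] using hloc

/-- Two functions coupled across the interface have a common momentum. -/
theorem exists_common_slope [FiniteDimensional ℝ E] (H₁ : InterfaceSub e w₁ G₁ r₀)
    (H₂ : InterfaceSub e w₂ G₂ r₀) {c : ℝ} (hc : 0 ≤ c)
    (hpair : ∀ h k, ‖h‖ < r₀ → ‖k‖ < r₀ → inner ℝ e h = inner ℝ e k →
      w₁ h + w₂ k ≤ c * ‖h - k‖ ^ 2) :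
    ∃ s : ℝ, G₁ (s • e) 0 ≤ 0 ∧ G₂ (-(s • e)) 0 ≤ 0 := by
  have h01 : ∀ h, ‖h‖ < r₀ → inner ℝ e h = 0 → w₁ h ≤ c * ‖h‖ ^ 2 := fun h hh hn => by
    have := hpair h 0 hh (by simpa using H₁.pos) (by rw [hn, inner_zero_right])
    rwa [H₂.zero, add_zero, sub_zero] at this
  have h02 : ∀ h, ‖h‖ < r₀ → inner ℝ e h = 0 → w₂ h ≤ c * ‖h‖ ^ 2 := fun h hh hn => by
    have := hpair 0 h (by simpa using H₁.pos) hh (by rw [hn, inner_zero_right])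
    rwa [H₁.zero, zero_add, zero_sub, norm_neg] at this
  obtain ⟨σ₁, hg₁, hb₁, hz₁⟩ := H₁.exists_critical h01
  obtain ⟨σ₂, hg₂, hb₂, hz₂⟩ := H₂.exists_critical h02
  obtain ⟨C₂, hC₂, hslab⟩ := H₂.slab
  obtain ⟨b, hb⟩ := hslab.exists_isSlope H₂.unit H₂.pos hC₂ H₂.cont h02
  have hmem : (0 : E) ∈ {h : E | ‖h‖ < r₀ ∧ inner ℝ e h ≤ 0} := by simpa using H₁.pos
  have hcont : ∀ {w : E → ℝ} {G : E → E → ℝ} (_ : InterfaceSub e w G r₀),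
      Continuous fun p => G p 0 := fun H => by
    rw [← continuousOn_univ]
    exact H.contG.comp (f := fun p : E => (p, (0 : E))) (by fun_prop)
      fun p _ => ⟨mem_univ _, hmem⟩
  have key := exists_matching_slope (LU := {s | IsSlope (-e) w₁ (-s)}) (RU := {s | IsSlope e w₁ s})
    (LV := {s | IsSlope (-e) w₂ s}) (RV := {s | IsSlope e w₂ (-s)})
    (gu := fun s => G₁ (s • e) 0) (gv := fun s => -G₂ (-(s • e)) 0) (A := -σ₁) (B := σ₂)
    ((hcont H₁).comp (by fun_prop : Continuous fun s : ℝ => s • e))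
    ((hcont H₂).comp (by fun_prop : Continuous fun s : ℝ => -(s • e))).neg
    (fun s hs => ?_) (by simpa using hz₁) (fun s hs => ?_) (by simpa using hz₂)
    ⟨-b, by simpa using hb⟩ (fun s hs s' hs' => hs.mono (neg_le_neg hs'))
    (fun s hl hr => H₁.le_zero_of_isSlope hl hr) (fun s hl hr => ?_) (fun hneg => ?_)
    (fun s hs s' hss' => ?_)
  · obtain ⟨s, hs1, hs2⟩ := key
    exact ⟨s, hs1, by linarith⟩
  · have := hg₁ (-s - σ₁) (by linarith)
    rwa [add_sub_cancel] at this
  · have := hg₂ (s - σ₂) (by linarith)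
    rwa [add_sub_cancel] at this
  · have h1 : IsSlope (-e) w₂ (-(-s)) := by rw [neg_neg]; exact hl
    have := H₂.le_zero_of_isSlope h1 hr
    rw [neg_smul] at this
    linarith
  · by_contra hlt
    push Not at hlt
    have hpos : 0 < G₂ (σ₁ • e) 0 := by simpa using hneg
    have h1 := (H₂.contG (σ₁ • e, 0) ⟨mem_univ _, hmem⟩).eventually (lt_mem_nhds hpos)
    rw [eventually_nhdsWithin_iff] at h1
    obtain ⟨m, hm, hball⟩ := Metric.eventually_nhds_iff_ball.1 h1
    set δ := min (m / 4) ((σ₁ + σ₂) / 4) with hδ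
    have hδpos : 0 < δ := lt_min (by linarith) (by linarith)
    have hδm : δ ≤ m / 4 := min_le_left _ _
    have hδσ : δ ≤ (σ₁ + σ₂) / 4 := min_le_right _ _
    have h2 := isSlope_of_not_isSlope (ν := -e) (by rw [norm_neg, H₁.unit]) H₁.pos hc H₂.cont
      H₁.zero H₂.zero (fun h k hh hk hn => hpair h k hh hk (by simpa using hn))
      (hg₂ 1 one_pos) (hb₁ δ hδpos) (s' := σ₁ - 2 * δ) (by linarith) fun α hα => ?_
    · have h3 := hb₂ (σ₂ - -(σ₁ - 2 * δ)) (by linarith)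
      rw [sub_sub_cancel] at h3
      exact h3 h2
    · refine ⟨min (min r₀ m) (m / (4 * (α + 1))), ?_, 0, le_rfl, fun k hk hn hloc => ?_⟩
      · have := H₁.pos
        positivity
      rw [lt_min_iff, lt_min_iff] at hk
      obtain ⟨⟨hk1, hk2⟩, hk3⟩ := hk
      rw [inner_neg_left] at hn
      have h3 := H₂.test ((σ₁ - 2 * δ) • e) α 0 k hk1 (by linarith) (by
        filter_upwards [hloc] with z hz
        simp only [slabTest, inner_neg_left, inner_smul_left, conj_trivial, sub_zero,
          zero_mul] at hz ⊢
        linarith)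
      rw [sub_zero] at h3
      have h4 := hball ((σ₁ - 2 * δ) • e + (2 * α) • k, k) (by
        rw [mem_ball, Prod.dist_eq, max_lt_iff]
        refine ⟨?_, by simpa using hk2⟩
        rw [dist_eq_norm]
        have h5 : (σ₁ - 2 * δ) • e + (2 * α) • k - σ₁ • e = (-(2 * δ)) • e + (2 * α) • k := by
          module
        rw [h5]
        refine (norm_add_le _ _).trans_lt ?_
        rw [norm_smul, norm_smul, H₁.unit, norm_neg, Real.norm_of_nonneg (by positivity),
          Real.norm_of_nonneg (by positivity)]
        rw [lt_div_iff₀ (by positivity)] at hk3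
        linarith [norm_nonneg k]) ⟨mem_univ _, hk1, by simpa using hn.le⟩
      exact absurd h3 (not_le.2 h4)
  · refine isSlope_of_not_isSlope H₁.unit H₁.pos hc H₂.cont H₁.zero H₂.zero hpair hb hs hss'
      fun α hα => ⟨r₀, H₁.pos, C₂ * (1 + |-s'| + α) + 1, by positivity, fun k hk hn hloc => ?_⟩
    have := hslab (-s') α _ k hα (by positivity) hk hn hloc
    linarith

end InterfaceSub

end Interface

section Transmission

variable {n : ℕ}

/-- The lower half of uniform ellipticity. -/
def LowerElliptic (l L : ℝ) (F : Matrix (Fin n) (Fin n) ℝ → Euc n → ℝ → ℝ) : Prop :=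
  ∀ M₁ M₂ p₁ p₂ z₁ z₂, pucciMinus l L (M₂ - M₁) - L * ‖p₂ - p₁‖ - L * max (-(z₂ - z₁)) 0 ≤
    F M₂ p₂ z₂ - F M₁ p₁ z₁

theorem LowerElliptic.neg {l L : ℝ} {F : Matrix (Fin n) (Fin n) ℝ → Euc n → ℝ → ℝ}
    (hF : LowerElliptic l L F) : LowerElliptic l L fun M p z => -F (-M) (-p) (-z) := by
  intro M₁ M₂ p₁ p₂ z₁ z₂
  have := hF (-M₂) (-M₁) (-p₂) (-p₁) (-z₂) (-z₁)
  rw [neg_sub_neg, neg_sub_neg, neg_sub_neg] at this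
  linarith

/-- Sub-solutions of the transmission problem, tested with quadratic functions. -/
structure TransSub (l L : ℝ) (Ω : Set (Euc (n + 1))) (H : Euc (n + 1) → ℝ → Euc (n + 1) → ℝ)
    (F : Matrix (Fin (n + 1)) (Fin (n + 1)) ℝ → Euc (n + 1) → ℝ → ℝ)
    (f : ℝ → Euc (n + 1) → ℝ) (u : Euc (n + 1) → ℝ) : Prop where
  isOpen : IsOpen Ω
  cont : ContinuousOn u Ω
  contH : ContinuousOn (fun q : Euc (n + 1) × ℝ × Euc (n + 1) => H q.1 q.2.1 q.2.2)
    (univ ×ˢ univ ×ˢ {x | x ∈ Ω ∧ x (Fin.last n) ≤ 0})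
  contf : ContinuousOn (fun q : ℝ × Euc (n + 1) => f q.1 q.2)
    (univ ×ˢ {x | x ∈ Ω ∧ 0 ≤ x (Fin.last n)})
  ell : LowerElliptic l L F
  lip : ∀ x₀ ∈ Ω, x₀ (Fin.last n) = 0 → ∃ K, ∃ r > 0, ∀ x ∈ ball x₀ r, ∀ y ∈ ball x₀ r,
    x (Fin.last n) ≤ 0 → y (Fin.last n) ≤ 0 → u x ≤ u y + K * ‖x - y‖
  left : ∀ (P : Euc (n + 1)) (T : Euc (n + 1) →L[ℝ] Euc (n + 1)) (x₀ x₁ : Euc (n + 1)),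
    (∀ a b, inner ℝ (T a) b = inner ℝ (T b) a) → x₁ ∈ Ω → x₁ (Fin.last n) ≤ 0 →
    (∀ᶠ x in 𝓝 x₁, u x - quad P T x₀ x ≤ u x₁ - quad P T x₀ x₁) →
    H (P + T (x₁ - x₀)) (u x₁) x₁ ≤ 0
  right : ∀ (P : Euc (n + 1)) (T : Euc (n + 1) →L[ℝ] Euc (n + 1)) (x₀ x₁ : Euc (n + 1)),
    (∀ a b, inner ℝ (T a) b = inner ℝ (T b) a) → x₁ ∈ Ω → 0 < x₁ (Fin.last n) →
    (∀ᶠ x in 𝓝 x₁, u x - quad P T x₀ x ≤ u x₁ - quad P T x₀ x₁) →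
    F (opMatrix T) (P + T (x₁ - x₀)) (u x₁) + f (u x₁) x₁ ≤ 0

theorem norm_slabOp_le {α κ : ℝ} (hα : 0 ≤ α) (hκ : 0 ≤ κ) (h : Euc (n + 1)) :
    ‖slabOp n α κ h‖ ≤ (2 * α + 2 * κ) * ‖h‖ := by
  have hc : ∀ a : Euc (n + 1), |a (Fin.last n)| ≤ ‖a‖ := fun a => PiLp.norm_apply_le a _
  set T := slabOp n α κ h with hT
  have h1 : ‖T‖ ^ 2 ≤ (2 * α + 2 * κ) * (‖h‖ * ‖T‖) := by
    rw [← real_inner_self_eq_norm_sq]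
    nth_rewrite 1 [hT]
    rw [inner_slabOp]
    have h2 := real_inner_le_norm h T
    have h3 : -(h (Fin.last n) * T (Fin.last n)) ≤ ‖h‖ * ‖T‖ := by
      refine (neg_le_abs _).trans ?_
      rw [abs_mul]
      exact mul_le_mul (hc h) (hc T) (abs_nonneg _) (norm_nonneg _)
    have h4 := mul_le_mul_of_nonneg_left h2 hα
    have h5 := mul_le_mul_of_nonneg_left h3 hκ
    linarith
  rcases (norm_nonneg T).eq_or_lt with h0 | h0
  · rw [← h0]; positivity
  · refine le_of_mul_le_mul_right ?_ h0
    linarith [sq ‖T‖]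

namespace TransSub

variable {l L : ℝ} {Ω : Set (Euc (n + 1))} {H : Euc (n + 1) → ℝ → Euc (n + 1) → ℝ}
  {F : Matrix (Fin (n + 1)) (Fin (n + 1)) ℝ → Euc (n + 1) → ℝ → ℝ}
  {f : ℝ → Euc (n + 1) → ℝ} {u : Euc (n + 1) → ℝ}

theorem exists_slab_bound (hl : 0 < l) (hL : l ≤ L) (hu : TransSub l L Ω H F f u)
    {x₀ : Euc (n + 1)} (hx₀ : x₀ ∈ Ω) (hx₀' : x₀ (Fin.last n) = 0) (p : Euc (n + 1)) :
    ∃ C, 0 ≤ C ∧ ∃ r₁ > 0, ∀ s α κ : ℝ, ∀ h : Euc (n + 1), 0 ≤ α → 0 ≤ κ → ‖h‖ < r₁ →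
      0 < h (Fin.last n) →
      (∀ᶠ x in 𝓝 (x₀ + h), u x - quad (p + s • EuclideanSpace.single (Fin.last n) 1)
        (slabOp n α κ) x₀ x ≤ u (x₀ + h) - quad (p + s • EuclideanSpace.single (Fin.last n) 1)
        (slabOp n α κ) x₀ (x₀ + h)) → κ ≤ C * (1 + |s| + α) := by
  have hL0 : 0 < L := hl.trans_le hL
  have hg : ContinuousWithinAt (fun x => |u x| + |f (u x) x|) {x | x ∈ Ω ∧ 0 ≤ x (Fin.last n)}
      x₀ := by
    have h1 : ContinuousOn u {x | x ∈ Ω ∧ 0 ≤ x (Fin.last n)} := hu.cont.mono fun x hx => hx.1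
    have h2 : ContinuousOn (fun x => f (u x) x) {x | x ∈ Ω ∧ 0 ≤ x (Fin.last n)} :=
      hu.contf.comp (f := fun x => (u x, x)) (h1.prodMk continuousOn_id)
        fun x hx => ⟨mem_univ _, hx⟩
    exact (h1.abs.add h2.abs) x₀ ⟨hx₀, hx₀'.ge⟩
  set B := |u x₀| + |f (u x₀) x₀| + 1 with hB
  have h1 := hg.eventually (gt_mem_nhds (lt_add_one _ : _ < B))
  rw [eventually_nhdsWithin_iff] at h1
  obtain ⟨r, hr, hball⟩ := Metric.eventually_nhds_iff_ball.1 (h1.and (hu.isOpen.mem_nhds hx₀))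
  set r₁ := min r (l / (2 * L)) with hr₁
  have hr₁pos : 0 < r₁ := by positivity
  have hr₁l : 2 * L * r₁ ≤ l := by
    have : r₁ ≤ l / (2 * L) := min_le_right _ _
    rw [le_div_iff₀ (by positivity)] at this
    linarith
  set D := L * B + |F 0 0 0| + B with hD
  have hB0 : 0 ≤ B := by positivity
  have hD0 : 0 ≤ D := by positivity
  set A := 2 * L * (n + 1) + L * ‖p‖ + L + l + D with hA
  have hA0 : 0 ≤ A := by positivity
  refine ⟨A / l, by positivity, r₁, hr₁pos, fun s α κ h hα hκ hh hn hloc => ?_⟩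
  have hmem : x₀ + h ∈ ball x₀ r := by
    simpa [mem_ball, dist_eq_norm] using hh.trans_le (min_le_left _ _)
  have hlast : (x₀ + h) (Fin.last n) = h (Fin.last n) := by simp [hx₀']
  have hΩh := (hball _ hmem).2
  have hb := (hball _ hmem).1 ⟨hΩh, by rw [hlast]; exact hn.le⟩
  have h2 := hu.right _ _ x₀ (x₀ + h) (slabOp_symm α κ) hΩh (by rw [hlast]; exact hn) hloc
  rw [add_sub_cancel_left] at h2
  set x := x₀ + h with hx
  have h3 := hu.ell 0 (opMatrix (slabOp n α κ)) 0
    (p + s • EuclideanSpace.single (Fin.last n) 1 + slabOp n α κ h) 0 (u x)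
  rw [sub_zero, sub_zero, sub_zero] at h3
  have h4 := le_pucciMinus_slabOp (n := n) hL hα hκ
  have h5 : ‖p + s • EuclideanSpace.single (Fin.last n) (1 : ℝ) + slabOp n α κ h‖ ≤
      ‖p‖ + |s| + (2 * α + 2 * κ) * r₁ := by
    refine (norm_add₃_le).trans ?_
    have : ‖s • (EuclideanSpace.single (Fin.last n) (1 : ℝ) : Euc (n + 1))‖ = |s| := by
      rw [norm_smul, PiLp.norm_single, norm_one, mul_one, Real.norm_eq_abs]
    rw [this]
    have h6 := norm_slabOp_le hα hκ h
    have h7 : (2 * α + 2 * κ) * ‖h‖ ≤ (2 * α + 2 * κ) * r₁ := by gcongr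
    linarith
  have h6 : L * ‖p + s • EuclideanSpace.single (Fin.last n) (1 : ℝ) + slabOp n α κ h‖ ≤
      L * (‖p‖ + |s| + (2 * α + 2 * κ) * r₁) := by gcongr
  have h7 : L * max (-u x) 0 ≤ L * B := by
    gcongr
    refine max_le ?_ hB0
    linarith [neg_le_abs (u x), abs_nonneg (f (u x) x)]
  have h8 : -f (u x) x ≤ B := by linarith [neg_le_abs (f (u x) x), abs_nonneg (u x)]
  have h9 : κ * (2 * L * r₁) ≤ κ * l := by gcongr
  have h10 : α * (2 * L * r₁) ≤ α * l := by gcongr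
  have h11 := neg_le_abs (F 0 0 0)
  have h12 : κ * l ≤ 2 * L * (n + 1) * α + L * ‖p‖ + L * |s| + α * l + D := by
    rw [hD]
    linarith
  rw [div_mul_eq_mul_div, le_div_iff₀ hl]
  refine h12.trans ?_
  have e1 : 0 ≤ |s| := abs_nonneg s
  have t1 : 0 ≤ 2 * L * (n + 1) := by positivity
  have t2 : 0 ≤ L * ‖p‖ := by positivity
  have e2 : A * (1 + |s| + α) = A + A * |s| + A * α := by ring
  have e3 : L * |s| ≤ A * |s| := by gcongr; rw [hA]; linarith
  have e4 : (2 * L * (n + 1) + l) * α ≤ A * α := by gcongr; rw [hA]; linarith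
  rw [e2]
  linarith

theorem exists_interfaceSub (hl : 0 < l) (hL : l ≤ L) (hu : TransSub l L Ω H F f u)
    {x₀ : Euc (n + 1)} (hx₀ : x₀ ∈ Ω) (hx₀' : x₀ (Fin.last n) = 0) (p : Euc (n + 1)) :
    ∃ r₁ > 0, ∀ r₀ > 0, r₀ ≤ r₁ → InterfaceSub (EuclideanSpace.single (Fin.last n) (1 : ℝ))
      (fun h => u (x₀ + h) - u x₀ - inner ℝ p h) (fun q h => H (p + q) (u (x₀ + h)) (x₀ + h))
      r₀ := by
  obtain ⟨C, hC, r, hr, hslab⟩ := hu.exists_slab_bound hl hL hx₀ hx₀' p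
  obtain ⟨K, r', hr', hlip⟩ := hu.lip x₀ hx₀ hx₀'
  obtain ⟨r'', hr'', hball⟩ := Metric.isOpen_iff.1 hu.isOpen x₀ hx₀
  have hin : ∀ a : Euc (n + 1), inner ℝ (EuclideanSpace.single (Fin.last n) (1 : ℝ)) a =
      a (Fin.last n) := fun a => by simp [EuclideanSpace.inner_single_left]
  have hmem : ∀ {h : Euc (n + 1)} {t : ℝ}, ‖h‖ < t → x₀ + h ∈ ball x₀ t := fun hh => by
    simpa [mem_ball, dist_eq_norm] using hh
  have hlast : ∀ h : Euc (n + 1), (x₀ + h) (Fin.last n) = h (Fin.last n) := fun h => by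
    simp [hx₀']
  have htrans : ∀ {φ : Euc (n + 1) → ℝ} {ψ : Euc (n + 1) → ℝ} {h : Euc (n + 1)},
      (∀ᶠ k in 𝓝 h, u (x₀ + k) - u x₀ - inner ℝ p k - φ k ≤
        u (x₀ + h) - u x₀ - inner ℝ p h - φ h) → (∀ k, ψ (x₀ + k) = inner ℝ p k + φ k) →
      ∀ᶠ x in 𝓝 (x₀ + h), u x - ψ x ≤ u (x₀ + h) - ψ (x₀ + h) := by
    intro φ ψ h hloc hψ
    have ht : Tendsto (fun x => x - x₀) (𝓝 (x₀ + h)) (𝓝 h) := by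
      have : Continuous fun x : Euc (n + 1) => x - x₀ := by fun_prop
      simpa using this.tendsto (x₀ + h)
    filter_upwards [ht.eventually hloc] with x hx
    have h1 := hψ (x - x₀)
    rw [add_sub_cancel] at hx h1
    rw [h1, hψ]
    linarith
  refine ⟨min r (min r' r''), by positivity, fun r₀ hr₀ hle => ?_⟩
  rw [le_min_iff, le_min_iff] at hle
  have hmaps : MapsTo (fun h => x₀ + h) (ball (0 : Euc (n + 1)) r₀) Ω := fun h hh =>
    hball (hmem (by simpa using hh.trans_le hle.2.2))
  have hcu : ContinuousOn (fun h => u (x₀ + h)) (ball 0 r₀) :=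
    hu.cont.comp (by fun_prop) hmaps
  refine ⟨by simp, hr₀, by simp, ?_, ?_, ?_, ⟨C, hC, ?_⟩, ⟨K + ‖p‖, ?_⟩⟩
  · exact (hcu.sub continuousOn_const).sub (Continuous.continuousOn (by fun_prop))
  · refine hu.contH.comp (f := fun q : Euc (n + 1) × Euc (n + 1) =>
      (p + q.1, u (x₀ + q.2), x₀ + q.2)) ?_ fun q hq => ⟨mem_univ _, mem_univ _, ?_, ?_⟩
    · refine ContinuousOn.prodMk (by fun_prop) (ContinuousOn.prodMk ?_ (by fun_prop))
      exact hcu.comp (f := Prod.snd) continuousOn_snd fun q hq => by simpa using hq.2.1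
    · exact hmaps (by simpa using hq.2.1)
    · dsimp only
      rw [hlast, ← hin]
      exact hq.2.2
  · intro P β h₀ h hh hn hloc
    rw [hin] at hn
    have h1 := hu.left (p + P) ((2 * β) • ContinuousLinearMap.id ℝ _) (x₀ + h₀) (x₀ + h)
      (fun a b => by simp [inner_smul_left, real_inner_comm])
      (hball (hmem (hh.trans_le hle.2.2))) (by rwa [hlast]) ?_
    · simpa [add_assoc] using h1
    · have := htrans (φ := fun k => inner ℝ P k + β * ‖k - h₀‖ ^ 2)
        (ψ := fun x => quad (p + P) ((2 * β) • ContinuousLinearMap.id ℝ _) (x₀ + h₀) x +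
          inner ℝ (p + P) h₀) hloc fun k => ?_
      · filter_upwards [this] with x hx
        linarith
      · simp only [quad, add_sub_add_left_eq_sub, smul_apply, ContinuousLinearMap.id_apply,
          inner_smul_left, conj_trivial, real_inner_self_eq_norm_sq]
        rw [inner_sub_right, inner_add_left, inner_add_left]
        ring
  · intro s α κ h hα hκ hh hn hloc
    rw [hin] at hn
    refine hslab s α κ h hα hκ (hh.trans_le hle.1) hn (htrans hloc fun k => ?_)
    simp only [quad, slabTest, add_sub_cancel_left, inner_slabOp, hin, inner_add_left,
      inner_smul_left, conj_trivial, real_inner_self_eq_norm_sq]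
    ring
  · intro h k hh hk hn hnk
    rw [hin] at hn hnk
    have h1 := hlip (x₀ + h) (hmem (hh.trans_le hle.2.1)) (x₀ + k) (hmem (hk.trans_le hle.2.1))
      (by rwa [hlast]) (by rwa [hlast])
    rw [add_sub_add_left_eq_sub] at h1
    have h2 := real_inner_le_norm p (k - h)
    rw [inner_sub_right, norm_sub_rev] at h2
    linarith

end TransSub

end Transmission

section Pairs

theorem exists_forall_of_eventually_diag {E : Type*} [NormedAddCommGroup E] {K : Set E}
    (hK : IsCompact K) {g : E × E → ℝ} (hg : ContinuousOn g (K ×ˢ K)) {c : ℝ} {Q : E × E → Prop}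
    (h : ∀ z ∈ K, c ≤ g (z, z) → ∀ᶠ q in 𝓝[K ×ˢ K] (z, z), Q q) :
    ∃ d > 0, ∀ x ∈ K, ∀ y ∈ K, ‖x - y‖ ≤ d → c ≤ g (x, y) → Q (x, y) := by
  by_contra hcon
  push Not at hcon
  choose x hx y hy hxy hc hQ using fun k : ℕ => hcon (1 / ((k : ℝ) + 1)) (by positivity)
  obtain ⟨z, hz, φ, hφ, hlim⟩ := hK.tendsto_subseq hx
  have h0 : Tendsto (fun k => x (φ k) - y (φ k)) atTop (𝓝 0) :=
    squeeze_zero_norm (fun k => hxy (φ k))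
      (tendsto_one_div_add_atTop_nhds_zero_nat.comp hφ.tendsto_atTop)
  have hlimy : Tendsto (fun k => y (φ k)) atTop (𝓝 z) := by
    have := hlim.sub h0
    simpa using this
  have hpair : Tendsto (fun k => (x (φ k), y (φ k))) atTop (𝓝[K ×ˢ K] (z, z)) :=
    tendsto_nhdsWithin_iff.2 ⟨hlim.prodMk_nhds hlimy,
      Eventually.of_forall fun k => ⟨hx _, hy _⟩⟩
  have hcz : c ≤ g (z, z) :=
    ge_of_tendsto ((hg (z, z) ⟨hz, hz⟩).tendsto.comp hpair) (Eventually.of_forall fun k => hc _)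
  obtain ⟨k, hk⟩ := (hpair.eventually (h z hz hcz)).exists
  exact hQ _ hk

variable {n : ℕ}

theorem opMatrix_neg (T : Euc n →L[ℝ] Euc n) : opMatrix (-T) = -opMatrix T := by
  ext i j
  simp [opMatrix]

namespace TransSub

variable {l L : ℝ} {Ω : Set (Euc (n + 1))} {H H' : Euc (n + 1) → ℝ → Euc (n + 1) → ℝ}
  {F F' : Matrix (Fin (n + 1)) (Fin (n + 1)) ℝ → Euc (n + 1) → ℝ → ℝ}
  {f f' : ℝ → Euc (n + 1) → ℝ} {u w : Euc (n + 1) → ℝ}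

/-- A maximum point of the doubled function on the interface yields a common momentum. -/
theorem interface_pair (hl : 0 < l) (hL : l ≤ L) (hu : TransSub l L Ω H F f u)
    (hw : TransSub l L Ω H' F' f' w) {ε : ℝ} (hε : 0 < ε) {x y : Euc (n + 1)} (hx : x ∈ Ω)
    (hy : y ∈ Ω) (hx' : x (Fin.last n) = 0) (hy' : y (Fin.last n) = 0)
    (hmax : ∀ x' ∈ Ω, ∀ y' ∈ Ω, x' (Fin.last n) = y' (Fin.last n) →
      u x' + w y' - ‖x' - y'‖ ^ 2 / (2 * ε) ≤ u x + w y - ‖x - y‖ ^ 2 / (2 * ε)) :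
    ∃ P, H P (u x) x ≤ 0 ∧ H' (-P) (w y) y ≤ 0 := by
  set p := (1 / ε) • (x - y) with hp
  obtain ⟨r₁, hr₁, h₁⟩ := hu.exists_interfaceSub hl hL hx hx' p
  obtain ⟨r₂, hr₂, h₂⟩ := hw.exists_interfaceSub hl hL hy hy' (-p)
  obtain ⟨r₃, hr₃, hb₃⟩ := Metric.isOpen_iff.1 hu.isOpen x hx
  obtain ⟨r₄, hr₄, hb₄⟩ := Metric.isOpen_iff.1 hu.isOpen y hy
  have hr : 0 < min (min r₁ r₂) (min r₃ r₄) := by positivity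
  set r := min (min r₁ r₂) (min r₃ r₄) with hrdef
  have hle₁ : r ≤ r₁ := (min_le_left _ _).trans (min_le_left _ _)
  have hle₂ : r ≤ r₂ := (min_le_left _ _).trans (min_le_right _ _)
  have hle₃ : r ≤ r₃ := (min_le_right _ _).trans (min_le_left _ _)
  have hle₄ : r ≤ r₄ := (min_le_right _ _).trans (min_le_right _ _)
  obtain ⟨s, hs₁, hs₂⟩ := (h₁ r hr hle₁).exists_common_slope (h₂ r hr hle₂) (c := 1 / (2 * ε))
    (by positivity) fun h k hh hk hn => by
      simp only [EuclideanSpace.inner_single_left, map_one, one_mul] at hn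
      have := hmax (x + h) (hb₃ (by simpa [mem_ball, dist_eq_norm] using hh.trans_le hle₃)) (y + k)
        (hb₄ (by simpa [mem_ball, dist_eq_norm] using hk.trans_le hle₄)) (by simp [hx', hy', hn])
      rw [add_sub_add_comm, norm_add_sq_real] at this
      have e : ‖x - y‖ ^ 2 / (2 * ε) + 1 / ε * inner ℝ (x - y) (h - k) +
          1 / (2 * ε) * ‖h - k‖ ^ 2 =
          (‖x - y‖ ^ 2 + 2 * inner ℝ (x - y) (h - k) + ‖h - k‖ ^ 2) / (2 * ε) := by
        field_simp
      rw [← e] at this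
      rw [inner_neg_left, hp, inner_smul_left, inner_smul_left, conj_trivial]
      rw [inner_sub_right] at this
      linarith
  refine ⟨p + s • EuclideanSpace.single (Fin.last n) 1, by simpa using hs₁, ?_⟩
  rw [neg_add]
  simpa using hs₂

/-- The second-order equations at a pair of points provided by the theorem on sums. -/
theorem right_pair (hl : 0 < l) (hL : l ≤ L) (hu : TransSub l L Ω H F f u)
    (hw : TransSub l L Ω H' (fun M p z => -F (-M) (-p) (-z)) f' w) {x y : Euc (n + 1)}
    (hx : x ∈ Ω) (hy : y ∈ Ω) (hx' : 0 < x (Fin.last n)) (hy' : 0 < y (Fin.last n))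
    (hpos : 0 ≤ u x + w y) {P₁ P₂ : Euc (n + 1)} {M₁ M₂ : Euc (n + 1) →L[ℝ] Euc (n + 1)}
    (hM₁ : ∀ b c, inner ℝ (M₁ b) c = inner ℝ (M₁ c) b)
    (hM₂ : ∀ b c, inner ℝ (M₂ b) c = inner ℝ (M₂ c) b)
    (hM : ∀ h, inner ℝ (M₁ h) h ≤ inner ℝ (M₂ h) h)
    (h₁ : ∀ η > 0, ∀ᶠ h in 𝓝 0,
      u (x + h) ≤ u x + inner ℝ P₁ h + inner ℝ (M₁ h) h / 2 + η * ‖h‖ ^ 2)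
    (h₂ : ∀ η > 0, ∀ᶠ h in 𝓝 0,
      w (y + h) ≤ w y - inner ℝ P₂ h - inner ℝ (M₂ h) h / 2 + η * ‖h‖ ^ 2) :
    f (u x) x + f' (w y) y ≤ L * ‖P₁ - P₂‖ := by
  have hL0 : 0 < L := hl.trans_le hL
  have htend : ∀ z : Euc (n + 1), Tendsto (fun x' => x' - z) (𝓝 z) (𝓝 0) := fun z => by
    have : Continuous fun x' : Euc (n + 1) => x' - z := by fun_prop
    simpa using this.tendsto z
  have key : ∀ η > 0, f (u x) x + f' (w y) y ≤
      L * ‖P₁ - P₂‖ + η * (4 * (L * ((n + 1 : ℕ) : ℝ))) := by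
    intro η hη
    set I := ContinuousLinearMap.id ℝ (Euc (n + 1)) with hI
    have hs₁ : ∀ a b, inner ℝ ((M₁ + (2 * η) • I) a) b = inner ℝ ((M₁ + (2 * η) • I) b) a :=
      fun a b => by
        simp only [hI, add_apply, smul_apply, ContinuousLinearMap.id_apply,
          inner_add_left, inner_smul_left, hM₁ a b, real_inner_comm a b]
    have hs₂ : ∀ a b, inner ℝ ((M₂ - (2 * η) • I) a) b = inner ℝ ((M₂ - (2 * η) • I) b) a :=
      fun a b => by
        simp only [hI, sub_apply, smul_apply, ContinuousLinearMap.id_apply,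
          inner_sub_left, inner_smul_left, hM₂ a b, real_inner_comm a b]
    have k₁ := hu.right P₁ (M₁ + (2 * η) • I) x x hs₁ hx hx' (by
      filter_upwards [(htend x).eventually (h₁ η hη)] with z hz
      rw [add_sub_cancel] at hz
      simp only [quad, sub_self, map_zero, inner_zero_right, hI, add_apply,
        smul_apply, ContinuousLinearMap.id_apply, inner_add_left, inner_smul_left, conj_trivial,
        real_inner_self_eq_norm_sq]
      linarith)
    have hq₂ : ∀ a, inner ℝ ((M₂ - (2 * η) • I) a) a = inner ℝ (M₂ a) a - 2 * η * ‖a‖ ^ 2 :=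
      fun a => by
        simp only [hI, sub_apply, smul_apply, ContinuousLinearMap.id_apply,
          inner_sub_left, inner_smul_left, conj_trivial, real_inner_self_eq_norm_sq]
    have k₂ := hw.right (-P₂) (-(M₂ - (2 * η) • I)) y y
      (fun a b => by
        rw [neg_apply, neg_apply, inner_neg_left, inner_neg_left, hs₂]) hy hy' (by
      filter_upwards [(htend y).eventually (h₂ η hη)] with z hz
      rw [add_sub_cancel] at hz
      have e := hq₂ (z - y)
      simp only [quad, sub_self, map_zero, inner_zero_right, neg_apply, inner_neg_left, e]
      linarith)
    rw [opMatrix_neg, sub_self, map_zero, add_zero, neg_neg, neg_neg] at k₂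
    rw [sub_self, map_zero, add_zero] at k₁
    have k₃ := hu.ell (opMatrix (M₂ - (2 * η) • I)) (opMatrix (M₁ + (2 * η) • I)) P₂ P₁
      (-w y) (u x)
    rw [← opMatrix_sub, max_eq_right (by linarith), mul_zero, sub_zero] at k₃
    have k₄ := neg_le_pucciMinus_opMatrix hl.le hL
      (T := M₁ + (2 * η) • I - (M₂ - (2 * η) • I)) (fun a b => by
        have e₁ := hs₁ a b
        have e₂ := hs₂ a b
        simp only [add_apply, sub_apply, inner_sub_left, inner_add_left] at e₁ e₂ ⊢
        linarith)
      (μ := 4 * η) (by positivity) (fun k => by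
        have := hM k
        simp only [hI, sub_apply, add_apply, smul_apply, ContinuousLinearMap.id_apply,
          inner_sub_left, inner_add_left, inner_smul_left, conj_trivial,
          real_inner_self_eq_norm_sq]
        linarith)
    linarith
  have ht : Tendsto (fun η : ℝ => L * ‖P₁ - P₂‖ + η * (4 * (L * ((n + 1 : ℕ) : ℝ)))) (𝓝[>] 0)
      (𝓝 (L * ‖P₁ - P₂‖ + 0 * (4 * (L * ((n + 1 : ℕ) : ℝ))))) :=
    (Continuous.tendsto (by fun_prop) 0).mono_left nhdsWithin_le_nhds
  rw [zero_mul, add_zero] at ht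
  exact ge_of_tendsto ht (eventually_of_mem self_mem_nhdsWithin fun η hη => key η hη)

end TransSub

end Pairs

section Comparison

variable {n : ℕ}

namespace TransSub

variable {l L : ℝ} {Ω : Set (Euc (n + 1))} {H H' : Euc (n + 1) → ℝ → Euc (n + 1) → ℝ}
  {F F' : Matrix (Fin (n + 1)) (Fin (n + 1)) ℝ → Euc (n + 1) → ℝ → ℝ}
  {f f' : ℝ → Euc (n + 1) → ℝ} {u w : Euc (n + 1) → ℝ}

theorem continuousOn_zeroth (hu : TransSub l L Ω H F f u) :
    ContinuousOn (fun x => f (u x) x) {x | x ∈ Ω ∧ 0 ≤ x (Fin.last n)} :=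
  hu.contf.comp (f := fun x => (u x, x)) ((hu.cont.mono fun _ hx => hx.1).prodMk continuousOn_id)
    fun _ hx => ⟨mem_univ _, hx⟩

theorem continuousOn_first (hu : TransSub l L Ω H F f u) :
    ContinuousOn (fun q : Euc (n + 1) × Euc (n + 1) => H q.1 (u q.2) q.2)
      (univ ×ˢ {x | x ∈ Ω ∧ x (Fin.last n) ≤ 0}) := by
  refine hu.contH.comp (f := fun q : Euc (n + 1) × Euc (n + 1) => (q.1, u q.2, q.2)) ?_
    fun _ hq => ⟨mem_univ _, mem_univ _, hq.2⟩
  exact continuousOn_fst.prodMk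
    ((hu.cont.comp continuousOn_snd fun q hq => hq.2.1).prodMk continuousOn_snd)

/-- Near the diagonal, at points where `u + w > 0`, the equations of the two functions are
incompatible. -/
theorem eventually_incompatible (hu : TransSub l L Ω H F f u) (hw : TransSub l L Ω H' F' f' w)
    {z : Euc (n + 1)} (hz : z ∈ Ω) (hf : 0 ≤ z (Fin.last n) → 0 < f (u z) z + f' (w z) z) {R : ℝ}
    (hR : ∀ x ∈ Ω, x (Fin.last n) ≤ 0 → ∀ P, H P (u x) x ≤ 0 → ‖P‖ ≤ R)
    (hS : z (Fin.last n) ≤ 0 → ∀ P, H P (u z) z ≤ 0 → 0 < H' (-P) (w z) z) :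
    ∀ᶠ q : Euc (n + 1) × Euc (n + 1) in 𝓝 (z, z), q.1 ∈ Ω ∧ q.2 ∈ Ω ∧
      (0 ≤ q.1 (Fin.last n) → 0 ≤ q.2 (Fin.last n) → 0 < f (u q.1) q.1 + f' (w q.2) q.2) ∧
      (q.1 (Fin.last n) ≤ 0 → q.2 (Fin.last n) ≤ 0 → ∀ P, H P (u q.1) q.1 ≤ 0 →
        0 < H' (-P) (w q.2) q.2) := by
  have hΩ : ∀ᶠ q : Euc (n + 1) × Euc (n + 1) in 𝓝 (z, z), q.1 ∈ Ω ∧ q.2 ∈ Ω :=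
    (hu.isOpen.prod hu.isOpen).mem_nhds ⟨hz, hz⟩
  have hc : Continuous fun q : Euc (n + 1) × Euc (n + 1) => q.1 (Fin.last n) := by fun_prop
  have hright : ∀ᶠ q : Euc (n + 1) × Euc (n + 1) in 𝓝 (z, z), q.1 ∈ Ω ∧ q.2 ∈ Ω →
      0 ≤ q.1 (Fin.last n) → 0 ≤ q.2 (Fin.last n) → 0 < f (u q.1) q.1 + f' (w q.2) q.2 := by
    rcases lt_or_ge (z (Fin.last n)) 0 with hn | hn
    · filter_upwards [hc.continuousAt.eventually (gt_mem_nhds hn)] with q hq _ h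
      linarith
    · have h1 : ContinuousOn (fun q : Euc (n + 1) × Euc (n + 1) => f (u q.1) q.1 + f' (w q.2) q.2)
          ({x | x ∈ Ω ∧ 0 ≤ x (Fin.last n)} ×ˢ {x | x ∈ Ω ∧ 0 ≤ x (Fin.last n)}) :=
        (hu.continuousOn_zeroth.comp continuousOn_fst fun q hq => hq.1).add
          (hw.continuousOn_zeroth.comp continuousOn_snd fun q hq => hq.2)
      have h2 := (h1 (z, z) ⟨⟨hz, hn⟩, hz, hn⟩).eventually (lt_mem_nhds (hf hn))
      rw [eventually_nhdsWithin_iff] at h2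
      filter_upwards [h2] with q hq hqΩ hq1 hq2
      exact hq ⟨⟨hqΩ.1, hq1⟩, hqΩ.2, hq2⟩
  have hleft : ∀ᶠ q : Euc (n + 1) × Euc (n + 1) in 𝓝 (z, z), ∀ P ∈ closedBall (0 : Euc (n + 1)) R,
      q.1 ∈ Ω ∧ q.2 ∈ Ω → q.1 (Fin.last n) ≤ 0 → q.2 (Fin.last n) ≤ 0 → H P (u q.1) q.1 ≤ 0 →
        0 < H' (-P) (w q.2) q.2 := by
    rcases lt_or_ge 0 (z (Fin.last n)) with hn | hn
    · filter_upwards [hc.continuousAt.eventually (lt_mem_nhds hn)] with q hq _ _ _ h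
      linarith
    refine (isCompact_closedBall _ _).eventually_forall_of_forall_eventually fun P _ => ?_
    rcases lt_or_ge 0 (H P (u z) z) with hpos | hneg
    · have h1 := (hu.continuousOn_first (P, z) ⟨mem_univ _, hz, hn⟩).eventually (lt_mem_nhds hpos)
      rw [eventually_nhdsWithin_iff] at h1
      have ht : Tendsto (fun a : (Euc (n + 1) × Euc (n + 1)) × Euc (n + 1) => (a.2, a.1.1))
          (𝓝 ((z, z), P)) (𝓝 (P, z)) := Continuous.tendsto (by fun_prop) ((z, z), P)
      filter_upwards [ht.eventually h1] with a ha haΩ ha1 _ h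
      exact absurd (ha ⟨mem_univ _, haΩ.1, ha1⟩) (not_lt.2 h)
    · have h1 := (hw.continuousOn_first (-P, z) ⟨mem_univ _, hz, hn⟩).eventually
        (lt_mem_nhds (hS hn P hneg))
      rw [eventually_nhdsWithin_iff] at h1
      have ht : Tendsto (fun a : (Euc (n + 1) × Euc (n + 1)) × Euc (n + 1) => (-a.2, a.1.2))
          (𝓝 ((z, z), P)) (𝓝 (-P, z)) := Continuous.tendsto (by fun_prop) ((z, z), P)
      filter_upwards [ht.eventually h1] with a ha haΩ _ ha2 _
      exact ha ⟨mem_univ _, haΩ.2, ha2⟩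
  filter_upwards [hΩ, hright, hleft] with q hq h1 h2
  exact ⟨hq.1, hq.2, h1 hq, fun ha hb P hP => h2 P (by simpa using hR _ hq.1 ha P hP) hq ha hb hP⟩

/-- The doubled function, with an additional penalization in the last variable. -/
def doubled (u w : Euc (n + 1) → ℝ) (ε η : ℝ) (q : Euc (n + 1) × Euc (n + 1)) : ℝ :=
  u q.1 + w q.2 - ‖q.1 - q.2‖ ^ 2 / (2 * ε) - (q.1 (Fin.last n) - q.2 (Fin.last n)) ^ 2 / (2 * η)

theorem continuousOn_doubled {K : Set (Euc (n + 1))} (hu : ContinuousOn u K)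
    (hw : ContinuousOn w K) (ε η : ℝ) : ContinuousOn (doubled u w ε η) (K ×ˢ K) := by
  have h1 : ContinuousOn (fun q : Euc (n + 1) × Euc (n + 1) => u q.1) (K ×ˢ K) :=
    hu.comp continuousOn_fst fun q hq => hq.1
  have h2 : ContinuousOn (fun q : Euc (n + 1) × Euc (n + 1) => w q.2) (K ×ˢ K) :=
    hw.comp continuousOn_snd fun q hq => hq.2
  have h3 : Continuous fun q : Euc (n + 1) × Euc (n + 1) => ‖q.1 - q.2‖ ^ 2 / (2 * ε) := by
    fun_prop
  have h4 : Continuous fun q : Euc (n + 1) × Euc (n + 1) =>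
      (q.1 (Fin.last n) - q.2 (Fin.last n)) ^ 2 / (2 * η) := by
    fun_prop
  exact ((h1.add h2).sub h3.continuousOn).sub h4.continuousOn

theorem doubled_eq (ε η : ℝ) (x y : Euc (n + 1)) : doubled u w ε η (x, y) =
    u x + w y - inner ℝ (slabOp n (1 / (2 * ε)) (-(1 / (2 * η))) (x - y)) (x - y) / 2 := by
  rw [inner_slabOp, real_inner_self_eq_norm_sq]
  simp only [doubled, PiLp.sub_apply]
  ring

variable {K : Set (Euc (n + 1))}

/-- The set of pairs where the second-order equations can hold simultaneously is avoided by some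
maximum point of the doubled function. -/
theorem exists_max_not_right (hl : 0 < l) (hL : l ≤ L) (hu : TransSub l L Ω H F f u)
    (hw : TransSub l L Ω H' (fun M p z => -F (-M) (-p) (-z)) f' w) (hK : IsCompact K)
    (hKne : K.Nonempty) (huK : ContinuousOn u K) (hwK : ContinuousOn w K) (hΩK : Ω ⊆ K)
    {ε η : ℝ} (hε : 0 < ε) (hη : 0 < η)
    (hgood : ∀ q ∈ K ×ˢ K, (∀ q' ∈ K ×ˢ K, doubled u w ε η q' ≤ doubled u w ε η q) →
      q.1 ∈ Ω ∧ q.2 ∈ Ω ∧ 0 < u q.1 + w q.2 ∧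
      (0 ≤ q.1 (Fin.last n) → 0 ≤ q.2 (Fin.last n) → 0 < f (u q.1) q.1 + f' (w q.2) q.2)) :
    ∃ q ∈ K ×ˢ K, (∀ q' ∈ K ×ˢ K, doubled u w ε η q' ≤ doubled u w ε η q) ∧
      (q.1 (Fin.last n) ≤ 0 ∨ q.2 (Fin.last n) ≤ 0) := by
  have hstep : ∀ k : ℕ, ∃ q ∈ K ×ˢ K,
      (∀ q' ∈ K ×ˢ K, doubled u w ε η q' ≤ doubled u w ε η q + 1 / ((k : ℝ) + 1)) ∧
      (q.1 ∈ Ω → q.2 ∈ Ω → 0 < q.1 (Fin.last n) → 0 < q.2 (Fin.last n) → 0 ≤ u q.1 + w q.2 →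
        f (u q.1) q.1 + f' (w q.2) q.2 ≤ L * (1 / ((k : ℝ) + 1))) := by
    intro k
    obtain ⟨x, hx, y, hy, P₁, P₂, M₁, M₂, hP, hM₁, hM₂, hM, h₁, h₂, hmax⟩ :=
      theorem_on_sums hK hKne huK hwK.neg (G := slabOp n (1 / (2 * ε)) (-(1 / (2 * η))))
        (slabOp_symm _ _) (a := 1 / ε) (by positivity) (fun x => by
          rw [inner_slabOp, real_inner_self_eq_norm_sq]
          have e1 : 2 * (1 / (2 * ε)) = 1 / ε := by field_simp
          have e2 : 0 ≤ 2 * (1 / (2 * η)) * (x (Fin.last n) * x (Fin.last n)) :=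
            mul_nonneg (by positivity) (mul_self_nonneg _)
          rw [e1]
          linarith) (τ := 1 / ((k : ℝ) + 1)) (by positivity)
    refine ⟨(x, y), ⟨hx, hy⟩, fun q hq => ?_, fun hxΩ hyΩ hxn hyn hpos => ?_⟩
    · have := hmax q.1 hq.1 q.2 hq.2
      rw [← Prod.mk.eta (p := q), doubled_eq, doubled_eq]
      simp only [Pi.neg_apply, sub_neg_eq_add] at this
      exact this
    · have htend : ∀ z : Euc (n + 1), z ∈ Ω → ∀ᶠ h in 𝓝 0, z + h ∈ K := fun z hz => by
        have hc : Continuous fun h : Euc (n + 1) => z + h := by fun_prop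
        have := hc.tendsto 0
        rw [add_zero] at this
        exact (this.eventually (hu.isOpen.mem_nhds hz)).mono fun h hh => hΩK hh
      refine (right_pair hl hL hu hw hxΩ hyΩ hxn hyn hpos hM₁ hM₂ hM (fun η hη => ?_)
        fun η hη => ?_).trans (mul_le_mul_of_nonneg_left hP (hl.le.trans hL))
      · filter_upwards [h₁ η hη, htend x hxΩ] with h hh hhK
        exact hh hhK
      · filter_upwards [h₂ η hη, htend y hyΩ] with h hh hhK
        have := hh hhK
        simp only [Pi.neg_apply] at this
        linarith
  choose q hqK hqmax hqf using hstep
  obtain ⟨q₀, hq₀, φ, hφ, hlim⟩ := (hK.prod hK).tendsto_subseq hqK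
  have hlimK : Tendsto (fun k => q (φ k)) atTop (𝓝[K ×ˢ K] q₀) :=
    tendsto_nhdsWithin_iff.2 ⟨hlim, Eventually.of_forall fun k => hqK _⟩
  have hτ : Tendsto (fun k => 1 / (((φ k : ℕ) : ℝ) + 1)) atTop (𝓝 0) :=
    tendsto_one_div_add_atTop_nhds_zero_nat.comp hφ.tendsto_atTop
  have hmax : ∀ q' ∈ K ×ˢ K, doubled u w ε η q' ≤ doubled u w ε η q₀ := fun q' hq' => by
    have h1 := ((continuousOn_doubled huK hwK ε η q₀ hq₀).tendsto.comp hlimK).add hτ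
    rw [add_zero] at h1
    exact ge_of_tendsto h1 (Eventually.of_forall fun k => hqmax _ q' hq')
  refine ⟨q₀, hq₀, hmax, ?_⟩
  by_contra hcon
  push Not at hcon
  obtain ⟨hΩ₁, hΩ₂, hpos, hf⟩ := hgood q₀ hq₀ hmax
  have hf := hf hcon.1.le hcon.2.le
  set S : Set (Euc (n + 1)) := {x | x ∈ Ω ∧ 0 < x (Fin.last n)} with hS
  have hlast : Continuous fun x : Euc (n + 1) => x (Fin.last n) := by fun_prop
  have hSo : IsOpen S := hu.isOpen.inter (isOpen_lt continuous_const hlast)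
  have hmem : S ×ˢ S ∈ 𝓝 q₀ := (hSo.prod hSo).mem_nhds ⟨⟨hΩ₁, hcon.1⟩, hΩ₂, hcon.2⟩
  have hsub : S ⊆ {x | x ∈ Ω ∧ 0 ≤ x (Fin.last n)} := fun x hx => ⟨hx.1, hx.2.le⟩
  have hcf : ContinuousAt (fun q : Euc (n + 1) × Euc (n + 1) => f (u q.1) q.1 + f' (w q.2) q.2)
      q₀ := by
    refine ContinuousOn.continuousAt (s := S ×ˢ S) ?_ hmem
    exact ((hu.continuousOn_zeroth.mono hsub).comp continuousOn_fst fun q hq => hq.1).add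
      ((hw.continuousOn_zeroth.mono hsub).comp continuousOn_snd fun q hq => hq.2)
  have hcs : ContinuousAt (fun q : Euc (n + 1) × Euc (n + 1) => u q.1 + w q.2) q₀ := by
    refine ContinuousOn.continuousAt (s := S ×ˢ S) ?_ hmem
    exact ((hu.cont.mono fun x hx => hx.1).comp continuousOn_fst fun q hq => hq.1).add
      ((hw.cont.mono fun x hx => hx.1).comp continuousOn_snd fun q hq => hq.2)
  have hle : f (u q₀.1) q₀.1 + f' (w q₀.2) q₀.2 ≤ L * 0 := by
    refine le_of_tendsto_of_tendsto (hcf.tendsto.comp hlim) (hτ.const_mul L) ?_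
    filter_upwards [hlim.eventually hmem, hlim.eventually (hcs.eventually (lt_mem_nhds hpos))]
      with k hk hk'
    exact hqf _ hk.1.1 hk.2.1 hk.1.2 hk.2.2 hk'.le
  linarith

/-- Comparison for the transmission problem, with `w` playing the role of minus a
super-solution. -/
theorem comparison (hl : 0 < l) (hL : l ≤ L) (hΩb : IsBounded Ω) (hu : TransSub l L Ω H F f u)
    (hw : TransSub l L Ω H' (fun M p z => -F (-M) (-p) (-z)) f' w)
    (huK : ContinuousOn u (closure Ω)) (hwK : ContinuousOn w (closure Ω))
    (hbdry : ∀ x ∈ frontier Ω, u x + w x ≤ 0)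
    (hf : ∀ x ∈ Ω, 0 ≤ x (Fin.last n) → 0 < u x + w x → 0 < f (u x) x + f' (w x) x) {R : ℝ}
    (hR : ∀ x ∈ Ω, x (Fin.last n) ≤ 0 → ∀ P, H P (u x) x ≤ 0 → ‖P‖ ≤ R)
    (hS : ∀ x ∈ Ω, x (Fin.last n) ≤ 0 → 0 < u x + w x → ∀ P, H P (u x) x ≤ 0 →
      0 < H' (-P) (w x) x) :
    ∀ x ∈ Ω, u x + w x ≤ 0 := by
  intro z₀ hz₀
  by_contra hm
  push Not at hm
  set m := u z₀ + w z₀ with hmdef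
  set K := closure Ω with hKdef
  have hK : IsCompact K := hΩb.isCompact_closure
  have hΩK : Ω ⊆ K := subset_closure
  have hsum : ContinuousOn (fun q : Euc (n + 1) × Euc (n + 1) => u q.1 + w q.2) (K ×ˢ K) :=
    (huK.comp continuousOn_fst fun q hq => hq.1).add
      (hwK.comp continuousOn_snd fun q hq => hq.2)
  obtain ⟨d, hd, hinc⟩ := exists_forall_of_eventually_diag hK hsum (c := m)
    (fun z hz hmz => by
      have hzΩ : z ∈ Ω := by
        by_contra hzn
        have := hbdry z ⟨hz, by rwa [hu.isOpen.interior_eq]⟩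
        linarith
      have hpos : 0 < u z + w z := hm.trans_le hmz
      exact mem_nhdsWithin_of_mem_nhds (eventually_incompatible hu hw hzΩ
        (fun h => hf z hzΩ h hpos) hR fun h => hS z hzΩ h hpos))
  obtain ⟨B, hB⟩ := (hK.prod hK).exists_bound_of_continuousOn hsum
  have hz₀K : (z₀, z₀) ∈ K ×ˢ K := ⟨hΩK hz₀, hΩK hz₀⟩
  have hB0 : 0 ≤ B := (norm_nonneg _).trans (hB _ hz₀K)
  set ε := d ^ 2 / (2 * (B + 1)) with hεdef
  have hε : 0 < ε := by positivity
  have hbound : ∀ η > 0, ∀ q ∈ K ×ˢ K, m ≤ doubled u w ε η q → m ≤ u q.1 + w q.2 ∧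
      ‖q.1 - q.2‖ ≤ d ∧ (q.1 (Fin.last n) - q.2 (Fin.last n)) ^ 2 ≤ 2 * B * η := by
    intro η hη q hq hmq
    unfold doubled at hmq
    have h1 : 0 ≤ ‖q.1 - q.2‖ ^ 2 / (2 * ε) := by positivity
    have h2 : 0 ≤ (q.1 (Fin.last n) - q.2 (Fin.last n)) ^ 2 / (2 * η) := by positivity
    have h3 : u q.1 + w q.2 ≤ B := (le_abs_self _).trans (hB q hq)
    refine ⟨by linarith, ?_, ?_⟩
    · have h4 : ‖q.1 - q.2‖ ^ 2 / (2 * ε) ≤ B := by linarith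
      rw [div_le_iff₀ (by positivity)] at h4
      have h5 : (B + 1) * (2 * ε) = d ^ 2 := by rw [hεdef]; field_simp
      refine le_of_sq_le_sq ?_ hd.le
      linarith
    · have h4 : (q.1 (Fin.last n) - q.2 (Fin.last n)) ^ 2 / (2 * η) ≤ B := by linarith
      rw [div_le_iff₀ (by positivity)] at h4
      linarith
  have hcenter : ∀ η, doubled u w ε η (z₀, z₀) = m := fun η => by simp [doubled, hmdef]
  have hstep : ∀ k : ℕ, ∃ q ∈ K ×ˢ K,
      (∀ q' ∈ K ×ˢ K, doubled u w ε (1 / ((k : ℝ) + 1)) q' ≤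
        doubled u w ε (1 / ((k : ℝ) + 1)) q) ∧
      (q.1 (Fin.last n) * q.2 (Fin.last n) ≤ 0) := by
    intro k
    have hη : (0 : ℝ) < 1 / ((k : ℝ) + 1) := by positivity
    set η := 1 / ((k : ℝ) + 1) with hηdef
    obtain ⟨q, hq, hmax, hside⟩ := exists_max_not_right hl hL hu hw hK ⟨z₀, hΩK hz₀⟩ huK hwK hΩK hε
      hη fun q hq hmax => by
        obtain ⟨h1, h2, -⟩ := hbound η hη q hq (by rw [← hcenter η]; exact hmax _ hz₀K)
        obtain ⟨h3, h4, h5, -⟩ := hinc q.1 hq.1 q.2 hq.2 h2 h1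
        exact ⟨h3, h4, hm.trans_le h1, h5⟩
    refine ⟨q, hq, hmax, ?_⟩
    obtain ⟨h1, h2, -⟩ := hbound η hη q hq (by rw [← hcenter η]; exact hmax _ hz₀K)
    obtain ⟨hΩ₁, hΩ₂, -, hleft⟩ := hinc q.1 hq.1 q.2 hq.2 h2 h1
    by_contra hcon
    push Not at hcon
    have hn : q.1 (Fin.last n) < 0 ∧ q.2 (Fin.last n) < 0 := by
      rcases pos_and_pos_or_neg_and_neg_of_mul_pos hcon with h | h
      · rcases hside with h' | h' <;> linarith [h.1, h.2]
      · exact h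
    set G := slabOp n (1 / (2 * ε)) (-(1 / (2 * η))) with hG
    have ha := hu.left 0 G q.2 q.1 (slabOp_symm _ _) hΩ₁ hn.1.le (by
      filter_upwards [hu.isOpen.mem_nhds hΩ₁] with x hx
      have := hmax (x, q.2) ⟨hΩK hx, hq.2⟩
      rw [← Prod.mk.eta (p := q), doubled_eq, doubled_eq] at this
      simp only [quad, inner_zero_left, zero_add]
      linarith)
    have hb := hw.left 0 G q.1 q.2 (slabOp_symm _ _) hΩ₂ hn.2.le (by
      filter_upwards [hu.isOpen.mem_nhds hΩ₂] with y hy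
      have := hmax (q.1, y) ⟨hq.1, hΩK hy⟩
      rw [← Prod.mk.eta (p := q), doubled_eq, doubled_eq] at this
      simp only [quad, inner_zero_left, zero_add]
      rw [← neg_sub y q.1, ← neg_sub q.2 q.1, map_neg, map_neg, inner_neg_neg,
        inner_neg_neg] at this
      linarith)
    rw [zero_add] at ha hb
    have := hleft hn.1.le hn.2.le _ ha
    rw [← map_neg, neg_sub] at this
    linarith
  choose q hqK hqmax hqn using hstep
  obtain ⟨q₀, hq₀, φ, hφ, hlim⟩ := (hK.prod hK).tendsto_subseq hqK
  have hlimK : Tendsto (fun k => q (φ k)) atTop (𝓝[K ×ˢ K] q₀) :=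
    tendsto_nhdsWithin_iff.2 ⟨hlim, Eventually.of_forall fun k => hqK _⟩
  have hτ : Tendsto (fun k => 1 / (((φ k : ℕ) : ℝ) + 1)) atTop (𝓝 0) :=
    tendsto_one_div_add_atTop_nhds_zero_nat.comp hφ.tendsto_atTop
  have hqm : ∀ k : ℕ, m ≤ doubled u w ε (1 / ((k : ℝ) + 1)) (q k) := fun k => by
    rw [← hcenter (1 / ((k : ℝ) + 1))]
    exact hqmax k _ hz₀K
  have hqb := fun k : ℕ => hbound (1 / ((k : ℝ) + 1)) (by positivity) (q k) (hqK k) (hqm k)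
  have hc₁ : Continuous fun q : Euc (n + 1) × Euc (n + 1) => q.1 (Fin.last n) := by fun_prop
  have hc₂ : Continuous fun q : Euc (n + 1) × Euc (n + 1) => q.2 (Fin.last n) := by fun_prop
  have heq : q₀.1 (Fin.last n) = q₀.2 (Fin.last n) := by
    have h1 : (q₀.1 (Fin.last n) - q₀.2 (Fin.last n)) ^ 2 ≤ 2 * B * 0 :=
      le_of_tendsto_of_tendsto ((((hc₁.sub hc₂).pow 2).tendsto q₀).comp hlim) (hτ.const_mul _)
        (Eventually.of_forall fun k => (hqb _).2.2)
    have h2 := sq_nonneg (q₀.1 (Fin.last n) - q₀.2 (Fin.last n))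
    have h3 := pow_eq_zero_iff (two_ne_zero) |>.1 (le_antisymm (by linarith) h2)
    linarith
  have hprod : q₀.1 (Fin.last n) * q₀.2 (Fin.last n) ≤ 0 :=
    le_of_tendsto (((hc₁.mul hc₂).tendsto q₀).comp hlim) (Eventually.of_forall fun k => hqn _)
  have hzero₁ : q₀.1 (Fin.last n) = 0 := by
    rw [← heq] at hprod
    exact mul_self_eq_zero.1 (le_antisymm hprod (mul_self_nonneg _))
  have hzero₂ : q₀.2 (Fin.last n) = 0 := heq ▸ hzero₁
  have hm₀ : m ≤ u q₀.1 + w q₀.2 :=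
    ge_of_tendsto ((hsum q₀ hq₀).tendsto.comp hlimK) (Eventually.of_forall fun k => (hqb _).1)
  have hd₀ : ‖q₀.1 - q₀.2‖ ≤ d := by
    have hc : Continuous fun q : Euc (n + 1) × Euc (n + 1) => ‖q.1 - q.2‖ := by fun_prop
    exact le_of_tendsto ((hc.tendsto q₀).comp hlim) (Eventually.of_forall fun k => (hqb _).2.1)
  obtain ⟨hΩ₁, hΩ₂, -, hleft⟩ := hinc q₀.1 hq₀.1 q₀.2 hq₀.2 hd₀ hm₀
  obtain ⟨P, hP₁, hP₂⟩ := interface_pair hl hL hu hw hε hΩ₁ hΩ₂ hzero₁ hzero₂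
    fun x hx y hy hxy => by
      have hc : ContinuousOn (doubled u w ε 0) (K ×ˢ K) := continuousOn_doubled huK hwK ε 0
      have h1 : doubled u w ε 0 (x, y) ≤ doubled u w ε 0 q₀ := by
        refine ge_of_tendsto ((hc q₀ hq₀).tendsto.comp hlimK) (Eventually.of_forall fun k => ?_)
        have h2 := hqmax (φ k) (x, y) ⟨hΩK hx, hΩK hy⟩
        have h3 : 0 ≤ ((q (φ k)).1 (Fin.last n) - (q (φ k)).2 (Fin.last n)) ^ 2 /
            (2 * (1 / (((φ k : ℕ) : ℝ) + 1))) := by positivity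
        simp only [doubled, hxy, sub_self, ne_eq, OfNat.ofNat_ne_zero, not_false_eq_true,
          zero_pow, zero_div, mul_zero, div_zero, sub_zero, Function.comp_apply] at h2 ⊢
        linarith
      simpa [doubled] using h1
  linarith [hleft hzero₁.le hzero₂.le P hP₁]

end TransSub

end Comparison

section Assembly

variable {n : ℕ}

theorem gradient_neg_fun (φ : Euc n → ℝ) (x : Euc n) : gradient (-φ) x = -gradient φ x := by
  rw [gradient, fderiv_neg, map_neg, gradient]

theorem hessianMatrix_neg (φ : Euc n → ℝ) (x : Euc n) :
    hessianMatrix (-φ) x = -hessianMatrix φ x := by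
  ext i j
  simp [hessianMatrix, iteratedFDeriv_neg_apply]

theorem SubTest.neg {Ω : Set (Euc n)} {v φ : Euc n → ℝ} {x₀ : Euc n} {r : ℝ}
    (h : SubTest Ω (-v) x₀ φ r) : SupTest Ω v x₀ (-φ) r := by
  obtain ⟨h1, h2, h3, h4, h5⟩ := h
  refine ⟨h1, h2, h3.neg, fun x hx => ?_, ?_⟩
  · have := h4 x hx
    simp only [Pi.neg_apply] at this ⊢
    linarith
  · simp only [Pi.neg_apply] at h5 ⊢
    linarith

theorem LocallyLipschitzOp1.continuousOn {S : Set (Euc n)} {H : Euc n → ℝ → Euc n → ℝ}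
    (h : LocallyLipschitzOp1 S H) :
    ContinuousOn (fun q : Euc n × ℝ × Euc n => H q.1 q.2.1 q.2.2) (univ ×ˢ univ ×ˢ S) := by
  intro q hq
  obtain ⟨K, t, ht, hK⟩ := h q hq.2.2
  exact (hK.continuousOn q (mem_of_mem_nhdsWithin hq ht)).mono_of_mem_nhdsWithin ht

theorem subset_closure_left {Ω : Set (Euc (n + 1))} (hΩ : IsOpen Ω) :
    {x | x ∈ Ω ∧ x (Fin.last n) ≤ 0} ⊆ closure {x | x ∈ Ω ∧ x (Fin.last n) < 0} := by
  rintro x ⟨hx, hx0⟩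
  set g : ℝ → Euc (n + 1) := fun t => x - t • EuclideanSpace.single (Fin.last n) (1 : ℝ) with hg
  have hc : Continuous g := by fun_prop
  have h0 : g 0 = x := by simp [hg]
  have hlim : Tendsto g (𝓝[>] 0) (𝓝 x) := by
    have := hc.tendsto 0
    rw [h0] at this
    exact this.mono_left nhdsWithin_le_nhds
  refine mem_closure_of_tendsto hlim ?_
  filter_upwards [hlim.eventually (hΩ.mem_nhds hx), self_mem_nhdsWithin] with t ht ht0
  refine ⟨ht, ?_⟩
  have : g t (Fin.last n) = x (Fin.last n) - t := by simp [hg]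
  have h2 : 0 < t := ht0
  rw [this]
  linarith

theorem exists_lipschitz_left {Ω : Set (Euc (n + 1))} (hΩ : IsOpen Ω) {u : Euc (n + 1) → ℝ}
    (hu : ContinuousOn u (closure Ω)) {K : NNReal}
    (hK : LipschitzOnWith K u {x | x ∈ Ω ∧ x (Fin.last n) < 0}) :
    ∀ x₀ ∈ Ω, x₀ (Fin.last n) = 0 → ∃ K, ∃ r > 0, ∀ x ∈ ball x₀ r, ∀ y ∈ ball x₀ r,
      x (Fin.last n) ≤ 0 → y (Fin.last n) ≤ 0 → u x ≤ u y + K * ‖x - y‖ := by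
  intro x₀ hx₀ _
  obtain ⟨r, hr, hb⟩ := Metric.isOpen_iff.1 hΩ x₀ hx₀
  have hcl := hK.closure (hu.mono (closure_mono fun x hx => hx.1))
  refine ⟨K, r, hr, fun x hx y hy hx0 hy0 => ?_⟩
  have h := hcl.dist_le_mul x (subset_closure_left hΩ ⟨hb hx, hx0⟩) y
    (subset_closure_left hΩ ⟨hb hy, hy0⟩)
  rw [Real.dist_eq, dist_eq_norm] at h
  linarith [le_abs_self (u x - u y)]

theorem TransSub.of_subTest {l L : ℝ} {Ω : Set (Euc (n + 1))}
    {H : Euc (n + 1) → ℝ → Euc (n + 1) → ℝ}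
    {F : Matrix (Fin (n + 1)) (Fin (n + 1)) ℝ → Euc (n + 1) → ℝ → ℝ}
    {f : ℝ → Euc (n + 1) → ℝ} {u : Euc (n + 1) → ℝ} (hΩ : IsOpen Ω) (hu : ContinuousOn u Ω)
    (hH : ContinuousOn (fun q : Euc (n + 1) × ℝ × Euc (n + 1) => H q.1 q.2.1 q.2.2)
      (univ ×ˢ univ ×ˢ {x | x ∈ Ω ∧ x (Fin.last n) ≤ 0}))
    (hf : ContinuousOn (fun q : ℝ × Euc (n + 1) => f q.1 q.2)
      (univ ×ˢ {x | x ∈ Ω ∧ 0 ≤ x (Fin.last n)}))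
    (hF : LowerElliptic l L F)
    (hlip : ∀ x₀ ∈ Ω, x₀ (Fin.last n) = 0 → ∃ K, ∃ r > 0, ∀ x ∈ ball x₀ r, ∀ y ∈ ball x₀ r,
      x (Fin.last n) ≤ 0 → y (Fin.last n) ≤ 0 → u x ≤ u y + K * ‖x - y‖)
    (hsub : ∀ x₀ φ r, SubTest Ω u x₀ φ r → x₀ ∈ Ω →
      (x₀ (Fin.last n) ≤ 0 → H (gradient φ x₀) (φ x₀) x₀ ≤ 0) ∧
      (0 < x₀ (Fin.last n) →
        F (hessianMatrix φ x₀) (gradient φ x₀) (φ x₀) + f (φ x₀) x₀ ≤ 0)) :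
    TransSub l L Ω H F f u where
  isOpen := hΩ
  cont := hu
  contH := hH
  contf := hf
  ell := hF
  lip := hlip
  left P T x₀ x₁ hT hx₁ h0 hmax := by
    obtain ⟨r, hr⟩ := SubTest.exists_of_isLocalMax hΩ hx₁ hmax
    have h := (hsub _ _ _ hr hx₁).1 h0
    rwa [gradient_const_add_quad _ _ hT, sub_add_cancel] at h
  right P T x₀ x₁ hT hx₁ h0 hmax := by
    obtain ⟨r, hr⟩ := SubTest.exists_of_isLocalMax hΩ hx₁ hmax
    have h := (hsub _ _ _ hr hx₁).2 h0
    rwa [gradient_const_add_quad _ _ hT, hessianMatrix_const_add_quad _ _ hT,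
      sub_add_cancel] at h

/-- Comparison for the transmission problem, for sub-solutions that are strict by a constant `c`. -/
theorem comparison_of_strict {lam Lam : ℝ} (hlam : 0 < lam) (hLam : lam ≤ Lam)
    {Ω : Set (Euc (n + 1))} (hΩ : IsOpen Ω) (hΩb : IsBounded Ω)
    {Hm : Euc (n + 1) → ℝ → Euc (n + 1) → ℝ}
    (hHm : LocallyLipschitzOp1 {x | x ∈ Ω ∧ x (Fin.last n) ≤ 0} Hm)
    (hDE : DegElliptic1 {x | x ∈ Ω ∧ x (Fin.last n) ≤ 0} Hm)
    (hBS : BoundedSublevels1 {x | x ∈ Ω ∧ x (Fin.last n) ≤ 0} Hm)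
    {F : Matrix (Fin (n + 1)) (Fin (n + 1)) ℝ → Euc (n + 1) → ℝ → ℝ}
    {f : ℝ → Euc (n + 1) → ℝ} (hF : LowerElliptic lam Lam F)
    (hfC : ContinuousOn (fun q : ℝ × Euc (n + 1) => f q.1 q.2)
      (univ ×ˢ {x | x ∈ Ω ∧ 0 ≤ x (Fin.last n)}))
    (hfInc : ∀ x ∈ Ω, 0 ≤ x (Fin.last n) → ∀ z₁ z₂ : ℝ, z₁ < z₂ → f z₁ x < f z₂ x)
    {u v : Euc (n + 1) → ℝ} (huC : ContinuousOn u (closure Ω)) (hvC : ContinuousOn v (closure Ω))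
    (hul : ∀ x₀ ∈ Ω, x₀ (Fin.last n) = 0 → ∃ K, ∃ r > 0, ∀ x ∈ ball x₀ r, ∀ y ∈ ball x₀ r,
      x (Fin.last n) ≤ 0 → y (Fin.last n) ≤ 0 → u x ≤ u y + K * ‖x - y‖)
    (hvl : ∀ x₀ ∈ Ω, x₀ (Fin.last n) = 0 → ∃ K, ∃ r > 0, ∀ x ∈ ball x₀ r, ∀ y ∈ ball x₀ r,
      x (Fin.last n) ≤ 0 → y (Fin.last n) ≤ 0 → v x ≤ v y + K * ‖x - y‖) (c : ℝ)
    (hsub : ∀ x₀ φ r, SubTest Ω u x₀ φ r → x₀ ∈ Ω →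
      (x₀ (Fin.last n) ≤ 0 → Hm (gradient φ x₀) (φ x₀) x₀ + c ≤ 0) ∧
      (0 < x₀ (Fin.last n) →
        F (hessianMatrix φ x₀) (gradient φ x₀) (φ x₀) + f (φ x₀) x₀ ≤ 0))
    (hsup : ∀ x₀ φ r, SupTest Ω v x₀ φ r → x₀ ∈ Ω →
      (x₀ (Fin.last n) ≤ 0 → 0 ≤ Hm (gradient φ x₀) (φ x₀) x₀) ∧
      (0 < x₀ (Fin.last n) →
        0 ≤ F (hessianMatrix φ x₀) (gradient φ x₀) (φ x₀) + f (φ x₀) x₀))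
    (hstrict : ∀ x ∈ Ω, x (Fin.last n) ≤ 0 → v x < u x → ∀ P, Hm P (u x) x + c ≤ 0 →
      Hm P (v x) x < 0)
    (hbdry : ∀ x ∈ frontier Ω, u x ≤ v x) : ∀ x ∈ Ω, u x ≤ v x := by
  have hU : TransSub lam Lam Ω (fun p z x => Hm p z x + c) F f u :=
    TransSub.of_subTest hΩ (huC.mono subset_closure) (hHm.continuousOn.add continuousOn_const)
      hfC hF hul hsub
  have hW : TransSub lam Lam Ω (fun p z x => -Hm (-p) (-z) x) (fun M p z => -F (-M) (-p) (-z))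
      (fun z x => -f (-z) x) (-v) := by
    refine TransSub.of_subTest hΩ (hvC.mono subset_closure).neg ?_ ?_ hF.neg ?_ ?_
    · have hg : Continuous fun q : Euc (n + 1) × ℝ × Euc (n + 1) => (-q.1, -q.2.1, q.2.2) := by
        fun_prop
      exact (hHm.continuousOn.comp hg.continuousOn fun q hq => ⟨trivial, trivial, hq.2.2⟩).neg
    · have hg : Continuous fun q : ℝ × Euc (n + 1) => (-q.1, q.2) := by fun_prop
      exact (hfC.comp hg.continuousOn fun q hq => ⟨trivial, hq.2⟩).neg
    · intro x₀ hx₀ h0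
      obtain ⟨K, r, hr, h⟩ := hvl x₀ hx₀ h0
      refine ⟨K, r, hr, fun x hx y hy hx0 hy0 => ?_⟩
      have := h y hy x hx hy0 hx0
      rw [norm_sub_rev] at this
      simp only [Pi.neg_apply]
      linarith
    · intro x₀ φ r hφ hx₀
      have h := hsup x₀ (-φ) r hφ.neg hx₀
      rw [gradient_neg_fun, hessianMatrix_neg, Pi.neg_apply] at h
      exact ⟨fun h0 => neg_nonpos.2 (h.1 h0), fun h0 => by linarith [h.2 h0]⟩
  obtain ⟨B, hB⟩ := hΩb.isCompact_closure.exists_bound_of_continuousOn huC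
  obtain ⟨R, hR⟩ := isBounded_iff_forall_norm_le.1 (hBS (-B) (-c))
  have key := TransSub.comparison hlam hLam hΩb hU hW huC hvC.neg
    (fun x hx => by simpa using hbdry x hx)
    (fun x hx h0 hpos => by
      have hvu : v x < u x := by simpa using hpos
      have := hfInc x hx h0 _ _ hvu
      simpa using this)
    (R := R)
    (fun x hx h0 P hP => hR P ⟨x, ⟨hx, h0⟩, by
      have h1 := neg_abs_le (u x)
      have h2 := hB x (subset_closure hx)
      rw [Real.norm_eq_abs] at h2
      have h3 := hDE P (-B) (u x) x ⟨hx, h0⟩ (by linarith)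
      linarith⟩)
    (fun x hx h0 hpos P hP => by
      have hvu : v x < u x := by simpa using hpos
      simpa using hstrict x hx h0 hvu P hP)
  intro x hx
  simpa using key x hx

theorem eq_empty_of_monotone_gradient {S : Set (Euc n)} {H : Euc n → ℝ → Euc n → ℝ}
    (hBS : BoundedSublevels1 S H) {lam₀ : ℝ} (hlam₀ : 0 < lam₀) {e : Euc n} (he : ‖e‖ = 1)
    (h : ∀ p : Euc n, ∀ z t : ℝ, ∀ x ∈ S, 0 ≤ t → H p z x + lam₀ * t ≤ H (p + t • e) z x) :
    S = ∅ := by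
  by_contra hne
  obtain ⟨x, hx⟩ := nonempty_iff_ne_empty.2 hne
  obtain ⟨R, hR⟩ := isBounded_iff_forall_norm_le.1 (hBS 0 (H 0 0 x))
  have ht : 0 ≤ |R| + 1 := by positivity
  have h1 := h (-((|R| + 1) • e)) 0 (|R| + 1) x hx ht
  rw [neg_add_cancel] at h1
  have h2 := hR (-((|R| + 1) • e)) ⟨x, hx, by nlinarith [mul_nonneg hlam₀.le ht]⟩
  rw [norm_neg, norm_smul, he, mul_one, Real.norm_of_nonneg ht] at h2
  linarith [le_abs_self R]

theorem LowerElliptic.mono {l L : ℝ} (hL : l ≤ L)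
    {F : Matrix (Fin n) (Fin n) ℝ → Euc n → ℝ → ℝ} (hF : LowerElliptic l L F)
    (M : Matrix (Fin n) (Fin n) ℝ) (p : Euc n) {z₁ z₂ : ℝ} (h : z₁ ≤ z₂) :
    F M p z₁ ≤ F M p z₂ := by
  have h1 := hF M M p p z₁ z₂
  have h2 : 0 ≤ pucciMinus l L (M - M) := le_pucciMinus hL fun A _ => by simp
  rw [max_eq_right (by linarith), sub_self p, norm_zero] at h1
  linarith

/-- A test function for the combination `(1 - θ) u + θ β - θ C` of `u` with a `C²` function `β`
induces a test function for `u`. -/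
theorem SubTest.of_convexCombination {Ω : Set (Euc n)} {u β φ : Euc n → ℝ}
    {θ C r : ℝ} {x₀ : Euc n} (hθ : θ < 1) (hβ : ContDiffOn ℝ 2 β Ω)
    (h : SubTest Ω (fun x => (1 - θ) * u x + θ * β x - θ * C) x₀ φ r) :
    SubTest Ω u x₀ (fun x => (1 - θ)⁻¹ * (φ x - θ * β x + θ * C)) r := by
  obtain ⟨h1, h2, h3, h4, h5⟩ := h
  have hpos : 0 < 1 - θ := by linarith
  refine ⟨h1, h2, ?_, fun x hx => ?_, ?_⟩
  · exact contDiffOn_const.mul ((h3.sub (contDiffOn_const.mul (hβ.mono h2))).add contDiffOn_const)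
  · have := h4 x hx
    beta_reduce at this ⊢
    rw [inv_mul_eq_div, le_div_iff₀ hpos]
    linarith
  · beta_reduce at h5 ⊢
    rw [inv_mul_eq_div, eq_div_iff hpos.ne']
    linarith

theorem gradient_convexCombination {β φ : Euc n → ℝ} {θ C : ℝ} {x₀ : Euc n} (hθ : θ < 1)
    (hβ : DifferentiableAt ℝ β x₀) (hφ : DifferentiableAt ℝ φ x₀) :
    (1 - θ) • gradient (fun x => (1 - θ)⁻¹ * (φ x - θ * β x + θ * C)) x₀ + θ • gradient β x₀ =
      gradient φ x₀ := by
  have hpos : 1 - θ ≠ 0 := by linarith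
  have h : HasFDerivAt (fun x => (1 - θ)⁻¹ * (φ x - θ * β x + θ * C))
      ((1 - θ)⁻¹ • (fderiv ℝ φ x₀ - θ • fderiv ℝ β x₀)) x₀ :=
    ((hφ.hasFDerivAt.sub (hβ.hasFDerivAt.const_mul θ)).add_const (θ * C)).const_mul (1 - θ)⁻¹
  have hg : gradient (fun x => (1 - θ)⁻¹ * (φ x - θ * β x + θ * C)) x₀ =
      (1 - θ)⁻¹ • (gradient φ x₀ - θ • gradient β x₀) := by
    rw [gradient, h.fderiv]
    simp [gradient]
  rw [hg, smul_inv_smul₀ hpos, sub_add_cancel]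

end Assembly

theorem statement_5 {n : ℕ} (lam Lam : ℝ) (hlam : 0 < lam) (hLam : lam ≤ Lam)
    (Ω Ωm Ωp Γ : Set (Euc (n + 1)))
    (hΩ : IsOpen Ω) (hΩb : Bornology.IsBounded Ω)
    (hΩm : Ωm = Ω ∩ {x | x (Fin.last n) < 0})
    (hΩp : Ωp = Ω ∩ {x | 0 < x (Fin.last n)})
    (hΓ : Γ = Ω ∩ {x | x (Fin.last n) = 0})
    (Hm : Euc (n + 1) → ℝ → Euc (n + 1) → ℝ)
    (hHmLip : LocallyLipschitzOp1 (Ωm ∪ Γ) Hm)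
    (hHmDE : DegElliptic1 (Ωm ∪ Γ) Hm)
    (hHmQC : QuasiConvex1 (Ωm ∪ Γ) Hm)
    (hHmBS : BoundedSublevels1 (Ωm ∪ Γ) Hm)
    (Hp : Matrix (Fin (n + 1)) (Fin (n + 1)) ℝ → Euc (n + 1) → ℝ → Euc (n + 1) → ℝ)
    (F : Matrix (Fin (n + 1)) (Fin (n + 1)) ℝ → Euc (n + 1) → ℝ → ℝ)
    (f : ℝ → Euc (n + 1) → ℝ)
    (hHp : ∀ M p z x, Hp M p z x = F M p z + f z x)
    (hHpDE : DegElliptic2 (Ωp ∪ Γ) Hp)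
    (hFC : Continuous fun q : Matrix (Fin (n + 1)) (Fin (n + 1)) ℝ × Euc (n + 1) × ℝ =>
      F q.1 q.2.1 q.2.2)
    (hFUE : UnifEllipticF lam Lam F)
    (hfC : ContinuousOn (fun q : ℝ × Euc (n + 1) => f q.1 q.2) (univ ×ˢ (Ωp ∪ Γ)))
    (hfInc : ∀ x ∈ Ωp ∪ Γ, ∀ z₁ z₂ : ℝ, z₁ < z₂ → f z₁ x < f z₂ x)
    (u v : Euc (n + 1) → ℝ)
    (huC : ContinuousOn u (closure Ω)) (hvC : ContinuousOn v (closure Ω))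
    (huLip : ∃ K : NNReal, LipschitzOnWith K u Ωm)
    (hvLip : ∃ K : NNReal, LipschitzOnWith K v Ωm)
    (hextra :
      (∃ lam₀ : ℝ, 0 < lam₀ ∧
        (∀ p : Euc (n + 1), ∀ z h : ℝ, ∀ x ∈ Ωm ∪ Γ, 0 ≤ h →
          Hm p z x + lam₀ * h ≤ Hm p (z + h) x) ∧
        (∀ M : Matrix (Fin (n + 1)) (Fin (n + 1)) ℝ, ∀ p : Euc (n + 1), ∀ z h : ℝ,
          ∀ x ∈ Ωp ∪ Γ, 0 ≤ h → Hp M p z x + lam₀ * h ≤ Hp M p (z + h) x)) ∨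
      (∃ lam₀ : ℝ, 0 < lam₀ ∧ ∃ e : Euc (n + 1), ‖e‖ = 1 ∧
        (∀ p : Euc (n + 1), ∀ z h : ℝ, ∀ x ∈ Ωm ∪ Γ, 0 ≤ h →
          Hm p z x + lam₀ * h ≤ Hm (p + h • e) z x) ∧
        (∀ M : Matrix (Fin (n + 1)) (Fin (n + 1)) ℝ, ∀ p : Euc (n + 1), ∀ z h : ℝ,
          ∀ x ∈ Ωp ∪ Γ, 0 ≤ h → Hp M p z x + lam₀ * h ≤ Hp M (p + h • e) z x)) ∨
      ((∀ p : Euc (n + 1), ∀ z z' : ℝ, ∀ x : Euc (n + 1), Hm p z x = Hm p z' x) ∧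
        (∀ M : Matrix (Fin (n + 1)) (Fin (n + 1)) ℝ, ∀ p : Euc (n + 1), ∀ z z' : ℝ,
          ∀ x : Euc (n + 1), Hp M p z x = Hp M p z' x) ∧
        (∀ x ∈ Ωm ∪ Γ, ConvexOn ℝ univ fun p : Euc (n + 1) => Hm p 0 x) ∧
        (∀ x ∈ Ωp ∪ Γ, ConvexOn ℝ
          (univ : Set (Matrix (Fin (n + 1)) (Fin (n + 1)) ℝ × Euc (n + 1)))
          fun q => Hp q.1 q.2 0 x) ∧
        ∃ β : Euc (n + 1) → ℝ, ∃ ηb : ℝ, 0 < ηb ∧ ContDiffOn ℝ 2 β (closure Ω) ∧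
          (∀ x ∈ Ωm ∪ Γ, Hm (gradient β x) (β x) x + ηb ≤ 0) ∧
          (∀ x ∈ Ωp ∪ Γ, Hp (hessianMatrix β x) (gradient β x) (β x) x + ηb ≤ 0)))
    (husub : ∀ x₀ : Euc (n + 1), ∀ φ : Euc (n + 1) → ℝ, ∀ r : ℝ, SubTest Ω u x₀ φ r →
      (x₀ ∈ Ωm ∪ Γ → evalOp1 Hm φ x₀ ≤ 0) ∧ (x₀ ∈ Ωp → evalOp2 Hp φ x₀ ≤ 0))
    (hvsup : ∀ x₀ : Euc (n + 1), ∀ φ : Euc (n + 1) → ℝ, ∀ r : ℝ, SupTest Ω v x₀ φ r →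
      (x₀ ∈ Ωm ∪ Γ → 0 ≤ evalOp1 Hm φ x₀) ∧ (x₀ ∈ Ωp → 0 ≤ evalOp2 Hp φ x₀))
    (hbdry : ∀ x ∈ frontier Ω, u x ≤ v x) :
    ∀ x ∈ Ω, u x ≤ v x := by
  have hleft : Ωm ∪ Γ = {x | x ∈ Ω ∧ x (Fin.last n) ≤ 0} := by
    ext x
    simp only [hΩm, hΓ, mem_union, mem_inter_iff, mem_ofPred_eq, ← and_or_left, le_iff_lt_or_eq]
  have hright : Ωp ∪ Γ = {x | x ∈ Ω ∧ 0 ≤ x (Fin.last n)} := by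
    ext x
    simp only [hΩp, hΓ, mem_union, mem_inter_iff, mem_ofPred_eq, ← and_or_left, le_iff_lt_or_eq,
      eq_comm (a := (0 : ℝ))]
  have hFL : LowerElliptic lam Lam F := fun M₁ M₂ p₁ p₂ z₁ z₂ => (hFUE M₁ M₂ p₁ p₂ z₁ z₂).1
  rw [hleft] at hHmLip hHmDE hHmBS hextra husub hvsup
  rw [hright] at hfC hfInc hextra
  obtain ⟨Ku, hKu⟩ := huLip
  obtain ⟨Kv, hKv⟩ := hvLip
  rw [hΩm] at hKu hKv
  have hul := exists_lipschitz_left hΩ huC hKu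
  have hvl := exists_lipschitz_left hΩ hvC hKv
  have hfInc' : ∀ x ∈ Ω, 0 ≤ x (Fin.last n) → ∀ z₁ z₂ : ℝ, z₁ < z₂ → f z₁ x < f z₂ x :=
    fun x hx h0 => hfInc x ⟨hx, h0⟩
  have hsub : ∀ x₀ φ r, SubTest Ω u x₀ φ r → x₀ ∈ Ω →
      (x₀ (Fin.last n) ≤ 0 → Hm (gradient φ x₀) (φ x₀) x₀ ≤ 0) ∧
      (0 < x₀ (Fin.last n) →
        F (hessianMatrix φ x₀) (gradient φ x₀) (φ x₀) + f (φ x₀) x₀ ≤ 0) :=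
    fun x₀ φ r h hx₀ => ⟨fun h0 => (husub x₀ φ r h).1 ⟨hx₀, h0⟩, fun h0 => by
      have := (husub x₀ φ r h).2 (hΩp ▸ ⟨hx₀, h0⟩)
      rwa [evalOp2, hHp] at this⟩
  have hsup : ∀ x₀ φ r, SupTest Ω v x₀ φ r → x₀ ∈ Ω →
      (x₀ (Fin.last n) ≤ 0 → 0 ≤ Hm (gradient φ x₀) (φ x₀) x₀) ∧
      (0 < x₀ (Fin.last n) →
        0 ≤ F (hessianMatrix φ x₀) (gradient φ x₀) (φ x₀) + f (φ x₀) x₀) :=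
    fun x₀ φ r h hx₀ => ⟨fun h0 => (hvsup x₀ φ r h).1 ⟨hx₀, h0⟩, fun h0 => by
      have := (hvsup x₀ φ r h).2 (hΩp ▸ ⟨hx₀, h0⟩)
      rwa [evalOp2, hHp] at this⟩
  have hsub₀ : ∀ x₀ φ r, SubTest Ω u x₀ φ r → x₀ ∈ Ω →
      (x₀ (Fin.last n) ≤ 0 → Hm (gradient φ x₀) (φ x₀) x₀ + 0 ≤ 0) ∧
      (0 < x₀ (Fin.last n) →
        F (hessianMatrix φ x₀) (gradient φ x₀) (φ x₀) + f (φ x₀) x₀ ≤ 0) := by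
    simpa only [add_zero] using hsub
  rcases hextra with ⟨lam₀, hlam₀, hmono, -⟩ | ⟨lam₀, hlam₀, e, he, hmono, -⟩ |
    ⟨hHz, hHpz, hconv, -, β, η, hη, hβ, hβH, -⟩
  · refine comparison_of_strict hlam hLam hΩ hΩb hHmLip hHmDE hHmBS hFL hfC hfInc' huC hvC hul hvl 0
      hsub₀ hsup (fun x hx h0 hvu P hP => ?_) hbdry
    have h1 := hmono P (v x) (u x - v x) x ⟨hx, h0⟩ (by linarith)
    rw [add_sub_cancel] at h1
    have h2 := mul_pos hlam₀ (sub_pos.2 hvu)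
    linarith
  · have hempty := eq_empty_of_monotone_gradient hHmBS hlam₀ he hmono
    refine comparison_of_strict hlam hLam hΩ hΩb hHmLip hHmDE hHmBS hFL hfC hfInc' huC hvC hul hvl 0
      hsub₀ hsup (fun x hx h0 => ?_) hbdry
    exact absurd (show x ∈ {x | x ∈ Ω ∧ x (Fin.last n) ≤ 0} from ⟨hx, h0⟩) (by simp [hempty])
  · have hneg : ∀ x ∈ Ω, x (Fin.last n) < 0 := by
      intro x hx
      by_contra! h0
      have h1 := hHpz 0 0 0 1 x
      rw [hHp, hHp] at h1
      have h2 := hfInc' x hx h0 0 1 one_pos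
      have h3 := hFL.mono hLam 0 0 (zero_le_one' ℝ)
      linarith
    obtain ⟨C, hC⟩ := hΩb.isCompact_closure.exists_bound_of_continuousOn
      (hβ.continuousOn.sub huC)
    have hθ : ∀ θ : ℝ, 0 < θ → θ < 1 → ∀ x ∈ Ω, (1 - θ) * u x + θ * β x - θ * C ≤ v x := by
      intro θ hθ0 hθ1
      have hle : ∀ x ∈ closure Ω, (1 - θ) * u x + θ * β x - θ * C ≤ u x := fun x hx => by
        have := mul_le_mul_of_nonneg_left ((le_abs_self _).trans (hC x hx)) hθ0.le
        simp only [Pi.sub_apply] at this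
        linarith
      refine comparison_of_strict (u := fun x => (1 - θ) * u x + θ * β x - θ * C) hlam hLam hΩ hΩb
        hHmLip hHmDE hHmBS hFL hfC hfInc'
        (((continuousOn_const.mul huC).add (continuousOn_const.mul hβ.continuousOn)).sub
          continuousOn_const) hvC
        (fun x hx h0 => absurd h0 (hneg x hx).ne) hvl (θ * η) (fun x φ r h hx => ?_) hsup
        (fun x hx h0 hvu P hP => ?_)
        (fun x hx => (hle x (frontier_subset_closure hx)).trans (hbdry x hx))
      · refine ⟨fun h0 => ?_, fun h0 => absurd h0 (hneg x hx).not_gt⟩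
        have hβΩ := hβ.mono subset_closure
        have hb := ball_mem_nhds x h.1
        have h1 := (hsub _ _ _ (h.of_convexCombination hθ1 hβΩ) hx).1 h0
        have h2 := hβH x ⟨hx, h0⟩
        rw [hHz _ _ 0] at h1 h2 ⊢
        have h3 := (hconv x ⟨hx, h0⟩).2 (mem_univ _) (mem_univ _) (sub_pos.2 hθ1).le hθ0.le
          (sub_add_cancel 1 θ)
          (x := gradient (fun x => (1 - θ)⁻¹ * (φ x - θ * β x + θ * C)) x) (y := gradient β x)
        rw [gradient_convexCombination hθ1
          ((hβΩ.contDiffAt (hΩ.mem_nhds hx)).differentiableAt two_ne_zero)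
          ((h.2.2.1.contDiffAt hb).differentiableAt two_ne_zero)] at h3
        simp only [smul_eq_mul] at h3
        have h4 := mul_nonpos_of_nonneg_of_nonpos (sub_pos.2 hθ1).le h1
        have h5 := mul_le_mul_of_nonneg_left h2 hθ0.le
        linarith
      · rw [hHz _ _ 0] at hP ⊢
        linarith [mul_pos hθ0 hη]
    intro x hx
    have hlim : Tendsto (fun θ : ℝ => (1 - θ) * u x + θ * β x - θ * C) (𝓝[>] 0) (𝓝 (u x)) := by
      have hc : Continuous fun θ : ℝ => (1 - θ) * u x + θ * β x - θ * C := by fun_prop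
      have := hc.tendsto 0
      simp only [sub_zero, one_mul, zero_mul, add_zero] at this
      exact this.mono_left nhdsWithin_le_nhds
    refine le_of_tendsto hlim ?_
    filter_upwards [Ioo_mem_nhdsGT (zero_lt_one' ℝ)] with θ hθI
    exact hθ θ hθI.1 hθI.2 x hx

end
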